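/- arXiv:2010.04982 — 3 statements merged into one kernel-verified Lean document; each statement's English description precedes it below -/
import Mathlib

section
/- For every fixed α ∈ (0, 0.13) there is a constant K = K(α) > 0 such that the following holds for m square-free with least prime factor p_1 = P^-(m) sufficiently large (in terms of α). Let t = ω(m) and let C be a set of non-negative integers less than p_1 with |C| ≥ α·2^t·log p_1 and t ≤ p_1^{0.01}. Then |N_m(C)| ≤ K·m·p_1^{−α}. -/
open Finset

/-- The set of quadratic residues modulo `M`, as a finset of `ZMod M`. -/
def QR (M : ℕ) : Finset (ZMod M) := (Finset.range M).image (fun a : ℕ => ((a : ZMod M)) ^ 2)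

/-- The "universe" finset of `ZMod M` (all residues), valid for any `M ≥ 1`. -/
def univM (M : ℕ) : Finset (ZMod M) := (Finset.range M).image (fun a : ℕ => (a : ZMod M))

/-- `RN_M(C₁, C₂)` for `C₁, C₂ ⊆ Z_M`: the set of `x ∈ Z_M` with `x + c₁ ∈ R_M` for all
`c₁ ∈ C₁` and `x + c₂ ∉ R_M` for all `c₂ ∈ C₂`. -/
def RNsetZ (M : ℕ) (C₁ C₂ : Finset (ZMod M)) : Finset (ZMod M) :=
  (univM M).filter (fun x => (∀ c ∈ C₁, x + c ∈ QR M) ∧ (∀ c ∈ C₂, x + c ∉ QR M))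

/-- `RN_M(C₁, C₂)` for sets `C₁, C₂` of non-negative integers, identified with their
residues in `Z_M`. -/
def RNset (M : ℕ) (C₁ C₂ : Finset ℕ) : Finset (ZMod M) :=
  (univM M).filter
    (fun x => (∀ c ∈ C₁, x + (c : ZMod M) ∈ QR M) ∧ (∀ c ∈ C₂, x + (c : ZMod M) ∉ QR M))

/-- `N_M(C)` for a set `C` of non-negative integers (identified with residues in `Z_M`):
the set of `x ∈ Z_M` with `x + c ∉ R_M` for all `c ∈ C`. -/
def Nset (M : ℕ) (C : Finset ℕ) : Finset (ZMod M) :=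
  (univM M).filter (fun x => ∀ c ∈ C, x + (c : ZMod M) ∉ QR M)

open Polynomial in
lemma exists_iterate_derivative_pow_mul {F : Type*} [Field F] (f : F[X]) (e : ℕ) :
    ∀ k ≤ e, ∃ L : F[X] →ₗ[F] F[X],
      (∀ u v : F[X], derivative v = 0 →
        derivative^[k] (f ^ e * u * v) = f ^ (e - k) * L u * v) ∧
      ∀ u, (L u).natDegree ≤ u.natDegree + k * f.natDegree := by
  intro k
  induction k with
  | zero => exact fun _ => ⟨LinearMap.id, by simp, by simp⟩
  | succ k ih =>
    intro hk
    obtain ⟨L, hL, hdeg⟩ := ih (by omega)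
    refine ⟨LinearMap.mulLeft F (C ((e - k : ℕ) : F) * derivative f) ∘ₗ L +
      LinearMap.mulLeft F f ∘ₗ derivative ∘ₗ L, fun u v hv => ?_, fun u => ?_⟩
    · obtain ⟨n, hn⟩ : ∃ n, e - k = n + 1 := ⟨e - k - 1, by omega⟩
      have hn' : e - (k + 1) = n := by omega
      rw [Function.iterate_succ_apply', hL u v hv, hn', hn]
      simp only [derivative_mul, hv, derivative_pow_succ, LinearMap.add_apply,
        LinearMap.comp_apply, LinearMap.mulLeft_apply]
      push_cast
      ring
    · simp only [LinearMap.add_apply, LinearMap.comp_apply, LinearMap.mulLeft_apply]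
      have h1 := hdeg u
      have h2 := natDegree_derivative_le f
      have h3 := natDegree_derivative_le (L u)
      rw [add_mul]
      refine natDegree_add_le_of_degree_le ?_ ?_
      · rw [mul_assoc]
        refine (natDegree_C_mul_le _ _).trans (natDegree_mul_le.trans ?_)
        omega
      · refine natDegree_mul_le.trans ?_
        omega

open Polynomial in
lemma eq_zero_of_mul_sq_eq_C_mul_sq {F : Type*} [Field F] {f r s : F[X]} {b c : F} (hb : b ≠ 0)
    (hc : f.rootMultiplicity c = 1) (h : f * r ^ 2 = C b * s ^ 2) : r = 0 ∧ s = 0 := by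
  classical
  have hf : f ≠ 0 := by
    rintro rfl
    simp at hc
  by_cases hr : r = 0
  · subst hr
    have : C b * s ^ 2 = 0 := by simpa using h.symm
    simpa [hb] using this
  exfalso
  have hne : f * r ^ 2 ≠ 0 := mul_ne_zero hf (pow_ne_zero _ hr)
  have h1 := congrArg (rootMultiplicity c) h
  rw [rootMultiplicity_mul hne, rootMultiplicity_mul (h ▸ hne), hc, rootMultiplicity_C,
    ← count_roots, ← count_roots, roots_pow, roots_pow, Multiset.count_nsmul,
    Multiset.count_nsmul] at h1
  omega

open Polynomial in
lemma eq_zero_of_sum_add_pow_mul_sum_eq_zero {p : ℕ} [Fact p.Prime] (hp : p ≠ 2)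
    {f : (ZMod p)[X]} (h0 : f.coeff 0 ≠ 0) {c : ZMod p} (hc : f.rootMultiplicity c = 1) {B : ℕ}
    (hB : f.natDegree + 2 * B ≤ p + 1) (J : ℕ) :
    ∀ r s : ℕ → (ZMod p)[X], (∀ j, (r j).natDegree < B) → (∀ j, (s j).natDegree < B) →
      ∑ j ∈ range J, r j * X ^ (p * j) + f ^ (p / 2) * ∑ j ∈ range J, s j * X ^ (p * j) = 0 →
      ∀ j < J, r j = 0 ∧ s j = 0 := by
  induction J with
  | zero => simp
  | succ J ih =>
    intro r s hr hs h
    have shift : ∀ u : ℕ → (ZMod p)[X], ∑ j ∈ range (J + 1), u j * X ^ (p * j) =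
        u 0 + X ^ p * ∑ j ∈ range J, u (j + 1) * X ^ (p * j) := by
      intro u
      rw [sum_range_succ', mul_sum, add_comm]
      simp only [mul_zero, pow_zero, mul_one, mul_add, pow_add]
      congr 1
      exact sum_congr rfl fun j _ => by ring
    rw [shift, shift] at h
    set R := ∑ j ∈ range J, r (j + 1) * X ^ (p * j)
    set S := ∑ j ∈ range J, s (j + 1) * X ^ (p * j)
    have hodd : p / 2 + p / 2 + 1 = p := by
      have := (Fact.out : p.Prime).eq_two_or_odd
      omega
    have hfp : f ^ p = f.comp (X ^ p) := by
      rw [← expand_eq_comp_X_pow, ZMod.expand_card]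
    obtain ⟨w, hw⟩ : (X : (ZMod p)[X]) ^ p ∣ f ^ p - C (f.coeff 0) := by
      have hX : (X : (ZMod p)[X]) ∣ f - C (f.coeff 0) := by
        rw [X_dvd_iff]; simp
      obtain ⟨w, hw⟩ := hX
      refine ⟨w.comp (X ^ p), ?_⟩
      rw [hfp]
      have := congrArg (fun q => q.comp (X ^ p)) hw
      simpa using this
    have key : f * (r 0 + X ^ p * R) ^ 2 = f ^ p * (s 0 + X ^ p * S) ^ 2 := by
      have h1 : r 0 + X ^ p * R = - (f ^ (p / 2) * (s 0 + X ^ p * S)) := by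
        linear_combination h
      have h2 : f ^ p = f ^ (p / 2 + p / 2 + 1) := congrArg (f ^ ·) hodd.symm
      rw [h1, h2]
      ring
    have hdvd : (X : (ZMod p)[X]) ^ p ∣ f * r 0 ^ 2 - C (f.coeff 0) * s 0 ^ 2 := by
      refine ⟨w * (s 0) ^ 2 + f ^ p * (2 * s 0 * S + X ^ p * S ^ 2) -
        f * (2 * r 0 * R + X ^ p * R ^ 2), ?_⟩
      linear_combination key + s 0 ^ 2 * hw
    have hzero : f * r 0 ^ 2 - C (f.coeff 0) * s 0 ^ 2 = 0 := by
      refine eq_zero_of_dvd_of_natDegree_lt hdvd ?_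
      rw [natDegree_X_pow]
      have h1 := hr 0
      have h2 := hs 0
      refine (natDegree_sub_le_of_le (m := f.natDegree + 2 * (B - 1)) (n := 2 * (B - 1))
        ?_ ?_).trans_lt ?_
      · refine natDegree_mul_le.trans (Nat.add_le_add_left (natDegree_pow_le.trans ?_) _)
        omega
      · refine (natDegree_C_mul_le _ _).trans (natDegree_pow_le.trans ?_)
        omega
      · rw [max_eq_left (by omega)]
        omega
    obtain ⟨hr0, hs0⟩ := eq_zero_of_mul_sq_eq_C_mul_sq h0 hc (sub_eq_zero.mp hzero)
    rw [hr0, hs0] at h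
    have h' : (X : (ZMod p)[X]) ^ p * (R + f ^ (p / 2) * S) = 0 := by linear_combination h
    have h'' := (mul_eq_zero.mp h').resolve_left (pow_ne_zero _ X_ne_zero)
    have := ih (fun j => r (j + 1)) (fun j => s (j + 1)) (fun j => hr _) (fun j => hs _) h''
    rintro (_ | j) hj
    · exact ⟨hr0, hs0⟩
    · exact this j (by omega)

open Polynomial in
lemma mul_card_le_natDegree_of_iterate_derivative {p : ℕ} [Fact p.Prime] {r : (ZMod p)[X]}
    (hr : r ≠ 0) {l : ℕ} (hl : l ≤ p) (S : Finset (ZMod p))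
    (h : ∀ x ∈ S, ∀ k < l, (derivative^[k] r).eval x = 0) : l * #S ≤ r.natDegree := by
  rcases Nat.eq_zero_or_pos l with rfl | hl0
  · simp
  calc l * #S = ∑ x ∈ S, l := by rw [sum_const, smul_eq_mul, mul_comm]
    _ ≤ ∑ x ∈ S, r.roots.count x := by
      refine sum_le_sum fun x hx => ?_
      rw [count_roots]
      have := lt_rootMultiplicity_of_isRoot_iterate_derivative_of_mem_nonZeroDivisors
        (t := x) (n := l - 1) hr (fun k hk => h x hx k (by omega)) ?_
      · omega
      · rw [mem_nonZeroDivisors_iff_ne_zero, Ne, ZMod.natCast_eq_zero_iff,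
          (Fact.out : p.Prime).dvd_factorial]
        omega
    _ ≤ ∑ x ∈ S ∪ r.roots.toFinset, r.roots.count x :=
      sum_le_sum_of_subset subset_union_left
    _ = r.roots.card := Multiset.sum_count_eq_card fun x hx => by
      simp [Multiset.mem_toFinset.mpr hx]
    _ ≤ r.natDegree := card_roots' r

open Polynomial in
lemma exists_ne_zero_forall_sum_eq_zero {F : Type*} [Field F] {B J l D : ℕ}
    (L M : ℕ → F[X] →ₗ[F] F[X])
    (hL : ∀ k < l, ∀ u, (L k u).natDegree ≤ u.natDegree + D)
    (hM : ∀ k < l, ∀ u, (M k u).natDegree ≤ u.natDegree + D) (a : F)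
    (hdim : l * (B + J + D) < 2 * J * B) :
    ∃ r s : ℕ → F[X], (∀ j, (r j).natDegree < B) ∧ (∀ j, (s j).natDegree < B) ∧
      (¬ ∀ j < J, r j = 0 ∧ s j = 0) ∧
      ∀ k < l, ∑ j ∈ range J, X ^ j * (L k (r j) + a • M k (s j)) = 0 := by
  have hBpos : 0 < B := Nat.pos_of_ne_zero (by rintro rfl; simp at hdim)
  let V := Fin J → degreeLT F B
  let Q (k : ℕ) : (V × V) →ₗ[F] F[X] :=
    ∑ j : Fin J, LinearMap.mulLeft F (X ^ (j : ℕ)) ∘ₗ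
      (L k ∘ₗ (Submodule.subtype _) ∘ₗ LinearMap.proj j ∘ₗ LinearMap.fst F V V +
        a • (M k ∘ₗ (Submodule.subtype _) ∘ₗ LinearMap.proj j ∘ₗ LinearMap.snd F V V))
  let Φ : (V × V) →ₗ[F] (Fin l → Fin (B + J + D) → F) :=
    LinearMap.pi fun k => LinearMap.pi fun i => lcoeff F i ∘ₗ Q k
  have hQ : ∀ k v, Q k v = ∑ j : Fin J, X ^ (j : ℕ) * (L k (v.1 j : F[X]) +
      a • M k (v.2 j : F[X])) := by
    intro k v
    simp only [Q, LinearMap.sum_apply]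
    rfl
  have hfin : Module.finrank F (degreeLT F B) = B := by
    rw [(degreeLTEquiv F B).finrank_eq]; simp
  have : Module.Finite F (degreeLT F B) := Module.Finite.equiv (degreeLTEquiv F B).symm
  have hker : LinearMap.ker Φ ≠ ⊥ := by
    apply LinearMap.ker_ne_bot_of_finrank_lt
    simp only [V, Module.finrank_prod, Module.finrank_pi_fintype, hfin, sum_const, card_univ,
      Fintype.card_fin, smul_eq_mul, Module.finrank_self, mul_one]
    calc _ < 2 * J * B := hdim
      _ = _ := by ring
  obtain ⟨v, hv, hv0⟩ := (Submodule.ne_bot_iff _).mp hker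
  have hdegB : ∀ u : degreeLT F B, (u : F[X]).natDegree < B := by
    intro u
    by_cases hu : (u : F[X]) = 0
    · simp [hu, hBpos]
    · exact (natDegree_lt_iff_degree_lt hu).mpr (mem_degreeLT.mp u.2)
  have hQ0 : ∀ k < l, Q k v = 0 := by
    intro k hk
    ext i
    rw [coeff_zero]
    by_cases hi : i < B + J + D
    · exact congrFun (congrFun (LinearMap.mem_ker.mp hv) ⟨k, hk⟩) ⟨i, hi⟩
    · refine coeff_eq_zero_of_natDegree_lt (lt_of_le_of_lt (b := B + J + D - 1) ?_ (by omega))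
      rw [hQ]
      refine natDegree_sum_le_of_forall_le _ _ fun j _ => ?_
      have h1 := hdegB (v.1 j)
      have h2 := hdegB (v.2 j)
      have h3 := hL k hk (v.1 j)
      have h4 := hM k hk (v.2 j)
      have hj := j.2
      have h6 : (L k (v.1 j : F[X]) + a • M k (v.2 j : F[X])).natDegree ≤ B - 1 + D :=
        natDegree_add_le_of_degree_le (by omega) ((natDegree_smul_le _ _).trans (by omega))
      refine natDegree_mul_le.trans ?_
      rw [natDegree_X_pow]
      omega
  refine ⟨fun j => if h : j < J then (v.1 ⟨j, h⟩ : F[X]) else 0,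
    fun j => if h : j < J then (v.2 ⟨j, h⟩ : F[X]) else 0, fun j => ?_, fun j => ?_, fun h => hv0 ?_,
    fun k hk => ?_⟩
  · dsimp only
    split_ifs
    · exact hdegB _
    · simpa using hBpos
  · dsimp only
    split_ifs
    · exact hdegB _
    · simpa using hBpos
  · refine Prod.ext (funext fun j => Subtype.ext ?_) (funext fun j => Subtype.ext ?_)
    · simpa using! (h j j.2).1
    · simpa using! (h j j.2).2
  · rw [← Fin.sum_univ_eq_sum_range (fun j => X ^ j *
      (L k (if h : j < J then (v.1 ⟨j, h⟩ : F[X]) else 0) +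
        a • M k (if h : j < J then (v.2 ⟨j, h⟩ : F[X]) else 0))), ← hQ0 k hk, hQ]
    exact sum_congr rfl fun j _ => by simp

open Polynomial in
lemma stepanov_mul_card_le {p : ℕ} [Fact p.Prime] (hp : p ≠ 2)
    {f : (ZMod p)[X]} (h0 : f.coeff 0 ≠ 0) {c : ZMod p} (hc : f.rootMultiplicity c = 1)
    (a : ZMod p) {B J l : ℕ} (hB : f.natDegree + 2 * B ≤ p + 1) (hl : l ≤ p)
    (hdim : l * (B + J + l * f.natDegree) < 2 * J * B) :
    l * #{x : ZMod p | f.eval x ^ (p / 2) = a} ≤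
      l * f.natDegree + p / 2 * f.natDegree + B + p * J := by
  set d := f.natDegree with hd
  set g := p / 2
  choose! L hL hLdeg using fun k => exists_iterate_derivative_pow_mul f l k
  choose! M hM hMdeg using fun k => exists_iterate_derivative_pow_mul f (l + g) k
  obtain ⟨r, s, hrdeg, hsdeg, hrs, hQ0⟩ := exists_ne_zero_forall_sum_eq_zero (l := l) L M
    (fun k hk u => (hLdeg k hk.le u).trans
      (Nat.add_le_add_left (Nat.mul_le_mul_right _ hk.le) _))
    (fun k hk u => (hMdeg k (by omega) u).trans
      (Nat.add_le_add_left (Nat.mul_le_mul_right _ hk.le) _)) a hdim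
  set R := ∑ j ∈ range J, r j * X ^ (p * j) with hR
  set S := ∑ j ∈ range J, s j * X ^ (p * j) with hS
  have hf : f ≠ 0 := by
    rintro rfl
    simp at h0
  have hne : f ^ l * (R + f ^ g * S) ≠ 0 := by
    refine mul_ne_zero (pow_ne_zero _ hf) fun h => hrs ?_
    exact eq_zero_of_sum_add_pow_mul_sum_eq_zero hp h0 hc hB J r s hrdeg hsdeg h
  have hderiv0 : ∀ j, derivative ((X : (ZMod p)[X]) ^ (p * j)) = 0 := by
    intro j
    rw [derivative_X_pow]
    simp
  refine (mul_card_le_natDegree_of_iterate_derivative hne hl _ fun x hx k hk => ?_).trans ?_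
  · have hx : f.eval x ^ g = a := by simpa using hx
    have e1 : f ^ l * (R + f ^ g * S) = ∑ j ∈ range J,
        (f ^ l * r j * X ^ (p * j) + f ^ (l + g) * s j * X ^ (p * j)) := by
      rw [hR, hS, sum_add_distrib, mul_add, mul_sum, mul_sum, mul_sum]
      congr 1
      · exact sum_congr rfl fun j _ => by ring
      · exact sum_congr rfl fun j _ => by ring
    have e2 := congrArg (eval x) (hQ0 k hk)
    rw [eval_finsetSum, eval_zero] at e2
    rw [e1, iterate_derivative_sum, eval_finsetSum]
    calc _ = ∑ j ∈ range J, eval x f ^ (l - k) *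
          (x ^ j * (eval x (L k (r j)) + a * eval x (M k (s j)))) := by
          refine sum_congr rfl fun j _ => ?_
          rw [iterate_map_add, hL k hk.le _ _ (hderiv0 j),
            hM k (by omega) _ _ (hderiv0 j), show l + g - k = g + (l - k) by omega]
          simp only [eval_add, eval_mul, eval_pow, eval_X, pow_add, pow_mul, ZMod.pow_card, hx]
          ring
      _ = 0 := by
          rw [← mul_sum]
          refine mul_eq_zero_of_right _ ?_
          simpa using e2
  · have hsum : ∀ u : ℕ → (ZMod p)[X], (∀ j, (u j).natDegree < B) →
        (∑ j ∈ range J, u j * X ^ (p * j)).natDegree ≤ B + p * J := by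
      intro u hu
      refine natDegree_sum_le_of_forall_le _ _ fun j hj => natDegree_mul_le.trans ?_
      rw [natDegree_X_pow]
      have h1 := hu j
      have h2 : p * j ≤ p * J := Nat.mul_le_mul_left _ (mem_range.mp hj).le
      omega
    have h1 := hR ▸ hsum r hrdeg
    have h2 := hS ▸ hsum s hsdeg
    refine natDegree_mul_le.trans ?_
    have h3 : (f ^ l).natDegree ≤ l * d := natDegree_pow_le
    have h4 : (f ^ g).natDegree ≤ g * d := natDegree_pow_le
    have h5 : (f ^ g * S).natDegree ≤ g * d + (B + p * J) :=
      natDegree_mul_le.trans (by omega)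
    have h6 : (R + f ^ g * S).natDegree ≤ g * d + (B + p * J) :=
      natDegree_add_le_of_degree_le (by omega) h5
    omega

open Polynomial in
lemma card_filter_pow_eq_le {p : ℕ} [Fact p.Prime] {T : Finset (ZMod p)} (hT : T.Nonempty)
    (h0 : 0 ∉ T) (hd : 16 * #T ^ 2 ≤ p) (a : ZMod p) :
    (#{x : ZMod p | (∏ c ∈ T, (x + c)) ^ (p / 2) = a} : ℝ) ≤ p / 2 + 9 * #T * √p := by
  set d := #T with hdT
  have hd1 : 1 ≤ d := hT.card_pos
  have hp16 : 16 ≤ p := by nlinarith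
  set f : (ZMod p)[X] := ∏ c ∈ T, (X + C c) with hf
  have hfdeg : f.natDegree = d := by
    rw [hf, natDegree_prod_of_monic _ _ fun c _ => monic_X_add_C c]
    simp [hdT]
  have hf0 : f.coeff 0 ≠ 0 := by
    rw [coeff_zero_eq_eval_zero, hf, eval_prod, prod_ne_zero_iff]
    intro c hc
    simpa using fun h : c = 0 => h0 (h ▸ hc)
  obtain ⟨c, hc⟩ := hT
  have hroot : f.rootMultiplicity (-c) = 1 := by
    have : f = ((T.image (-·)).val.map fun b => X - C b).prod := by
      rw [hf]
      change _ = ∏ b ∈ T.image (-·), (X - C b)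
      rw [prod_image fun x _ y _ h => neg_injective h]
      simp
    rw [← count_roots, this, roots_multiset_prod_X_sub_C]
    exact Multiset.count_eq_one_of_mem (nodup _) (mem_image_of_mem _ hc)
  set q := Nat.sqrt p
  set h := q / 2
  have hq4 : 4 ≤ q := Nat.le_sqrt.mpr (by omega)
  have hq1 : q * q ≤ p := Nat.sqrt_le p
  have hh : 2 * h ≤ q := by omega
  have hdq : 4 * d ≤ q := Nat.le_sqrt.mpr (by nlinarith)
  have hB : h * (h + 1) < (p + 1 - d) / 2 := by
    have h1 : (p + 1 - d) / 2 * 2 + 1 ≥ p + 1 - d := by omega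
    have h2 : 4 * (h * (h + 1)) ≤ p + 2 * q := by nlinarith
    have h3 : 4 * q ≤ p := by nlinarith
    omega
  have hst := stepanov_mul_card_le (by omega) hf0 hroot a
    (B := (p + 1 - d) / 2) (J := h + 2 * d + 1) (l := 2 * h) (by rw [hfdeg]; omega) (by nlinarith)
    (by rw [hfdeg]; nlinarith)
  simp only [hf, eval_prod, eval_add, eval_X, eval_C] at hst
  rw [← hf, hfdeg] at hst
  set N := #{x : ZMod p | (∏ c ∈ T, (x + c)) ^ (p / 2) = a}
  have hst' : (2 * h : ℝ) * N ≤ 2 * h * d + p / 2 * d + p / 2 + p * (h + 2 * d + 1) := by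
    have h1 : ((p / 2 : ℕ) : ℝ) ≤ p / 2 := Nat.cast_div_le
    have h2 : (((p + 1 - d) / 2 : ℕ) : ℝ) ≤ p / 2 := by
      refine Nat.cast_div_le.trans ?_
      have : ((p + 1 - d : ℕ) : ℝ) ≤ p := by exact_mod_cast (by omega)
      push_cast
      linarith
    have h3 : ((2 * h * N : ℕ) : ℝ) ≤ _ := Nat.cast_le.mpr hst
    push_cast at h3
    have h4 : ((p / 2 : ℕ) : ℝ) * d ≤ p / 2 * d := by gcongr
    linarith
  have hsq : √(p : ℝ) * √p = p := Real.mul_self_sqrt (Nat.cast_nonneg p)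
  have hs4 : 4 ≤ √(p : ℝ) := Real.le_sqrt_of_sq_le (by norm_num; exact_mod_cast hp16)
  have hhs : √(p : ℝ) / 2 ≤ 2 * h := by
    have h1 : √(p : ℝ) ≤ q + 1 := by
      refine Real.sqrt_le_iff.mpr ⟨by positivity, ?_⟩
      exact_mod_cast (by have := Nat.sqrt_lt'.mp (Nat.lt_succ_self p.sqrt); exact this.le)
    have h2 : (q : ℝ) ≤ 2 * h + 1 := by exact_mod_cast (by omega)
    linarith
  have hd1' : (1 : ℝ) ≤ d := by exact_mod_cast hd1
  have hmain : (2 * h : ℝ) * N ≤ (2 * h) * (p / 2 + 9 * d * √p) := by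
    refine hst'.trans ?_
    have h1 : √(p : ℝ) / 2 * (8 * d * √p) ≤ 2 * h * (8 * d * √p) := by gcongr
    have h2 : (2 * h : ℝ) * (1 * d * 1) ≤ 2 * h * (1 * d * √p) := by
      gcongr
      linarith
    have h3 : (p : ℝ) * 1 ≤ p * d := by gcongr
    nlinarith
  exact le_of_mul_le_mul_left hmain (by linarith)

lemma abs_sum_quadraticChar_prod_le_of_zero_notMem {p : ℕ} [Fact p.Prime] (hp : p ≠ 2)
    {T : Finset (ZMod p)} (hT : T.Nonempty) (h0 : 0 ∉ T) (hd : 16 * #T ^ 2 ≤ p) :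
    |∑ x : ZMod p, (quadraticChar (ZMod p) (∏ c ∈ T, (x + c)) : ℝ)| ≤ 19 * #T * √p := by
  set F : ZMod p → ZMod p := fun x => ∏ c ∈ T, (x + c) with hF
  have hchar : ringChar (ZMod p) ≠ 2 := by rwa [ZMod.ringChar_zmod_n]
  have hle : ∀ a : ℤ, (#{x | quadraticChar (ZMod p) (F x) = a} : ℝ) ≤ p / 2 + 9 * #T * √p := by
    intro a
    refine le_trans ?_ (card_filter_pow_eq_le hT h0 hd (a : ZMod p))
    norm_cast
    refine card_le_card fun x hx => ?_
    simp only [mem_filter, mem_univ, true_and] at hx ⊢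
    have := quadraticChar_eq_pow_of_char_ne_two' hchar (F x)
    rw [hx, ZMod.card] at this
    exact this.symm
  have hval : ∀ x, (quadraticChar (ZMod p) (F x) : ℝ) =
      (if quadraticChar (ZMod p) (F x) = 1 then 1 else 0) -
      (if quadraticChar (ZMod p) (F x) = -1 then 1 else 0) := by
    intro x
    by_cases hx : F x = 0
    · simp [hx]
    · rcases quadraticChar_dichotomy hx with h | h <;> simp [h]
  have hone : ∀ x, (1 : ℝ) ≤ (if quadraticChar (ZMod p) (F x) = 1 then 1 else 0) +
      (if quadraticChar (ZMod p) (F x) = -1 then 1 else 0) + ∑ c ∈ T, if x = -c then 1 else 0 := by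
    intro x
    by_cases hx : F x = 0
    · obtain ⟨c, hc, hxc⟩ := prod_eq_zero_iff.mp hx
      have h1 : (if x = -c then (1 : ℝ) else 0) ≤ ∑ c ∈ T, if x = -c then 1 else 0 :=
        single_le_sum (f := fun c => if x = -c then (1 : ℝ) else 0)
          (fun c _ => by split_ifs <;> norm_num) hc
      rw [if_pos (eq_neg_of_add_eq_zero_left hxc)] at h1
      simpa [hx] using h1
    · rcases quadraticChar_dichotomy hx with h | h <;> simp [h]
  have hcount : (p : ℝ) ≤ #{x | quadraticChar (ZMod p) (F x) = 1} +
      #{x | quadraticChar (ZMod p) (F x) = -1} + #T := by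
    have := sum_le_sum fun x (_ : x ∈ (univ : Finset (ZMod p))) => hone x
    rw [sum_add_distrib, sum_add_distrib, sum_comm] at this
    simpa [ZMod.card] using this
  have hsum : ∑ x, (quadraticChar (ZMod p) (F x) : ℝ) =
      #{x | quadraticChar (ZMod p) (F x) = 1} - #{x | quadraticChar (ZMod p) (F x) = -1} := by
    rw [sum_congr rfl fun x _ => hval x, sum_sub_distrib]
    simp
  have h1 := hle 1
  have h2 := hle (-1)
  have h3 : (#T : ℝ) * 1 ≤ #T * √p := by
    gcongr
    exact Real.one_le_sqrt.mpr (by exact_mod_cast (Fact.out : p.Prime).one_le)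
  rw [hsum, abs_le]
  have h4 : (#{x | quadraticChar (ZMod p) (F x) = 1} : ℝ) +
      #{x | quadraticChar (ZMod p) (F x) = -1} ≤ p := by
    norm_cast
    rw [← card_union_of_disjoint]
    · exact (card_le_univ _).trans_eq (ZMod.card p)
    · rw [disjoint_filter]
      intro x _ hx hx'
      rw [hx] at hx'
      exact absurd hx' (by decide)
  constructor <;> linarith

/-- A Weil-type bound for quadratic character sums over products of distinct linear factors. -/
lemma abs_sum_quadraticChar_prod_le {p : ℕ} [Fact p.Prime] (hp : p ≠ 2)
    {T : Finset (ZMod p)} (hT : T.Nonempty) :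
    |∑ x : ZMod p, (quadraticChar (ZMod p) (∏ c ∈ T, (x + c)) : ℝ)| ≤ 19 * #T * √p := by
  have hd1 : (1 : ℝ) ≤ #T := by exact_mod_cast hT.card_pos
  have hsq : √(p : ℝ) * √p = p := Real.mul_self_sqrt (Nat.cast_nonneg p)
  have hp1 : (1 : ℝ) ≤ p := by exact_mod_cast (Fact.out : p.Prime).one_le
  by_cases hd : 16 * #T ^ 2 ≤ p
  · obtain ⟨a, ha⟩ : ∃ a, a ∉ T.image (-·) := by
      by_contra! h
      have h1 : (univ : Finset (ZMod p)) ⊆ T.image (-·) := fun x _ => h x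
      have h2 := (card_le_card h1).trans card_image_le
      rw [card_univ, ZMod.card] at h2
      have := hT.card_pos
      nlinarith
    have hinj : Function.Injective (a + · : ZMod p → ZMod p) := add_right_injective a
    have hmem : (0 : ZMod p) ∉ T.image (a + ·) := by
      intro h
      obtain ⟨c, hc, hac⟩ := mem_image.mp h
      exact ha (mem_image.mpr ⟨c, hc, (eq_neg_of_add_eq_zero_left hac).symm⟩)
    have := abs_sum_quadraticChar_prod_le_of_zero_notMem hp (hT.image (a + ·)) hmem
      (by rwa [card_image_of_injective _ hinj])
    rw [card_image_of_injective _ hinj] at this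
    refine le_trans (le_of_eq ?_) this
    congr 1
    rw [← Equiv.sum_comp (Equiv.addRight a)]
    refine sum_congr rfl fun x _ => ?_
    rw [prod_image fun x _ y _ h => hinj h]
    simp [add_assoc]
  · have hd' : (p : ℝ) ≤ 16 * #T ^ 2 := by exact_mod_cast (not_le.mp hd).le
    have h1 : √(p : ℝ) ≤ 4 * #T := Real.sqrt_le_iff.mpr ⟨by positivity, by linarith⟩
    refine (abs_sum_le_sum_abs _ _).trans ((sum_le_card_nsmul _ _ 1 fun x _ => ?_).trans ?_)
    · by_cases hx : ∏ c ∈ T, (x + c) = 0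
      · simp [hx]
      · rcases quadraticChar_dichotomy hx with h | h <;> simp [h]
    · rw [card_univ, ZMod.card, nsmul_eq_mul, mul_one]
      have : 0 ≤ √(p : ℝ) := Real.sqrt_nonneg _
      nlinarith

lemma abs_card_isSquare_shifts_sub_le {p : ℕ} [Fact p.Prime] (hp : p ≠ 2) (S : Finset (ZMod p)) :
    |(#{x : ZMod p | ∀ c ∈ S, IsSquare (x + c)} : ℝ) - p / 2 ^ #S| ≤ 20 * #S * √p := by
  set χ := quadraticChar (ZMod p)
  have hchar : ringChar (ZMod p) ≠ 2 := by rwa [ZMod.ringChar_zmod_n]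
  have hsqrt : 1 ≤ √(p : ℝ) :=
    Real.one_le_sqrt.mpr (by exact_mod_cast (Fact.out : p.Prime).one_le)
  let w : ZMod p → ℝ := fun x => ∏ c ∈ S, ((1 + (χ (x + c) : ℝ)) / 2)
  have hχ : ∀ y : ZMod p, 0 ≤ (1 + (χ y : ℝ)) / 2 ∧ (1 + (χ y : ℝ)) / 2 ≤ 1 := by
    intro y
    by_cases hy : y = 0
    · rw [hy, MulChar.map_zero]
      norm_num
    · rcases quadraticChar_dichotomy hy with h | h <;> simp [χ, h]
  have hdiff : ∀ x, |(if ∀ c ∈ S, IsSquare (x + c) then (1 : ℝ) else 0) - w x| ≤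
      ∑ c ∈ S, if x = -c then 1 else 0 := by
    intro x
    by_cases hx : ∃ c ∈ S, x + c = 0
    · obtain ⟨c, hc, hxc⟩ := hx
      have h1 : (if x = -c then (1 : ℝ) else 0) ≤ ∑ c ∈ S, if x = -c then 1 else 0 :=
        single_le_sum (f := fun c => if x = -c then (1 : ℝ) else 0)
          (fun c _ => by split_ifs <;> norm_num) hc
      rw [if_pos (eq_neg_of_add_eq_zero_left hxc)] at h1
      refine le_trans ?_ h1
      have h2 : 0 ≤ w x := prod_nonneg fun c _ => (hχ _).1
      have h3 : w x ≤ 1 := prod_le_one (fun c _ => (hχ _).1) fun c _ => (hχ _).2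
      split_ifs <;> rw [abs_le] <;> constructor <;> linarith
    · push Not at hx
      have h1 : w x = if ∀ c ∈ S, IsSquare (x + c) then (1 : ℝ) else 0 := by
        split_ifs with h
        · refine prod_eq_one fun c hc => ?_
          rw [(quadraticChar_one_iff_isSquare (hx c hc)).mpr (h c hc)]
          norm_num
        · push Not at h
          obtain ⟨c, hc, hns⟩ := h
          refine prod_eq_zero hc ?_
          rw [quadraticChar_neg_one_iff_not_isSquare.mpr hns]
          norm_num
      rw [h1, sub_self, abs_zero]
      exact sum_nonneg fun c _ => by split_ifs <;> norm_num
  have hA : |(#{x : ZMod p | ∀ c ∈ S, IsSquare (x + c)} : ℝ) - ∑ x, w x| ≤ #S := by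
    have h1 : (#{x : ZMod p | ∀ c ∈ S, IsSquare (x + c)} : ℝ) - ∑ x, w x =
        ∑ x, ((if ∀ c ∈ S, IsSquare (x + c) then (1 : ℝ) else 0) - w x) := by
      rw [sum_sub_distrib]
      simp
    rw [h1]
    refine (abs_sum_le_sum_abs _ _).trans ((sum_le_sum fun x _ => hdiff x).trans ?_)
    rw [sum_comm]
    simp
  have hw : ∑ x, w x = (∑ T ∈ S.powerset, ∑ x, (χ (∏ c ∈ T, (x + c)) : ℝ)) / 2 ^ #S := by
    rw [sum_comm, sum_div]
    refine sum_congr rfl fun x _ => ?_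
    simp only [w, prod_div_distrib, prod_const, map_prod, Int.cast_prod]
    rw [prod_one_add]
  have hT0 : ∑ x : ZMod p, (χ (∏ c ∈ (∅ : Finset (ZMod p)), (x + c)) : ℝ) = p := by
    simp [ZMod.card]
  have hB : |∑ x, w x - p / 2 ^ #S| ≤ 19 * #S * √p := by
    rw [hw, ← sum_erase_add _ _ (empty_mem_powerset S), hT0, add_div, add_sub_cancel_right,
      abs_div, abs_of_pos (by positivity : (0 : ℝ) < 2 ^ #S), div_le_iff₀ (by positivity)]
    refine (abs_sum_le_sum_abs _ _).trans
      ((sum_le_card_nsmul _ _ (19 * #S * √p) fun T hT => ?_).trans ?_)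
    · rw [mem_erase, mem_powerset] at hT
      refine (abs_sum_quadraticChar_prod_le hp (nonempty_iff_ne_empty.mpr hT.1)).trans ?_
      gcongr
      exact hT.2
    · rw [nsmul_eq_mul, mul_comm]
      gcongr
      have := card_erase_le (s := S.powerset) (a := ∅)
      rw [card_powerset] at this
      exact_mod_cast this
  have h3 : (#S : ℝ) * 1 ≤ #S * √p := by gcongr
  calc _ ≤ _ := abs_sub_le _ (∑ x, w x) _
    _ ≤ 20 * #S * √p := by linarith

lemma card_forall_isSquare_eq_prod {m : ℕ} [NeZero m] (hm : Squarefree m)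
    [∀ p : m.primeFactors, Fact (p : ℕ).Prime] (S : Finset ℕ) :
    #{x : ZMod m | ∀ c ∈ S, IsSquare (x + (c : ZMod m))} =
      ∏ p : m.primeFactors, #{x : ZMod p | ∀ c ∈ S, IsSquare (x + (c : ZMod p))} := by
  have hcop : Pairwise (Function.onFun Nat.Coprime fun p : m.primeFactors => (p : ℕ)) :=
    fun p q hpq => (Nat.coprime_primes Fact.out Fact.out).mpr fun h => hpq (Subtype.ext h)
  have hprod : ∏ p : m.primeFactors, (p : ℕ) = m := by
    rw [prod_coe_sort m.primeFactors (fun p => p), Nat.prod_primeFactors_of_squarefree hm]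
  let e : ZMod m ≃+* ((p : m.primeFactors) → ZMod p) :=
    (ZMod.ringEquivCongr hprod.symm).trans (ZMod.prodEquivPi _ hcop)
  rw [← Fintype.card_piFinset]
  refine card_equiv e.toEquiv fun x => ?_
  simp only [mem_filter, mem_univ, true_and, Fintype.mem_piFinset]
  have hadd : ∀ (c : ℕ) (p : m.primeFactors), e x p + (c : ZMod p) = e (x + c) p := by
    intro c p
    simp
  have hiff : ∀ y : ZMod m, IsSquare y ↔ ∀ p, IsSquare (e y p) := by
    intro y
    refine ⟨fun ⟨z, hz⟩ p => ⟨e z p, by simp [hz]⟩, fun h => ?_⟩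
    choose z hz using h
    refine ⟨e.symm z, e.injective ?_⟩
    ext p
    rw [hz, map_mul, e.apply_symm_apply, Pi.mul_apply]
  constructor
  · intro h p c hc
    change IsSquare (e x p + c)
    rw [hadd]
    exact (hiff _).mp (h c hc) p
  · intro h c hc
    refine (hiff _).mpr fun p => ?_
    rw [← hadd]
    exact h p c hc

lemma abs_card_forall_isSquare_sub_le {m : ℕ} [NeZero m] (hm : Squarefree m)
    (hm2 : 2 < m.minFac) {S : Finset ℕ} (hS : ∀ c ∈ S, c < m.minFac) :
    |(#{x : ZMod m | ∀ c ∈ S, IsSquare (x + (c : ZMod m))} : ℝ) -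
        m / (2 ^ #m.primeFactors) ^ #S| ≤
      m / (2 ^ #m.primeFactors) ^ #S *
        (Real.exp (#m.primeFactors * (20 * #S * 2 ^ #S / √m.minFac)) - 1) := by
  have hfact : ∀ p : m.primeFactors, Fact (p : ℕ).Prime :=
    fun p => ⟨Nat.prime_of_mem_primeFactors p.2⟩
  have hle : ∀ p : m.primeFactors, m.minFac ≤ p := fun p =>
    Nat.minFac_le_of_dvd (hfact p).out.two_le (Nat.dvd_of_mem_primeFactors p.2)
  have hprod : ∏ p : m.primeFactors, ((p : ℕ) : ℝ) = m := by
    rw [← Nat.cast_prod, prod_coe_sort m.primeFactors (fun p => p),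
      Nat.prod_primeFactors_of_squarefree hm]
  let A : m.primeFactors → ℝ := fun p => #{x : ZMod p | ∀ c ∈ S, IsSquare (x + (c : ZMod p))}
  let δ : m.primeFactors → ℝ := fun p => A p * 2 ^ #S / p - 1
  have hA : ∀ p, A p = p / 2 ^ #S * (1 + δ p) := by
    intro p
    have : (0 : ℝ) < p := by exact_mod_cast (hfact p).out.pos
    simp only [δ]
    field_simp
    ring
  have hδ : ∀ p, ‖δ p‖ ≤ 20 * #S * 2 ^ #S / √m.minFac := by
    intro p
    have hp0 : (0 : ℝ) < p := by exact_mod_cast (hfact p).out.pos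
    have hinj : Set.InjOn (fun c : ℕ => (c : ZMod p)) S := by
      intro a ha b hb hab
      have := (ZMod.natCast_eq_natCast_iff' a b p).mp hab
      rwa [Nat.mod_eq_of_lt ((hS a ha).trans_le (hle p)),
        Nat.mod_eq_of_lt ((hS b hb).trans_le (hle p))] at this
    have h1 := abs_card_isSquare_shifts_sub_le (p := p) (by have := hle p; omega)
      (S.image fun c : ℕ => (c : ZMod p))
    rw [card_image_of_injOn hinj] at h1
    simp only [forall_mem_image] at h1
    change |A p - _| ≤ _ at h1
    have h2 : A p - p / 2 ^ #S = δ p * (p / 2 ^ #S) := by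
      rw [hA]; ring
    rw [h2, abs_mul, abs_of_pos (by positivity : (0 : ℝ) < p / 2 ^ #S)] at h1
    have hsq : √(p : ℝ) * √p = p := Real.mul_self_sqrt hp0.le
    have hs0 : 0 < √(p : ℝ) := Real.sqrt_pos.mpr hp0
    have h3 : ‖δ p‖ ≤ 20 * #S * 2 ^ #S / √(p : ℝ) := by
      rw [Real.norm_eq_abs, le_div_iff₀ hs0]
      rw [mul_div_assoc', div_le_iff₀ (by positivity)] at h1
      refine le_of_mul_le_mul_right ?_ hs0
      rw [mul_assoc, hsq]
      linarith
    refine h3.trans ?_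
    have hmin : (0 : ℝ) < √m.minFac := Real.sqrt_pos.mpr (by exact_mod_cast (by omega))
    exact div_le_div_of_nonneg_left
      (mul_nonneg (mul_nonneg (by norm_num) (Nat.cast_nonneg _)) (by positivity)) hmin
      (Real.sqrt_le_sqrt (Nat.cast_le.mpr (hle p)))
  have hmain : (#{x : ZMod m | ∀ c ∈ S, IsSquare (x + (c : ZMod m))} : ℝ) =
      m / (2 ^ #m.primeFactors) ^ #S * ∏ p, (1 + δ p) := by
    rw [card_forall_isSquare_eq_prod hm, Nat.cast_prod]
    change ∏ p, A p = _
    rw [prod_congr rfl fun p _ => hA p, prod_mul_distrib, prod_div_distrib, hprod]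
    rw [prod_const, card_univ, Fintype.card_coe, ← pow_mul, ← pow_mul, mul_comm #S]
  rw [hmain, ← mul_sub_one, abs_mul,
    abs_of_nonneg (by positivity : (0 : ℝ) ≤ m / (2 ^ #m.primeFactors) ^ #S)]
  gcongr
  refine (norm_prod_one_add_sub_one_le univ δ).trans ?_
  gcongr
  refine (sum_le_card_nsmul _ _ _ fun p _ => hδ p).trans_eq ?_
  simp

lemma card_filter_forall_not_le_alternating_sum {ι κ : Type*} [DecidableEq ι] (X : Finset κ)
    (C : Finset ι) (A : κ → ι → Prop) [∀ x c, Decidable (A x c)] (l : ℕ) :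
    (#{x ∈ X | ∀ c ∈ C, ¬ A x c} : ℝ) ≤ ∑ j ∈ range (2 * l + 1),
      (-1) ^ j * ∑ S ∈ powersetCard j C, (#{x ∈ X | ∀ c ∈ S, A x c} : ℝ) := by
  have h1 : ∀ x j, ∑ S ∈ powersetCard j C, (if ∀ c ∈ S, A x c then (1 : ℝ) else 0) =
      (#{c ∈ C | A x c}).choose j := by
    intro x j
    rw [← card_powersetCard, sum_boole]
    congr 2
    ext S
    simp only [mem_filter, mem_powersetCard, subset_iff]
    grind
  have h2 : ∑ j ∈ range (2 * l + 1),
      (-1) ^ j * ∑ S ∈ powersetCard j C, (#{x ∈ X | ∀ c ∈ S, A x c} : ℝ) =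
      ∑ x ∈ X, ∑ j ∈ range (2 * l + 1), (-1) ^ j * ((#{c ∈ C | A x c}).choose j : ℝ) := by
    rw [sum_comm]
    refine sum_congr rfl fun j _ => ?_
    rw [← mul_sum, ← sum_congr rfl fun x _ => h1 x j, sum_comm]
    simp
  rw [h2, ← sum_boole]
  refine sum_le_sum fun x _ => ?_
  rcases Nat.eq_zero_or_pos #{c ∈ C | A x c} with h | h
  · rw [h, sum_range_succ']
    have : ∀ c ∈ C, ¬ A x c := by simpa [filter_eq_empty_iff] using h
    simp [if_pos this]
  · obtain ⟨n, hn⟩ := Nat.exists_eq_succ_of_ne_zero h.ne'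
    have h3 : ¬ ∀ c ∈ C, ¬ A x c := by
      intro h'
      rw [filter_false_of_mem h'] at h
      simp at h
    have h4 := congrArg (Int.cast : ℤ → ℝ)
      (Int.alternating_sum_range_choose_eq_choose (n := n) (m := 2 * l))
    push_cast at h4
    rw [if_neg h3, hn, Nat.succ_eq_add_one, h4]
    simp

lemma sum_range_choose_mul_pow (n b : ℕ) (x : ℝ) :
    ∑ j ∈ range (n + 1 + b), (n.choose j : ℝ) * x ^ j = (1 + x) ^ n := by
  rw [add_comm 1 x, add_pow, sum_range_add, add_eq_left.mpr]
  · exact sum_congr rfl fun j _ => by ring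
  · exact sum_eq_zero fun j _ => by rw [Nat.choose_eq_zero_of_lt (by omega)]; simp

lemma sum_range_choose_mul_pow_le (n k : ℕ) {x : ℝ} (hx : 0 ≤ x) :
    ∑ j ∈ range k, (n.choose j : ℝ) * x ^ j ≤ Real.exp (n * x) := by
  calc _ ≤ ∑ j ∈ range (n + 1 + k), (n.choose j : ℝ) * x ^ j :=
        sum_le_sum_of_subset_of_nonneg (range_mono (by omega)) fun _ _ _ => by positivity
    _ = (1 + x) ^ n := sum_range_choose_mul_pow n k x
    _ ≤ Real.exp x ^ n := by
        gcongr
        linarith [Real.add_one_le_exp x]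
    _ = _ := (Real.exp_nat_mul x n).symm

lemma alternating_sum_range_choose_mul_pow_le (n k : ℕ) {q : ℝ} (hq : 0 ≤ q) (hq1 : q ≤ 1) :
    ∑ j ∈ range k, (-1) ^ j * ((n.choose j : ℝ) * q ^ j) ≤
      Real.exp (-(n * q)) + Real.exp (-k) * Real.exp (n * (Real.exp 1 * q)) := by
  have h1 : ∑ j ∈ range (n + 1 + k), (-1) ^ j * ((n.choose j : ℝ) * q ^ j) = (1 - q) ^ n := by
    rw [sub_eq_add_neg, ← sum_range_choose_mul_pow n k (-q)]
    refine sum_congr rfl fun j _ => ?_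
    rw [neg_pow q]
    ring
  have h2 : (1 - q) ^ n ≤ Real.exp (-(n * q)) := by
    rw [← mul_neg, Real.exp_nat_mul]
    have : 0 ≤ 1 - q := by linarith
    gcongr
    linarith [Real.add_one_le_exp (-q)]
  rw [← sum_range_add_sum_Ico _ (by omega : k ≤ n + 1 + k)] at h1
  have h3 : -∑ j ∈ Ico k (n + 1 + k), (-1) ^ j * ((n.choose j : ℝ) * q ^ j) ≤
      Real.exp (-k) * Real.exp (n * (Real.exp 1 * q)) := by
    calc _ ≤ ∑ j ∈ Ico k (n + 1 + k),
          Real.exp (-k) * ((n.choose j : ℝ) * (Real.exp 1 * q) ^ j) := by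
          rw [← sum_neg_distrib]
          refine sum_le_sum fun j hj => ?_
          have hj : (k : ℝ) ≤ j := by exact_mod_cast (mem_Ico.mp hj).1
          have hnn : 0 ≤ (n.choose j : ℝ) * q ^ j := by positivity
          have ha : -((-1) ^ j * ((n.choose j : ℝ) * q ^ j)) ≤ (n.choose j : ℝ) * q ^ j := by
            rcases neg_one_pow_eq_or ℝ j with h | h <;> rw [h] <;> linarith
          have hb : 1 ≤ Real.exp (-k) * Real.exp 1 ^ j := by
            rw [← Real.exp_nat_mul, ← Real.exp_add]
            exact Real.one_le_exp (by linarith)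
          calc _ ≤ _ := ha
            _ ≤ (Real.exp (-k) * Real.exp 1 ^ j) * ((n.choose j : ℝ) * q ^ j) :=
              le_mul_of_one_le_left hnn hb
            _ = _ := by rw [mul_pow]; ring
      _ ≤ ∑ j ∈ range (n + 1 + k),
          Real.exp (-k) * ((n.choose j : ℝ) * (Real.exp 1 * q) ^ j) := by
          refine sum_le_sum_of_subset_of_nonneg (fun j hj => ?_) fun _ _ _ => by positivity
          exact mem_range.mpr (mem_Ico.mp hj).2
      _ ≤ _ := by
          rw [← mul_sum]
          gcongr
          exact sum_range_choose_mul_pow_le _ _ (by positivity)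
  linarith

lemma mem_QR_iff_isSquare {m : ℕ} [NeZero m] {x : ZMod m} : x ∈ QR m ↔ IsSquare x := by
  simp only [QR, mem_image, mem_range]
  constructor
  · rintro ⟨a, -, rfl⟩
    exact ⟨a, sq _⟩
  · rintro ⟨a, rfl⟩
    exact ⟨a.val, a.val_lt, by rw [ZMod.natCast_zmod_val, sq]⟩

lemma univM_eq_univ (m : ℕ) [NeZero m] : univM m = univ := by
  ext x
  simp only [univM, mem_image, mem_range, mem_univ, iff_true]
  exact ⟨x.val, x.val_lt, ZMod.natCast_zmod_val x⟩

lemma Nset_anti (m : ℕ) {C D : Finset ℕ} (h : D ⊆ C) : Nset m C ⊆ Nset m D := by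
  simp only [Nset]
  exact monotone_filter_right _ fun x _ hx c hc => hx c (h hc)

lemma exp_sub_one_le_two_mul {u : ℝ} (h0 : 0 ≤ u) (h1 : u ≤ 1) : Real.exp u - 1 ≤ 2 * u := by
  have h := Real.abs_exp_sub_one_sub_id_le (x := u) (by rwa [abs_of_nonneg h0])
  have := (abs_le.mp h).2
  nlinarith

/-- Bonferroni's inequality combined with the asymptotic independence of the events
`x + c ∈ R_m`. Here `D * 2 ^ (2 * l)` bounds the relative errors of all the events involved. -/
lemma card_Nset_le {m : ℕ} (hm : Squarefree m) (hm2 : 2 < m.minFac) {C : Finset ℕ}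
    (hC : ∀ c ∈ C, c < m.minFac) (l : ℕ) {D q : ℝ} (hq : q = 1 / 2 ^ #m.primeFactors)
    (hD : #m.primeFactors * (20 * (2 * l)) / √m.minFac ≤ D) (hD1 : D * 2 ^ (2 * l) ≤ 1) :
    (#(Nset m C) : ℝ) ≤ m * (Real.exp (-(#C * q)) +
      Real.exp (-(2 * l + 1)) * Real.exp (#C * (Real.exp 1 * q)) +
      2 * D * Real.exp (#C * (2 * q))) := by
  have hm0 : m ≠ 0 := hm.ne_zero
  have : NeZero m := ⟨hm0⟩
  have hq0 : 0 ≤ q := by rw [hq]; positivity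
  have hq1 : q ≤ 1 := by
    rw [hq]
    exact div_le_one_of_le₀ (one_le_pow₀ (by norm_num)) (by positivity)
  have hD0 : 0 ≤ D := le_trans (by positivity) hD
  let A (S : Finset ℕ) : ℝ := #{x : ZMod m | ∀ c ∈ S, IsSquare (x + (c : ZMod m))}
  have hstart : (#(Nset m C) : ℝ) ≤
      ∑ j ∈ range (2 * l + 1), (-1) ^ j * ∑ S ∈ powersetCard j C, A S := by
    have := card_filter_forall_not_le_alternating_sum (univ : Finset (ZMod m)) C
      (fun x c => IsSquare (x + (c : ZMod m))) l
    simpa only [Nset, univM_eq_univ, mem_QR_iff_isSquare] using this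
  have hA : ∀ j ∈ range (2 * l + 1), ∀ S ∈ powersetCard j C,
      |A S - m * q ^ j| ≤ m * (2 * D) * (2 * q) ^ j := by
    intro j hj S hS
    rw [mem_powersetCard] at hS
    have hj : j ≤ 2 * l := by have := mem_range.mp hj; omega
    have hj' : (j : ℝ) ≤ 2 * l := by exact_mod_cast hj
    have h1 := abs_card_forall_isSquare_sub_le hm hm2 fun c hc => hC c (hS.1 hc)
    have h2 : (m : ℝ) / (2 ^ #m.primeFactors) ^ j = m * q ^ j := by
      rw [hq, div_pow, one_pow]
      ring
    rw [hS.2, h2] at h1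
    have h3 : (#m.primeFactors : ℝ) * (20 * j * 2 ^ j / √m.minFac) ≤ D * 2 ^ j := by
      calc _ = (#m.primeFactors : ℝ) * (20 * j) / √m.minFac * 2 ^ j := by ring
        _ ≤ (#m.primeFactors : ℝ) * (20 * (2 * l)) / √m.minFac * 2 ^ j := by gcongr
        _ ≤ _ := by gcongr
    have h4 : D * 2 ^ j ≤ 1 := by
      refine le_trans ?_ hD1
      gcongr
      norm_num
    calc _ ≤ _ := h1
      _ ≤ m * q ^ j * (2 * (D * 2 ^ j)) := by
        gcongr
        exact (exp_sub_one_le_two_mul (by positivity) (h3.trans h4)).trans (by gcongr)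
      _ = _ := by rw [mul_pow]; ring
  have hterm : ∀ j ∈ range (2 * l + 1), (-1) ^ j * ∑ S ∈ powersetCard j C, A S ≤
      m * ((-1) ^ j * (((#C).choose j : ℝ) * q ^ j)) +
        m * (2 * D) * (((#C).choose j : ℝ) * (2 * q) ^ j) := by
    intro j hj
    have h1 : |∑ S ∈ powersetCard j C, A S - (#C).choose j * (m * q ^ j)| ≤
        (#C).choose j * (m * (2 * D) * (2 * q) ^ j) := by
      have h2 := (abs_sum_le_sum_abs (fun S => A S - m * q ^ j) (powersetCard j C)).trans
        (sum_le_sum fun S hS => hA j hj S hS)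
      simpa [sum_sub_distrib, card_powersetCard] using h2
    have h2 := abs_le.mp h1
    rcases neg_one_pow_eq_or ℝ j with h | h <;> rw [h] <;> nlinarith
  calc _ ≤ _ := hstart
    _ ≤ _ := sum_le_sum hterm
    _ = m * ∑ j ∈ range (2 * l + 1), (-1) ^ j * (((#C).choose j : ℝ) * q ^ j) +
        m * (2 * D) * ∑ j ∈ range (2 * l + 1), ((#C).choose j : ℝ) * (2 * q) ^ j := by
      rw [sum_add_distrib, ← mul_sum, ← mul_sum]
    _ ≤ m * (Real.exp (-(#C * q)) +
          Real.exp (-(2 * l + 1)) * Real.exp (#C * (Real.exp 1 * q))) +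
        m * (2 * D) * Real.exp (#C * (2 * q)) := by
      have h1 := alternating_sum_range_choose_mul_pow_le #C (2 * l + 1) hq0 hq1
      push_cast at h1
      gcongr
      exact sum_range_choose_mul_pow_le _ _ (by positivity)
    _ = _ := by ring

/-- Corollary 2.5: for fixed `α ∈ (0, 0.13)` and `m` square-free with `p₁ = P⁻(m)`
sufficiently large, `t = ω(m) ≤ p₁^0.01`, and `C` a set of non-negative integers below `p₁`
with `|C| ≥ α·2^t·log p₁`: `|N_m(C)| ≤ K·m·p₁^(-α)` with `K = K(α)`. -/
theorem stmt_10 :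
    ∀ α : ℝ, 0 < α → α < 0.13 →
      ∃ K : ℝ, 0 < K ∧ ∃ N : ℕ,
        ∀ m : ℕ, Squarefree m → N ≤ m.minFac →
          ∀ C : Finset ℕ, (∀ c ∈ C, c < m.minFac) →
            α * 2 ^ m.primeFactors.card * Real.log m.minFac ≤ (C.card : ℝ) →
            (m.primeFactors.card : ℝ) ≤ (m.minFac : ℝ) ^ (0.01 : ℝ) →
            ((Nset m C).card : ℝ) ≤ K * m * (m.minFac : ℝ) ^ (-α) := by
  intro α hα hα'
  refine ⟨1 + Real.exp 3 + 2 * Real.exp 2, by positivity, ⌈Real.exp 10000⌉₊, ?_⟩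
  intro m hm hN C hC hcard ht
  have hP : Real.exp 10000 ≤ m.minFac := (Nat.le_ceil _).trans (by exact_mod_cast hN)
  have hP0 : (0 : ℝ) < m.minFac := (Real.exp_pos _).trans_le hP
  set L := Real.log m.minFac with hL
  have hL0 : 10000 ≤ L := (Real.le_log_iff_exp_le hP0).mpr hP
  have hexpL : (m.minFac : ℝ) = Real.exp L := (Real.exp_log hP0).symm
  have hm2 : 2 < m.minFac := by
    have : (10000 : ℝ) + 1 ≤ m.minFac := (Real.add_one_le_exp _).trans hP
    exact_mod_cast (by linarith : (2 : ℝ) < m.minFac)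
  set t := #m.primeFactors
  obtain ⟨E, hEC, hE⟩ := exists_subset_card_eq (s := C) (n := ⌈α * 2 ^ t * L⌉₊)
    (Nat.ceil_le.mpr hcard)
  have hαL : 0 < α * L := by positivity
  have hn1 : α * 2 ^ t * L ≤ #E := hE ▸ Nat.le_ceil _
  have hn2 : (#E : ℝ) ≤ α * 2 ^ t * L + 1 := hE ▸ (Nat.ceil_lt_add_one (by positivity)).le
  set q : ℝ := 1 / 2 ^ t with hq
  have h2t : (1 : ℝ) ≤ 2 ^ t := one_le_pow₀ (by norm_num)
  have hnq1 : α * L ≤ #E * q := by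
    rw [hq, mul_one_div, le_div_iff₀ (by positivity)]
    linarith
  have hnq2 : #E * q ≤ α * L + 1 := by
    rw [hq, mul_one_div, div_le_iff₀ (by positivity)]
    linarith
  set l := ⌈L / 4⌉₊
  have hl1 : L / 2 ≤ 2 * l := by linarith [Nat.le_ceil (L / 4)]
  have hl2 : (2 * l : ℝ) ≤ L / 2 + 2 := by
    linarith [(Nat.ceil_lt_add_one (by positivity : 0 ≤ L / 4)).le]
  have hsqrt : √(m.minFac : ℝ) = Real.exp (L / 2) := by
    rw [hexpL, ← Real.exp_half]
  have hrpow : ∀ s : ℝ, (m.minFac : ℝ) ^ s = Real.exp (L * s) := fun s => by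
    rw [Real.rpow_def_of_pos hP0]
  rw [hrpow] at ht
  rw [hrpow]
  have hD : t * (20 * (2 * l)) / √m.minFac ≤ Real.exp (-(0.44 * L)) := by
    have h1 := Real.quadratic_le_exp_of_nonneg (by positivity : 0 ≤ 0.05 * L)
    have h2 : (20 * (2 * l) : ℝ) ≤ Real.exp (0.05 * L) := by nlinarith
    rw [hsqrt, div_le_iff₀ (Real.exp_pos _)]
    calc _ ≤ Real.exp (L * 0.01) * Real.exp (0.05 * L) := by gcongr
      _ = _ := by rw [← Real.exp_add, ← Real.exp_add]; ring_nf
  have hD1 : Real.exp (-(0.44 * L)) * 2 ^ (2 * l) ≤ 1 := by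
    have h2 : (2 : ℝ) ^ (2 * l) = Real.exp (2 * l * Real.log 2) := by
      rw [← Nat.cast_ofNat, ← Nat.cast_mul, Real.exp_nat_mul, Real.exp_log (by norm_num)]
    rw [h2, ← Real.exp_add, Real.exp_le_one_iff]
    have := Real.log_two_lt_d9
    have : 2 * l * Real.log 2 ≤ (L / 2 + 2) * 0.7 :=
      mul_le_mul hl2 (by linarith) (Real.log_nonneg one_le_two) (by linarith)
    linarith
  have hmain := card_Nset_le hm hm2 (fun c hc => hC c (hEC hc)) l hq hD hD1
  have hsub : (#(Nset m C) : ℝ) ≤ #(Nset m E) := by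
    exact_mod_cast card_le_card (Nset_anti m hEC)
  refine (hsub.trans hmain).trans ?_
  have he := Real.exp_one_lt_d9
  have hαL' : α * L ≤ 0.13 * L :=
    mul_le_mul_of_nonneg_right hα'.le (by linarith)
  have b1 : Real.exp (-(#E * q)) ≤ Real.exp (L * -α) := by
    rw [Real.exp_le_exp]
    linarith
  have b2 : Real.exp (-(2 * l + 1)) * Real.exp (#E * (Real.exp 1 * q)) ≤
      Real.exp 3 * Real.exp (L * -α) := by
    rw [← Real.exp_add, ← Real.exp_add, Real.exp_le_exp]
    have h1 : Real.exp 1 * (#E * q) ≤ 2.72 * (α * L + 1) :=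
      mul_le_mul (by linarith) hnq2 (hαL.le.trans hnq1) (by norm_num)
    linarith
  have b3 : 2 * Real.exp (-(0.44 * L)) * Real.exp (#E * (2 * q)) ≤
      2 * Real.exp 2 * Real.exp (L * -α) := by
    rw [mul_assoc, mul_assoc, ← Real.exp_add, ← Real.exp_add]
    refine mul_le_mul_of_nonneg_left ?_ zero_le_two
    rw [Real.exp_le_exp]
    linarith
  calc _ ≤ m * (Real.exp (L * -α) + Real.exp 3 * Real.exp (L * -α) +
        2 * Real.exp 2 * Real.exp (L * -α)) := by gcongr
    _ = _ := by ring
end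

section
/- There exist absolute constants C > 0 and K > 0 such that for every square-free positive integer M and every integer h with h ≥ (2C·τ(M))^{50}, the number of x ∈ Z_M such that x, x+1, ..., x+h−1 are all quadratic non-residues modulo M is at most K·M·τ(M)⁴·h^{−1.47}. -/
open Finset

section Stepanov

open Polynomial

variable {p : ℕ} [Fact p.Prime]

/-- The operator `L` with `D^t (f ^ n * q) = f ^ (n - t) * L q`. -/
noncomputable def derivOp (f : (ZMod p)[X]) (n : ℕ) : ℕ → (ZMod p)[X] →ₗ[ZMod p] (ZMod p)[X]
  | 0 => LinearMap.id
  | t + 1 => (LinearMap.mulLeft (ZMod p) (C ((n - t : ℕ) : ZMod p) * derivative f) +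
      (LinearMap.mulLeft (ZMod p) f).comp derivative).comp (derivOp f n t)

lemma natDegree_lt_of_degree_lt_natCast {q : (ZMod p)[X]} {u : ℕ} (hu : 1 ≤ u)
    (hq : q.degree < (u : ℕ)) : q.natDegree < u := by
  by_cases h : q = 0
  · subst h; rw [natDegree_zero]; omega
  · exact (natDegree_lt_iff_degree_lt h).2 hq

lemma iterate_derivative_pow_mul (f : (ZMod p)[X]) (n t : ℕ) (ht : t ≤ n) (q : (ZMod p)[X]) :
    derivative^[t] (f ^ n * q) = f ^ (n - t) * derivOp f n t q := by
  induction t with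
  | zero => simp [derivOp]
  | succ t ih =>
    rw [Function.iterate_succ_apply', ih (by omega)]
    obtain ⟨k, hk⟩ : ∃ k, n - t = k + 1 := ⟨n - t - 1, by omega⟩
    have hk' : n - (t + 1) = k := by omega
    rw [hk']
    simp only [derivOp, LinearMap.comp_apply, LinearMap.add_apply, LinearMap.mulLeft_apply, hk,
      derivative_mul, derivative_pow_succ]
    push_cast
    simp only [map_add, map_natCast, map_one]
    ring

lemma natDegree_derivOp_lt (f : (ZMod p)[X]) {m : ℕ} (hf : f.natDegree ≤ m) (n t u : ℕ)
    (q : (ZMod p)[X]) (hq : q.degree < (u : ℕ)) : (derivOp f n t q).degree < ((u + t * m : ℕ)) := by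
  induction t with
  | zero => simpa [derivOp] using hq
  | succ t ih =>
    have hfd : f.degree ≤ (m : ℕ) := (degree_le_natDegree).trans (by exact_mod_cast hf)
    simp only [derivOp, LinearMap.comp_apply, LinearMap.add_apply, LinearMap.mulLeft_apply]
    set w := derivOp f n t q
    have key : ∀ a b : (ZMod p)[X], a.degree ≤ (m : ℕ) → b.degree < ((u + t * m : ℕ)) →
        (a * b).degree < ((u + (t + 1) * m : ℕ)) := by
      intro a b ha hb
      by_cases hb0 : b = 0
      · subst hb0; rw [mul_zero, degree_zero]; exact WithBot.bot_lt_coe _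
      by_cases ha0 : a = 0
      · subst ha0; rw [zero_mul, degree_zero]; exact WithBot.bot_lt_coe _
      rw [degree_mul, degree_eq_natDegree ha0, degree_eq_natDegree hb0] at *
      norm_cast at *
      nlinarith
    refine lt_of_le_of_lt (degree_add_le _ _) (max_lt ?_ ?_)
    · refine key _ _ ?_ ih
      refine (show (C ((n - t : ℕ) : ZMod p) * derivative f).degree ≤ (derivative f).degree by
        rw [← smul_eq_C_mul]; exact degree_smul_le _ _).trans ((degree_derivative_le).trans hfd)
    · exact key _ _ hfd ((degree_derivative_le).trans_lt ih)

lemma iterate_derivative_mul_X_pow_char (a : (ZMod p)[X]) (j t : ℕ) :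
    derivative^[t] (a * X ^ (p * j)) = derivative^[t] a * X ^ (p * j) := by
  induction t with
  | zero => rfl
  | succ t ih =>
    rw [Function.iterate_succ_apply', ih, Function.iterate_succ_apply', derivative_mul,
      derivative_X_pow]
    simp

/-- If `q + f ^ e * r` vanishes to order `p = 2 * e + 1` at `0`, with `q` and `r` of small degree,
then `q ^ 2 * f` is a constant times `r ^ 2`. -/
lemma sq_mul_eq_of_X_pow_dvd (f : (ZMod p)[X]) {m e u : ℕ} (hf : f.natDegree ≤ m)
    (hp : p = 2 * e + 1) (hu : 2 * u + m ≤ p + 1) (hu0 : 1 ≤ u) (q r : (ZMod p)[X])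
    (hq : q.degree < (u : ℕ)) (hr : r.degree < (u : ℕ)) (h : X ^ p ∣ q + f ^ e * r) :
    q ^ 2 * f = C (f.eval 0) * r ^ 2 := by
  have h1 : (X : (ZMod p)[X]) ^ p ∣ q ^ 2 * f - f ^ p * r ^ 2 := by
    have : q ^ 2 * f - f ^ p * r ^ 2 = (q + f ^ e * r) * ((q - f ^ e * r) * f) := by
      have : f ^ p = f ^ e * f ^ e * f := by
        rw [← pow_add, ← pow_succ]; congr 1; omega
      rw [this]; ring
    rw [this]; exact Dvd.dvd.mul_right h _
  have h2 : (X : (ZMod p)[X]) ^ p ∣ f ^ p - C (f.eval 0) := by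
    have : X ∣ f - C (f.eval 0) := by
      rw [X_dvd_iff]; simp [coeff_zero_eq_eval_zero]
    obtain ⟨g, hg⟩ := this
    refine ⟨expand (ZMod p) p g, ?_⟩
    have := congrArg (expand (ZMod p) p) hg
    rwa [map_sub, map_mul, expand_C, expand_X, ZMod.expand_card] at this
  have h3 : (X : (ZMod p)[X]) ^ p ∣ q ^ 2 * f - C (f.eval 0) * r ^ 2 := by
    have := dvd_add h1 (Dvd.dvd.mul_right h2 (r ^ 2))
    convert this using 1; ring
  have hqn : q.natDegree ≤ u - 1 := by
    have := natDegree_lt_of_degree_lt_natCast hu0 hq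
    omega
  have hrn : r.natDegree ≤ u - 1 := by
    have := natDegree_lt_of_degree_lt_natCast hu0 hr
    omega
  have hd : (q ^ 2 * f - C (f.eval 0) * r ^ 2).degree < ((X : (ZMod p)[X]) ^ p).degree := by
    rw [degree_X_pow]
    refine lt_of_le_of_lt degree_le_natDegree ?_
    have ha : (q ^ 2 * f).natDegree ≤ 2 * (u - 1) + m := by
      refine natDegree_mul_le.trans ?_
      have := natDegree_pow_le (p := q) (n := 2)
      omega
    have hb : (C (f.eval 0) * r ^ 2).natDegree ≤ 2 * (u - 1) := by
      refine (natDegree_C_mul_le _ _).trans ?_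
      have := natDegree_pow_le (p := r) (n := 2)
      omega
    have := natDegree_sub_le (q ^ 2 * f) (C (f.eval 0) * r ^ 2)
    exact_mod_cast (by omega : (q ^ 2 * f - C (f.eval 0) * r ^ 2).natDegree < p)
  exact sub_eq_zero.mp (eq_zero_of_dvd_of_degree_lt h3 hd)

/-- Minimal-index argument: the powers `X ^ (p * j)` are independent over small pairs. -/
lemma eq_zero_of_sum_eq_zero (f : (ZMod p)[X]) {m e u : ℕ} (hf : f.natDegree ≤ m)
    (hp : p = 2 * e + 1) (hu : 2 * u + m ≤ p + 1) (hu0 : 1 ≤ u)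
    (hns : ∀ q r : (ZMod p)[X], q ^ 2 * f = C (f.eval 0) * r ^ 2 → q = 0 ∧ r = 0)
    (J : ℕ) (q r : ℕ → (ZMod p)[X]) (hq : ∀ j, (q j).degree < (u : ℕ))
    (hr : ∀ j, (r j).degree < (u : ℕ))
    (h : ∑ j ∈ range J, (q j + f ^ e * r j) * X ^ (p * j) = 0) :
    ∀ j < J, q j = 0 ∧ r j = 0 := by
  induction J generalizing q r with
  | zero => intro j hj; omega
  | succ J ih =>
    rw [sum_range_succ'] at h
    have hs : ∑ j ∈ range J, (q (j + 1) + f ^ e * r (j + 1)) * X ^ (p * (j + 1)) =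
        X ^ p * ∑ j ∈ range J, (q (j + 1) + f ^ e * r (j + 1)) * X ^ (p * j) := by
      rw [mul_sum]; refine sum_congr rfl fun j _ => ?_
      rw [mul_add, mul_one, pow_add]; ring
    rw [hs] at h
    simp only [mul_zero, pow_zero, mul_one] at h
    have h0 : q 0 = 0 ∧ r 0 = 0 := by
      refine hns _ _ (sq_mul_eq_of_X_pow_dvd f hf hp hu hu0 _ _ (hq 0) (hr 0) ?_)
      rw [eq_neg_of_add_eq_zero_right h]
      exact (dvd_neg).2 (dvd_mul_right _ _)
    have h1 : ∑ j ∈ range J, (q (j + 1) + f ^ e * r (j + 1)) * X ^ (p * j) = 0 := by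
      rw [h0.1, h0.2] at h
      simpa [(Fact.out : p.Prime).ne_zero] using h
    intro j hj
    cases j with
    | zero => exact h0
    | succ j =>
      exact ih (fun j => q (j + 1)) (fun j => r (j + 1)) (fun j => hq _) (fun j => hr _) h1 j
        (by omega)

/-- Linear algebra: the vanishing conditions can be met non-trivially. -/
lemma exists_stepanov_coeffs (f : (ZMod p)[X]) {m : ℕ} (hf : f.natDegree ≤ m) (e l J u : ℕ)
    (ε : ZMod p) (hcount : l * (u + l * m + J) < 2 * J * u) :
    ∃ q r : ℕ → (ZMod p)[X], (∀ j, (q j).degree < (u : ℕ)) ∧ (∀ j, (r j).degree < (u : ℕ)) ∧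
      (∃ j < J, ¬ (q j = 0 ∧ r j = 0)) ∧
      ∀ t < l, ∑ j ∈ range J, (derivOp f l t (q j) + C ε * derivOp f (l + e) t (r j)) * X ^ j = 0 := by
  set W := u + l * m + J with hW
  let V := Fin J → degreeLT (ZMod p) u
  let Φ : (V × V) →ₗ[ZMod p] (Fin l → (ZMod p)[X]) :=
    LinearMap.pi fun t => ∑ j : Fin J, (LinearMap.mulRight (ZMod p) (X ^ (j : ℕ))).comp
      ((derivOp f l t).comp ((degreeLT (ZMod p) u).subtype.comp
          ((LinearMap.proj j).comp (LinearMap.fst (ZMod p) V V))) +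
        (LinearMap.mulLeft (ZMod p) (C ε)).comp ((derivOp f (l + e) t).comp
          ((degreeLT (ZMod p) u).subtype.comp
          ((LinearMap.proj j).comp (LinearMap.snd (ZMod p) V V)))))
  have hΦ : ∀ v t, Φ v t = ∑ j : Fin J, (derivOp f l t (v.1 j) +
      C ε * derivOp f (l + e) t (v.2 j)) * X ^ (j : ℕ) := by
    intro v t
    simp [Φ, LinearMap.pi_apply, LinearMap.sum_apply]
  let Ψ : (V × V) →ₗ[ZMod p] (Fin l → Fin W → ZMod p) :=
    LinearMap.pi fun t => LinearMap.pi fun w =>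
      (lcoeff (ZMod p) (w : ℕ)).comp ((LinearMap.proj t).comp Φ)
  have hfin : Module.finrank (ZMod p) (degreeLT (ZMod p) u) = u := by
    rw [LinearEquiv.finrank_eq (degreeLTEquiv (ZMod p) u)]; simp
  have : FiniteDimensional (ZMod p) (degreeLT (ZMod p) u) :=
    LinearEquiv.finiteDimensional (degreeLTEquiv (ZMod p) u).symm
  have hker : LinearMap.ker Ψ ≠ ⊥ := by
    refine LinearMap.ker_ne_bot_of_finrank_lt ?_
    have hV : Module.finrank (ZMod p) V = J * u := by
      change Module.finrank (ZMod p) (Fin J → degreeLT (ZMod p) u) = J * u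
      rw [Module.finrank_pi_fintype]
      simp [hfin]
    rw [Module.finrank_prod, Module.finrank_pi_fintype, hV]
    simp only [Module.finrank_fin_fun, sum_const, card_univ, Fintype.card_fin, smul_eq_mul]
    nlinarith
  obtain ⟨v, hv, hv0⟩ := (Submodule.ne_bot_iff _).1 hker
  have hdeg : ∀ (i : Fin J → degreeLT (ZMod p) u) (j : Fin J), ((i j : (ZMod p)[X])).degree < (u : ℕ) :=
    fun i j => mem_degreeLT.1 (i j).2
  have hpos : ((0 : (ZMod p)[X])).degree < (u : ℕ) := by
    rw [degree_zero]; exact WithBot.bot_lt_coe _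
  refine ⟨fun j => if hj : j < J then (v.1 ⟨j, hj⟩ : (ZMod p)[X]) else 0,
    fun j => if hj : j < J then (v.2 ⟨j, hj⟩ : (ZMod p)[X]) else 0, ?_, ?_, ?_, ?_⟩
  · intro j; dsimp only; split_ifs
    · exact hdeg _ _
    · exact hpos
  · intro j; dsimp only; split_ifs
    · exact hdeg _ _
    · exact hpos
  · by_contra! hcon
    apply hv0
    refine Prod.ext (funext fun j => Subtype.ext ?_) (funext fun j => Subtype.ext ?_)
    · have := (hcon j j.2).1
      simp only [j.2, dite_true] at this
      exact this
    · have := (hcon j j.2).2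
      simp only [j.2, dite_true] at this
      exact this
  · intro t ht
    have h1 : Φ v ⟨t, ht⟩ = 0 := by
      have hlt : (Φ v ⟨t, ht⟩).degree < ((W : ℕ) : WithBot ℕ) := by
        rw [hΦ]
        refine lt_of_le_of_lt (degree_sum_le _ _) ?_
        rw [Finset.sup_lt_iff (WithBot.bot_lt_coe _)]
        intro j _
        have hX : ∀ b : (ZMod p)[X], b.degree < ((u + t * m : ℕ) : WithBot ℕ) →
            (b * X ^ (j : ℕ)).degree < ((W : ℕ) : WithBot ℕ) := by
          intro b hb
          by_cases hb0 : b = 0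
          · subst hb0; rw [zero_mul, degree_zero]; exact WithBot.bot_lt_coe _
          rw [degree_mul, degree_X_pow, degree_eq_natDegree hb0] at *
          have hj := j.2
          have : t * m ≤ l * m := Nat.mul_le_mul_right _ ht.le
          norm_cast at *
          omega
        refine hX _ (lt_of_le_of_lt (degree_add_le _ _) (max_lt ?_ ?_))
        · exact natDegree_derivOp_lt f hf _ _ _ _ (hdeg _ _)
        · refine lt_of_le_of_lt ?_ (natDegree_derivOp_lt f hf (l + e) t u _ (hdeg v.2 j))
          rw [← smul_eq_C_mul]; exact degree_smul_le _ _
      ext w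
      by_cases hw : w < W
      · have := congrFun (congrFun (LinearMap.mem_ker.1 hv) ⟨t, ht⟩) ⟨w, hw⟩
        simpa [Ψ] using this
      · rw [coeff_eq_zero_of_degree_lt (hlt.trans_le (by exact_mod_cast not_lt.1 hw))]; simp
    rw [hΦ] at h1
    rw [← Fin.sum_univ_eq_sum_range (fun j => (derivOp f l t
      (if hj : j < J then (v.1 ⟨j, hj⟩ : (ZMod p)[X]) else 0) + C ε * derivOp f (l + e) t
      (if hj : j < J then (v.2 ⟨j, hj⟩ : (ZMod p)[X]) else 0)) * X ^ j)]
    refine Eq.trans (sum_congr rfl fun j _ => ?_) h1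
    simp

/-- **Stepanov's bound** for the number of solutions of `f(x) ^ ((p - 1) / 2) = ε`. -/
theorem stepanov_bound (f : (ZMod p)[X]) {m e s : ℕ} (hf : f.natDegree ≤ m) (hf0 : f.eval 0 ≠ 0)
    (hns : ∀ q r : (ZMod p)[X], q ^ 2 * f = C (f.eval 0) * r ^ 2 → q = 0 ∧ r = 0)
    (ε : ZMod p) (hp : p = 2 * e + 1) (hs : s ^ 2 ≤ p) (hs' : p < (s + 1) ^ 2)
    (hs16 : 16 ≤ s) (hm : 2 * m ≤ p) :
    2 * #{x : ZMod p | f.eval x ^ e = ε} ≤ p + 100 * (m + 1) * s := by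
  set u := (p - m + 1) / 2 with hu
  set l := 2 * s with hl
  set J := s + 16 * (m + 1) with hJ
  have hu1 : p ≤ 4 * u := by omega
  have hu2 : 2 * u + m ≤ p + 1 := by omega
  have hu0 : 1 ≤ u := by omega
  have hcount : l * (u + l * m + J) < 2 * J * u := by
    have h1 : 4 * (m + 1) * p ≤ 4 * (m + 1) * (4 * u) := Nat.mul_le_mul_left _ hu1
    have h2 : 16 * s ≤ p := by nlinarith
    have h3 : (m + 1) * (16 * s) ≤ (m + 1) * p := Nat.mul_le_mul_left _ h2
    have h4 : s ^ 2 * (2 * m + 1) ≤ p * (2 * m + 1) := Nat.mul_le_mul_right _ hs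
    have h5 : 0 < p := by omega
    rw [hl, hJ]
    nlinarith
  obtain ⟨q, r, hq, hr, ⟨j0, hj0, hne⟩, hvan⟩ := exists_stepanov_coeffs f hf e l J u ε hcount
  set P : (ZMod p)[X] := ∑ j ∈ range J, (f ^ l * q j + f ^ (l + e) * r j) * X ^ (p * j) with hP
  have hfne : f ≠ 0 := by rintro rfl; simp at hf0
  have hP0 : P ≠ 0 := by
    intro h0
    have h1 : f ^ l * ∑ j ∈ range J, (q j + f ^ e * r j) * X ^ (p * j) = 0 := by
      rw [← h0, hP, mul_sum]
      refine sum_congr rfl fun j _ => ?_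
      rw [pow_add]; ring
    have h2 := (mul_eq_zero.1 h1).resolve_left (pow_ne_zero _ hfne)
    exact hne (eq_zero_of_sum_eq_zero f hf hp hu2 hu0 hns J q r hq hr h2 j0 hj0)
  have hlp : l < p := by nlinarith
  have hmult : ∀ x : ZMod p, f.eval x ^ e = ε → l ≤ P.rootMultiplicity x := by
    intro x hx
    have hl1 : l = (l - 1) + 1 := by omega
    rw [hl1, Nat.succ_le_iff, lt_rootMultiplicity_iff_isRoot_iterate_derivative_of_mem_nonZeroDivisors' hP0]
    · intro t ht
      have htl : t < l := by omega
      rw [IsRoot, hP, iterate_derivative_sum]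
      have h1 : ∀ j ∈ range J, derivative^[t] ((f ^ l * q j + f ^ (l + e) * r j) * X ^ (p * j)) =
          f ^ (l - t) * ((derivOp f l t (q j) + f ^ e * derivOp f (l + e) t (r j)) * X ^ (p * j)) := by
        intro j _
        rw [iterate_derivative_mul_X_pow_char, iterate_map_add,
          iterate_derivative_pow_mul f l t htl.le, iterate_derivative_pow_mul f (l + e) t (by omega),
          show l + e - t = (l - t) + e by omega, pow_add]
        ring
      rw [sum_congr rfl h1, ← mul_sum, eval_mul]
      have h2 := congrArg (eval x) (hvan t htl)
      rw [eval_finsetSum] at h2 ⊢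
      convert mul_zero _ using 2
      rw [← eval_zero (x := x), ← h2]
      refine sum_congr rfl fun j _ => ?_
      simp only [eval_mul, eval_add, eval_pow, eval_X, eval_C, hx]
      rw [pow_mul, ZMod.pow_card]
    · intro k hk hk0
      rw [mem_nonZeroDivisors_iff_ne_zero]
      intro h0
      rw [ZMod.natCast_eq_zero_iff] at h0
      have := Nat.le_of_dvd (Nat.pos_of_ne_zero hk0) h0
      omega
  have hdegP : P.natDegree ≤ l * m + e * m + u + p * J := by
    refine natDegree_sum_le_of_forall_le _ _ fun j hj => ?_
    have hj' : p * j ≤ p * J := Nat.mul_le_mul_left _ (mem_range.1 hj).le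
    refine natDegree_mul_le.trans ?_
    rw [natDegree_X_pow]
    have hqn := natDegree_lt_of_degree_lt_natCast hu0 (hq j)
    have hrn := natDegree_lt_of_degree_lt_natCast hu0 (hr j)
    have hpw : ∀ n, (f ^ n).natDegree ≤ n * m := fun n =>
      natDegree_pow_le.trans (Nat.mul_le_mul_left _ hf)
    have h1 := (natDegree_mul_le (p := f ^ l) (q := q j))
    have h2 := (natDegree_mul_le (p := f ^ (l + e)) (q := r j))
    have h3 := natDegree_add_le (f ^ l * q j) (f ^ (l + e) * r j)
    have h4 := hpw l
    have h5 := hpw (l + e)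
    rw [add_mul] at h5
    omega
  have hcard : l * #{x : ZMod p | f.eval x ^ e = ε} ≤ P.natDegree := by
    refine le_trans ?_ (card_roots' P)
    rw [← Multiset.toFinset_sum_count_eq]
    have hsub : ({x : ZMod p | f.eval x ^ e = ε} : Finset (ZMod p)) ⊆ P.roots.toFinset := by
      intro x hx
      have := hmult x (by simpa using hx)
      rw [Multiset.mem_toFinset, ← Multiset.count_pos, count_roots]
      omega
    refine le_trans ?_ (sum_le_sum_of_subset hsub)
    rw [mul_comm, ← smul_eq_mul]
    refine card_nsmul_le_sum _ _ _ fun x hx => ?_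
    rw [count_roots]
    exact hmult x (by simpa using hx)
  have hfinal := hcard.trans hdegP
  set N := #{x : ZMod p | f.eval x ^ e = ε}
  have h1 : s * (2 * N) ≤ s * (p + 100 * (m + 1) * s) := by
    have h2 : p ≤ 2 * s ^ 2 := by nlinarith
    have h3 : m * p ≤ m * (2 * s ^ 2) := Nat.mul_le_mul_left _ h2
    have h4 : e * m ≤ p * m := Nat.mul_le_mul_right _ (by omega)
    have h5 : s * m ≤ s * s * m := by nlinarith [Nat.zero_le (s*m)]
    have h6 : u ≤ p := by omega
    have h7 : p * (s + 16 * (m + 1)) = s * p + 16 * (m * p) + 16 * p := by ring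
    have h8 : s * (p + 100 * (m + 1) * s) =
        s * p + 50 * (m * (2 * s ^ 2)) + 50 * (2 * s ^ 2) := by ring
    have h9 : 2 * s * m ≤ m * (2 * s ^ 2) := by linarith [h5, show m * (2 * s ^ 2) = 2 * (s * s * m) by ring]
    have h10 : p * m = m * p := mul_comm _ _
    have h11 : s * (2 * N) = 2 * s * N := by ring
    rw [hl, hJ, h7] at hfinal
    rw [h8, h11]
    have h12 := Nat.zero_le (m * (2 * s ^ 2))
    have h13 := Nat.zero_le (2 * s ^ 2)
    linarith
  exact Nat.le_of_mul_le_mul_left h1 (by omega)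

end Stepanov

section Weil

open Polynomial

variable {p : ℕ} [Fact p.Prime]

lemma eq_zero_of_sq_mul_eq (f : (ZMod p)[X]) {c α : ZMod p} (hc : c ≠ 0)
    (hα : Odd (f.rootMultiplicity α)) (q r : (ZMod p)[X]) (h : q ^ 2 * f = C c * r ^ 2) :
    q = 0 ∧ r = 0 := by
  have hf : f ≠ 0 := by rintro rfl; simp at hα
  have hcc : (C c : (ZMod p)[X]) ≠ 0 := by simpa using hc
  by_cases hq : q = 0
  · subst hq
    refine ⟨rfl, ?_⟩
    have h1 : C c * r ^ 2 = 0 := by rw [← h]; ring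
    simpa [hc] using h1
  · exfalso
    have hl : q ^ 2 * f ≠ 0 := mul_ne_zero (pow_ne_zero _ hq) hf
    have hr' : C c * r ^ 2 ≠ 0 := h ▸ hl
    have h1 := congrArg (rootMultiplicity α) h
    rw [rootMultiplicity_mul hl, rootMultiplicity_mul hr', rootMultiplicity_C, zero_add, pow_two,
      pow_two, rootMultiplicity_mul (by rw [← pow_two]; exact pow_ne_zero _ hq),
      rootMultiplicity_mul (by rw [← pow_two]; exact right_ne_zero_of_mul hr')] at h1
    obtain ⟨k, hk⟩ := hα
    omega

lemma weil_bound_aux (f : (ZMod p)[X]) {m : ℕ} (hf : f.natDegree ≤ m) (hp2 : p ≠ 2)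
    {α : ZMod p} (hα : Odd (f.rootMultiplicity α)) (hf0 : f.eval 0 ≠ 0) (hs16 : 16 ≤ p.sqrt)
    (hm : 2 * m ≤ p) :
    |∑ x : ZMod p, quadraticChar (ZMod p) (f.eval x)| ≤ 101 * (m + 1) * p.sqrt := by
  have hpp : p.Prime := Fact.out
  obtain ⟨e, he⟩ := hpp.odd_of_ne_two hp2
  have hfne : f ≠ 0 := by rintro rfl; simp at hf0
  have hb : ∀ ε : ZMod p, 2 * #{x : ZMod p | f.eval x ^ e = ε} ≤ p + 100 * (m + 1) * p.sqrt :=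
    fun ε => stepanov_bound f hf hf0 (fun q r h => eq_zero_of_sq_mul_eq f hf0 hα q r h) ε he
      (Nat.sqrt_le' p) (Nat.lt_succ_sqrt' p) hs16 hm
  have hring : ringChar (ZMod p) ≠ 2 := by rwa [ZMod.ringChar_zmod_n]
  have hχ : ∀ a : ZMod p, ((quadraticChar (ZMod p) a : ℤ) : ZMod p) = a ^ e := by
    intro a
    rw [quadraticChar_eq_pow_of_char_ne_two' hring, ZMod.card]
    congr 1; omega
  have h11 : (1 : ZMod p) ≠ -1 := (Ring.neg_one_ne_one_of_char_ne_two hring).symm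
  have he0 : e ≠ 0 := by rintro rfl; exact hpp.one_lt.ne' he
  have hχ' : ∀ a : ZMod p, (quadraticChar (ZMod p) a : ℤ) =
      (if a ^ e = 1 then 1 else 0) - (if a ^ e = -1 then 1 else 0) := by
    intro a
    by_cases ha : a = 0
    · subst ha; rw [zero_pow he0]; simp
    · rcases quadraticChar_dichotomy ha with h | h <;> have h2 := hχ a <;> rw [h] at h2 ⊢ <;>
        rw [← h2] <;> simp [h11, h11.symm]
  have hone : ∀ a : ZMod p, (1 : ℤ) ≤ (if a ^ e = 1 then 1 else 0) + (if a ^ e = -1 then 1 else 0)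
      + (if a = 0 then 1 else 0) := by
    intro a
    by_cases ha : a = 0
    · simp [ha]; split_ifs <;> simp
    · rcases quadraticChar_dichotomy ha with h | h <;> have h2 := hχ a <;> rw [h] at h2 <;>
        rw [← h2] <;> simp [ha, h11, h11.symm]
  have hZ : #{x : ZMod p | f.eval x = 0} ≤ m := by
    refine le_trans ?_ hf
    refine le_trans ?_ (card_roots' f)
    refine le_trans (card_le_card ?_) (Multiset.toFinset_card_le _)
    intro x hx
    simpa [hfne] using hx
  have hS : ∑ x : ZMod p, (quadraticChar (ZMod p) (f.eval x) : ℤ) =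
      #{x : ZMod p | f.eval x ^ e = 1} - #{x : ZMod p | f.eval x ^ e = -1} := by
    simp_rw [hχ']
    rw [sum_sub_distrib]; simp
  have hT : (p : ℤ) ≤ #{x : ZMod p | f.eval x ^ e = 1} + #{x : ZMod p | f.eval x ^ e = -1} +
      #{x : ZMod p | f.eval x = 0} := by
    have := sum_le_sum (s := univ) fun x (_ : x ∈ (univ : Finset (ZMod p))) => hone (f.eval x)
    rw [sum_add_distrib, sum_add_distrib] at this
    simpa [ZMod.card] using this
  have hb1 := hb 1
  have hb2 := hb (-1)
  rw [hS]
  zify at hb1 hb2 hZ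
  have hs0 : (m : ℤ) ≤ (m + 1) * p.sqrt := by
    have : (16 : ℤ) ≤ p.sqrt := by exact_mod_cast hs16
    nlinarith
  rw [abs_le]
  constructor <;> linarith

/-- **Weil's bound** (with a crude constant) for quadratic character sums of a polynomial with a
rational root of odd multiplicity. -/
theorem weil_bound (f : (ZMod p)[X]) {m : ℕ} (hf : f.natDegree ≤ m) (hp2 : p ≠ 2)
    {α : ZMod p} (hα : Odd (f.rootMultiplicity α)) :
    |((∑ x : ZMod p, quadraticChar (ZMod p) (f.eval x) : ℤ) : ℝ)| ≤ 101 * (m + 1) * √p := by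
  have hfne : f ≠ 0 := by rintro rfl; simp at hα
  have hpp : p.Prime := Fact.out
  by_cases hbig : 16 ≤ p.sqrt ∧ 2 * m ≤ p
  · have hex : ∃ a : ZMod p, f.eval a ≠ 0 := by
      by_contra! hcon
      have h1 : (univ : Finset (ZMod p)) ⊆ f.roots.toFinset := by
        intro x _; simpa [hfne] using hcon x
      have h2 := (card_le_card h1).trans ((Multiset.toFinset_card_le _).trans (card_roots' f))
      rw [card_univ, ZMod.card] at h2
      have := hpp.pos
      omega
    obtain ⟨a, ha⟩ := hex
    have hα' : Odd ((f.comp (X + C a)).rootMultiplicity (α - a)) := by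
      rw [rootMultiplicity_eq_rootMultiplicity, comp_assoc]
      rw [rootMultiplicity_eq_rootMultiplicity] at hα
      convert hα using 4
      simp; ring
    have := weil_bound_aux (f.comp (X + C a)) (m := m) (by rw [natDegree_comp]; simpa using hf)
      hp2 hα' (by simpa using ha) hbig.1 hbig.2
    have hsum : ∑ x : ZMod p, quadraticChar (ZMod p) ((f.comp (X + C a)).eval x) =
        ∑ x : ZMod p, quadraticChar (ZMod p) (f.eval x) := by
      refine Fintype.sum_equiv (Equiv.addRight a) _ _ fun x => ?_
      simp
    rw [hsum] at this
    have h2 : |((∑ x : ZMod p, quadraticChar (ZMod p) (f.eval x) : ℤ) : ℝ)| ≤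
        101 * (m + 1) * (p.sqrt : ℝ) := by exact_mod_cast this
    refine h2.trans ?_
    gcongr
    exact Real.nat_sqrt_le_real_sqrt
  · have htriv : |((∑ x : ZMod p, quadraticChar (ZMod p) (f.eval x) : ℤ) : ℝ)| ≤ p := by
      have h1 : |∑ x : ZMod p, quadraticChar (ZMod p) (f.eval x)| ≤ p := by
        refine (abs_sum_le_sum_abs _ _).trans ?_
        have : ∀ x ∈ (univ : Finset (ZMod p)), |quadraticChar (ZMod p) (f.eval x)| ≤ 1 := by
          intro x _
          by_cases hx : f.eval x = 0
          · simp [hx]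
          · rcases quadraticChar_dichotomy hx with h | h <;> simp [h]
        refine (sum_le_card_nsmul _ _ _ this).trans ?_
        simp [ZMod.card]
      exact_mod_cast h1
    refine htriv.trans ?_
    have hp0 : (0 : ℝ) ≤ p := Nat.cast_nonneg _
    have hsq : √(p : ℝ) * √p = p := Real.mul_self_sqrt hp0
    have hle : √(p : ℝ) ≤ 101 * (m + 1) := by
      rw [Real.sqrt_le_left (by positivity)]
      rw [not_and_or, not_le, not_le] at hbig
      rcases hbig with h | h
      · have : p < 256 := by
          have := Nat.lt_succ_sqrt' p
          have h3 : (p.sqrt.succ) ^ 2 ≤ 16 ^ 2 := Nat.pow_le_pow_left h 2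
          omega
        have : (p : ℝ) < 256 := by exact_mod_cast this
        have : (0 : ℝ) ≤ m := Nat.cast_nonneg _
        nlinarith
      · have : (p : ℝ) < 2 * m := by exact_mod_cast h
        have : (0 : ℝ) ≤ m := Nat.cast_nonneg _
        nlinarith
    calc (p : ℝ) = √p * √p := hsq.symm
      _ ≤ _ := mul_le_mul_of_nonneg_right hle (Real.sqrt_nonneg _)

end Weil

section JacobiSums

/-- The Jacobi symbol modulo `d` as a real valued function on `ZMod d`. -/
noncomputable def jac (d : ℕ) (z : ZMod d) : ℝ := jacobiSym z.val d

lemma jac_intCast (d : ℕ) [NeZero d] (n : ℤ) : jac d (n : ZMod d) = jacobiSym n d := by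
  rw [jac, ZMod.val_intCast, ← jacobiSym.mod_left]

lemma jac_mul (d : ℕ) [NeZero d] (z w : ZMod d) : jac d (z * w) = jac d z * jac d w := by
  obtain ⟨a, rfl⟩ := ZMod.intCast_surjective z
  obtain ⟨b, rfl⟩ := ZMod.intCast_surjective w
  rw [← Int.cast_mul, jac_intCast, jac_intCast, jac_intCast, jacobiSym.mul_left]
  push_cast; rfl

lemma jac_mul_right (m n : ℕ) [NeZero m] [NeZero n] (z : ZMod (m * n)) :
    jac (m * n) z = jac m (ZMod.castHom (dvd_mul_right m n) _ z) *
      jac n (ZMod.castHom (dvd_mul_left n m) _ z) := by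
  obtain ⟨a, rfl⟩ := ZMod.intCast_surjective z
  rw [map_intCast, map_intCast, jac_intCast, jac_intCast, jac_intCast, jacobiSym.mul_right]
  push_cast; rfl

lemma abs_jac_le_one (d : ℕ) (z : ZMod d) : |jac d z| ≤ 1 := by
  rw [jac]
  rcases jacobiSym.trichotomy z.val d with h | h | h <;> simp [h]

lemma jac_prime (p : ℕ) [Fact p.Prime] (z : ZMod p) :
    jac p z = (quadraticChar (ZMod p) z : ℤ) := by
  obtain ⟨a, rfl⟩ := ZMod.intCast_surjective z
  rw [jac_intCast, ← jacobiSym.legendreSym.to_jacobiSym]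
  rfl

lemma sum_mul_castHom {m n : ℕ} [NeZero m] [NeZero n] (hmn : m.Coprime n) (f : ZMod m → ℝ)
    (g : ZMod n → ℝ) :
    ∑ z : ZMod (m * n), f (ZMod.castHom (dvd_mul_right m n) _ z) *
      g (ZMod.castHom (dvd_mul_left n m) _ z) = (∑ x, f x) * ∑ y, g y := by
  rw [Fintype.sum_mul_sum, ← Fintype.sum_prod_type']
  refine Fintype.sum_equiv (ZMod.chineseRemainder hmn).toEquiv _ _ fun z => ?_
  obtain ⟨a, rfl⟩ := ZMod.intCast_surjective z
  have h : (ZMod.chineseRemainder hmn).toEquiv (a : ZMod (m * n)) =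
      ((a : ZMod m), (a : ZMod n)) := by
    have := map_intCast (ZMod.chineseRemainder hmn) a
    exact this
  rw [h, map_intCast, map_intCast]

/-- The weight attached to a pair of shifts in a complete character sum. -/
noncomputable def shiftWeight (d x y : ℕ) : ℝ :=
  if x = y then 1 else √(Nat.gcd d ((x : ℤ) - y).natAbs)

lemma shiftWeight_mul {m n : ℕ} (hmn : m.Coprime n) (x y : ℕ) :
    shiftWeight (m * n) x y = shiftWeight m x y * shiftWeight n x y := by
  rw [shiftWeight, shiftWeight, shiftWeight]
  split_ifs
  · simp
  · rw [Nat.gcd_comm, hmn.gcd_mul, Nat.gcd_comm _ m, Nat.gcd_comm _ n, Nat.cast_mul,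
      Real.sqrt_mul (Nat.cast_nonneg _)]

lemma one_le_shiftWeight {d : ℕ} (hd : d ≠ 0) (x y : ℕ) : 1 ≤ shiftWeight d x y := by
  rw [shiftWeight]
  split_ifs
  · rfl
  · rw [Real.one_le_sqrt]
    exact_mod_cast Nat.gcd_pos_of_pos_left _ (Nat.pos_of_ne_zero hd)

open Polynomial in
lemma abs_complete_sum_prime_le {k : ℕ} (hk : k ≤ 12) (b : Fin k → ℕ) (j : Fin k)
    (hj : Odd #{i | b i = b j}) (p : ℕ) [Fact p.Prime] (hp2 : p ≠ 2) :
    |∑ y : ZMod p, ∏ i, jac p (y + b i)| ≤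
      (p.divisors.card : ℝ) ^ 11 * √p * ∏ i, shiftWeight p (b i) (b j) := by
  have hpp : p.Prime := Fact.out
  have hw : 1 ≤ ∏ i, shiftWeight p (b i) (b j) :=
    Finset.one_le_prod fun i _ => one_le_shiftWeight hpp.ne_zero _ _
  have hcard : (p.divisors.card : ℝ) ^ 11 = 2048 := by
    rw [hpp.divisors, card_pair hpp.one_lt.ne]; norm_num
  rw [hcard]
  have hsq : 0 ≤ √(p : ℝ) := Real.sqrt_nonneg _
  by_cases hodd : Odd #{i | (b i : ZMod p) = b j}
  · set f : (ZMod p)[X] := ∏ i, (X - C (-(b i : ZMod p))) with hf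
    have hdeg : f.natDegree ≤ 12 := by
      rw [hf, natDegree_prod_of_monic _ _ fun i _ => monic_X_sub_C _]
      simp_rw [natDegree_X_sub_C]
      simpa using hk
    have hmult : Odd (f.rootMultiplicity (-(b j : ZMod p))) := by
      have : f.rootMultiplicity (-(b j : ZMod p)) = #{i | (b i : ZMod p) = b j} := by
        rw [← count_roots, hf, roots_prod _ _ (by
          rw [Finset.prod_ne_zero_iff]; exact fun i _ => X_sub_C_ne_zero _)]
        simp only [roots_X_sub_C, Multiset.count_bind, Multiset.count_singleton]
        rw [card_filter]
        change ∑ i, _ = _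
        refine sum_congr rfl fun i _ => ?_
        simp [eq_comm]
      rwa [this]
    have := weil_bound f hdeg hp2 hmult
    have hsum : ∑ y : ZMod p, ∏ i, jac p (y + b i) =
        ((∑ x : ZMod p, quadraticChar (ZMod p) (f.eval x) : ℤ) : ℝ) := by
      push_cast
      refine sum_congr rfl fun y _ => ?_
      rw [hf, eval_prod, map_prod]
      push_cast
      refine prod_congr rfl fun i _ => ?_
      rw [jac_prime]; simp
    rw [hsum]
    push_cast at this ⊢
    nlinarith
  · have hex : ∃ i, b i ≠ b j ∧ (b i : ZMod p) = b j := by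
      by_contra! hcon
      refine hodd ?_
      convert hj using 2
      ext i
      simp only [mem_filter, mem_univ, true_and]
      exact ⟨fun h => by_contra fun h' => hcon i h' h, fun h => by rw [h]⟩
    obtain ⟨i, hi, hi'⟩ := hex
    have hwi : shiftWeight p (b i) (b j) = √p := by
      rw [shiftWeight, if_neg hi]
      have : (p : ℤ) ∣ (b i : ℤ) - b j := by
        rw [← ZMod.intCast_zmod_eq_zero_iff_dvd]; simp [hi']
      rw [Nat.gcd_eq_left (Int.natCast_dvd.1 this)]
    have hw' : √p ≤ ∏ i, shiftWeight p (b i) (b j) := by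
      rw [← hwi, ← mul_prod_erase univ _ (mem_univ i)]
      refine le_mul_of_one_le_right (zero_le_one.trans (one_le_shiftWeight hpp.ne_zero _ _)) ?_
      exact Finset.one_le_prod fun i _ => one_le_shiftWeight hpp.ne_zero _ _
    have htriv : |∑ y : ZMod p, ∏ i, jac p (y + b i)| ≤ p := by
      refine (abs_sum_le_sum_abs _ _).trans ?_
      refine (sum_le_card_nsmul _ _ 1 fun y _ => ?_).trans (by simp [ZMod.card])
      rw [abs_prod]
      exact prod_le_one (fun _ _ => abs_nonneg _) fun _ _ => abs_jac_le_one _ _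
    have hss : √(p : ℝ) * √p = p := Real.mul_self_sqrt (Nat.cast_nonneg _)
    nlinarith [mul_le_mul_of_nonneg_left hw' hsq]

/-- Bound for complete sums of products of shifted Jacobi symbols. -/
lemma abs_complete_sum_le {k : ℕ} (hk : k ≤ 12) (b : Fin k → ℕ) (j : Fin k)
    (hj : Odd #{i | b i = b j}) (d : ℕ) (hodd : Odd d) (hsf : Squarefree d) [NeZero d] :
    |∑ y : ZMod d, ∏ i, jac d (y + b i)| ≤
      (d.divisors.card : ℝ) ^ 11 * √d * ∏ i, shiftWeight d (b i) (b j) := by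
  suffices H : ∀ d : ℕ, Odd d → Squarefree d → ∀ [NeZero d],
      |∑ y : ZMod d, ∏ i, jac d (y + b i)| ≤
      (d.divisors.card : ℝ) ^ 11 * √d * ∏ i, shiftWeight d (b i) (b j) from H d hodd hsf
  intro d
  induction d using induction_on_primes with
  | zero => intro h; simp at h
  | one =>
    intro _ _ _
    have hw : 1 ≤ ∏ i, shiftWeight 1 (b i) (b j) :=
      Finset.one_le_prod fun i _ => one_le_shiftWeight one_ne_zero _ _
    refine le_trans ?_ (hw.trans (le_of_eq (by simp)))
    refine (abs_sum_le_sum_abs _ _).trans ?_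
    refine (sum_le_card_nsmul _ _ 1 fun y _ => ?_).trans (by simp)
    rw [abs_prod]
    exact prod_le_one (fun _ _ => abs_nonneg _) fun _ _ => abs_jac_le_one _ _
  | prime_mul p a hp ih =>
    intro hodd hsf _
    have hpf : Fact p.Prime := ⟨hp⟩
    have ha0 : a ≠ 0 := right_ne_zero_of_mul hsf.ne_zero
    have : NeZero a := ⟨ha0⟩
    have hcop : p.Coprime a := Nat.coprime_of_squarefree_mul hsf
    have hpo : Odd p := (Nat.odd_mul.1 hodd).1
    have h1 := abs_complete_sum_prime_le hk b j hj p (by rintro rfl; exact absurd hpo (by decide))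
    have h2 := ih (Nat.odd_mul.1 hodd).2 (hsf.squarefree_of_dvd (dvd_mul_left _ _))
    have hmul : ∑ y : ZMod (p * a), ∏ i, jac (p * a) (y + b i) =
        (∑ y : ZMod p, ∏ i, jac p (y + b i)) * ∑ y : ZMod a, ∏ i, jac a (y + b i) := by
      rw [← sum_mul_castHom hcop]
      refine sum_congr rfl fun y _ => ?_
      rw [← prod_mul_distrib]
      refine prod_congr rfl fun i _ => ?_
      rw [jac_mul_right, map_add, map_add, map_natCast, map_natCast]
    rw [hmul, abs_mul, hcop.card_divisors_mul]
    rw [prod_congr rfl fun i _ => shiftWeight_mul hcop (b i) (b j)]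
    rw [prod_mul_distrib, Nat.cast_mul, Nat.cast_mul, Real.sqrt_mul (Nat.cast_nonneg _)]
    refine (mul_le_mul h1 h2 (abs_nonneg _) ((abs_nonneg _).trans h1)).trans (le_of_eq ?_)
    ring

end JacobiSums

section Moments

lemma card_filter_dvd_sub_le {B g : ℕ} (hg : 0 < g) {v : ℕ} (hv : v < B) :
    #{x ∈ range B | x ≠ v ∧ (g : ℤ) ∣ (x : ℤ) - v} ≤ 2 * (B / g) := by
  have hsub : {x ∈ range B | x ≠ v ∧ (g : ℤ) ∣ (x : ℤ) - v} ⊆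
      (Ioc 0 (B / g)).image (fun k => v + g * k) ∪ (Ioc 0 (B / g)).image (fun k => v - g * k) := by
    intro x hx
    simp only [mem_filter, mem_range] at hx
    obtain ⟨hxB, hxv, hdvd⟩ := hx
    rw [mem_union, mem_image, mem_image]
    rcases lt_or_gt_of_ne hxv with h | h
    · right
      have : g ∣ v - x := by
        zify [h.le]
        rw [dvd_sub_comm]; exact hdvd
      obtain ⟨k, hk⟩ := this
      refine ⟨k, ?_, by omega⟩
      rw [mem_Ioc, Nat.le_div_iff_mul_le hg]
      refine ⟨Nat.pos_of_ne_zero ?_, by rw [mul_comm]; omega⟩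
      rintro rfl; omega
    · left
      have : g ∣ x - v := by
        zify [h.le]; exact hdvd
      obtain ⟨k, hk⟩ := this
      refine ⟨k, ?_, by omega⟩
      rw [mem_Ioc, Nat.le_div_iff_mul_le hg]
      refine ⟨Nat.pos_of_ne_zero ?_, by rw [mul_comm]; omega⟩
      rintro rfl; omega
  refine (card_le_card hsub).trans ((card_union_le _ _).trans ?_)
  have h1 := card_image_le (s := Ioc 0 (B / g)) (f := fun k => v + g * k)
  have h2 := card_image_le (s := Ioc 0 (B / g)) (f := fun k => v - g * k)
  rw [Nat.card_Ioc] at h1 h2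
  omega

lemma sum_shiftWeight_le {d : ℕ} (hd : d ≠ 0) {B v : ℕ} (hv : v < B) :
    ∑ x ∈ range B, shiftWeight d x v ≤ 3 * B * d.divisors.card := by
  have hpt : ∀ x ∈ range B, shiftWeight d x v ≤ (if x = v then 1 else 0) +
      ∑ g ∈ d.divisors, if x ≠ v ∧ (g : ℤ) ∣ (x : ℤ) - v then √(g : ℝ) else 0 := by
    intro x _
    have hnn : ∀ g ∈ d.divisors,
        0 ≤ if x ≠ v ∧ (g : ℤ) ∣ (x : ℤ) - v then √(g : ℝ) else 0 := by
      intro g _; split_ifs <;> positivity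
    by_cases h : x = v
    · simp [shiftWeight, h]
    · rw [shiftWeight, if_neg h, if_neg h, zero_add]
      have hmem : Nat.gcd d ((x : ℤ) - v).natAbs ∈ d.divisors :=
        Nat.mem_divisors.2 ⟨Nat.gcd_dvd_left _ _, hd⟩
      refine le_trans ?_ (single_le_sum hnn hmem)
      rw [if_pos ⟨h, Int.natCast_dvd.2 (Nat.gcd_dvd_right _ _)⟩]
  refine (sum_le_sum hpt).trans ?_
  rw [sum_add_distrib, sum_comm]
  have h1 : ∑ x ∈ range B, (if x = v then (1 : ℝ) else 0) = 1 := by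
    rw [sum_ite_eq', if_pos (mem_range.2 hv)]
  have h2 : ∀ g ∈ d.divisors, ∑ x ∈ range B,
      (if x ≠ v ∧ (g : ℤ) ∣ (x : ℤ) - v then √(g : ℝ) else 0) ≤ 2 * B := by
    intro g hg
    have hg0 : 0 < g := Nat.pos_of_mem_divisors hg
    rw [← sum_filter, sum_const, nsmul_eq_mul]
    have hc : ((#{x ∈ range B | x ≠ v ∧ (g : ℤ) ∣ (x : ℤ) - v} : ℕ) : ℝ) ≤ 2 * (B / g) := by
      have : ((#{x ∈ range B | x ≠ v ∧ (g : ℤ) ∣ (x : ℤ) - v} : ℕ) : ℝ) ≤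
          ((2 * (B / g) : ℕ) : ℝ) := by exact_mod_cast card_filter_dvd_sub_le hg0 hv
      refine this.trans ?_
      push_cast
      gcongr
      exact Nat.cast_div_le
    have hg1 : (1 : ℝ) ≤ g := by exact_mod_cast hg0
    have hsg : √(g : ℝ) ≤ g := by
      rw [Real.sqrt_le_left (by positivity)]; nlinarith
    calc _ ≤ 2 * ((B : ℝ) / g) * g := by gcongr
      _ = _ := by field_simp
  have h3 := sum_le_sum h2
  rw [sum_const, nsmul_eq_mul] at h3
  have hB : (1 : ℝ) ≤ B := by exact_mod_cast (by omega : 1 ≤ B)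
  have hτ : (1 : ℝ) ≤ d.divisors.card := by
    exact_mod_cast card_pos.2 ⟨1, Nat.one_mem_divisors.2 hd⟩
  nlinarith

lemma sum_prod_shiftWeight_le {d : ℕ} (hd : d ≠ 0) (B : ℕ) {k : ℕ} (j : Fin k) :
    ∑ b ∈ Fintype.piFinset fun _ : Fin k => range B, ∏ i, shiftWeight d (b i) (b j) ≤
      B * (3 * B * d.divisors.card) ^ (k - 1) := by
  have h1 : ∀ b ∈ Fintype.piFinset fun _ : Fin k => range B,
      ∏ i, shiftWeight d (b i) (b j) = ∑ v ∈ range B, ∏ i,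
        if i = j then (if b i = v then 1 else 0) else shiftWeight d (b i) v := by
    intro b hb
    rw [Fintype.mem_piFinset] at hb
    rw [sum_eq_single_of_mem (b j) (hb j)]
    · refine prod_congr rfl fun i _ => ?_
      split_ifs with h1 h2
      · subst h1; simp [shiftWeight]
      · subst h1; exact absurd rfl h2
      · rfl
    · intro v _ hv
      refine prod_eq_zero (mem_univ j) ?_
      rw [if_pos rfl, if_neg hv.symm]
  rw [sum_congr rfl h1, sum_comm]
  have h2 : ∀ v ∈ range B, ∑ b ∈ Fintype.piFinset fun _ : Fin k => range B, ∏ i,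
      (if i = j then (if b i = v then 1 else 0) else shiftWeight d (b i) v) ≤
      (3 * B * d.divisors.card : ℝ) ^ (k - 1) := by
    intro v hv
    rw [← prod_univ_sum (fun _ : Fin k => range B)
      (fun i x => if i = j then (if x = v then (1 : ℝ) else 0) else shiftWeight d x v)]
    have h3 : ∏ i : Fin k, (if i = j then (1 : ℝ) else 3 * B * d.divisors.card) =
        (3 * B * d.divisors.card : ℝ) ^ (k - 1) := by
      rw [prod_ite, prod_const_one, one_mul, prod_const, filter_ne' univ j,
        card_erase_of_mem (mem_univ j), card_univ, Fintype.card_fin]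
    rw [← h3]
    refine prod_le_prod (fun i _ => sum_nonneg fun x _ => ?_) fun i _ => ?_
    · split_ifs
      · exact zero_le_one
      · exact le_rfl
      · exact zero_le_one.trans (one_le_shiftWeight hd _ _)
    · by_cases hij : i = j
      · simp only [if_pos hij]
        rw [sum_ite_eq', if_pos hv]
      · simp only [if_neg hij]
        exact sum_shiftWeight_le hd (mem_range.1 hv)
  refine (sum_le_sum h2).trans ?_
  rw [sum_const, nsmul_eq_mul, card_range]

lemma card_even_tuples_le {r : ℕ} (hr : 1 ≤ r) (B : ℕ) :
    #{b ∈ Fintype.piFinset fun _ : Fin (2 * r) => range B | ∀ j, ¬ Odd #{i | b i = b j}} ≤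
      r ^ (2 * r) * B ^ r := by
  have hsub : {b ∈ Fintype.piFinset fun _ : Fin (2 * r) => range B |
      ∀ j, ¬ Odd #{i | b i = b j}} ⊆
      image₂ (fun (e : Fin (2 * r) → Fin r) (c : Fin r → ℕ) i => c (e i)) univ
        (Fintype.piFinset fun _ : Fin r => range B) := by
    intro b hb
    rw [mem_filter, Fintype.mem_piFinset] at hb
    obtain ⟨hbB, hev⟩ := hb
    have hcard : Fintype.card (Set.range b) ≤ Fintype.card (Fin r) := by
      rw [Fintype.card_fin, ← Set.toFinset_card, Set.toFinset_range]
      have h2 : ∀ x ∈ univ.image b, 2 ≤ #{i | b i = x} := by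
        intro x hx
        obtain ⟨j, -, rfl⟩ := mem_image.1 hx
        have hpos : 0 < #{i | b i = b j} := card_pos.2 ⟨j, by simp⟩
        have := hev j
        rw [Nat.not_odd_iff_even] at this
        obtain ⟨t, ht⟩ := this
        omega
      have h3 := card_eq_sum_card_image b (univ : Finset (Fin (2 * r)))
      have h4 := card_nsmul_le_sum _ _ 2 h2
      rw [← h3, card_univ, Fintype.card_fin, smul_eq_mul] at h4
      omega
    obtain ⟨⟨φ, hφ⟩⟩ := Function.Embedding.nonempty_of_card_le hcard
    have : Nonempty (Set.range b) := ⟨⟨b ⟨0, by omega⟩, ⟨_, rfl⟩⟩⟩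
    rw [mem_image₂]
    refine ⟨fun i => φ ⟨b i, ⟨i, rfl⟩⟩, mem_univ _, fun t => (Function.invFun φ t).1, ?_, ?_⟩
    · rw [Fintype.mem_piFinset]
      intro t
      obtain ⟨i, hi⟩ := (Function.invFun φ t).2
      rw [← hi]; exact hbB i
    · funext i
      exact congrArg Subtype.val (Function.leftInverse_invFun hφ ⟨b i, ⟨i, rfl⟩⟩)
  refine (card_le_card hsub).trans ((card_image₂_le _ _ _).trans (le_of_eq ?_))
  simp

/-- Moment bound for short sums of Jacobi symbols. -/
theorem moment_bound {r : ℕ} (hr : 1 ≤ r) (hr6 : r ≤ 6) {d : ℕ} (hodd : Odd d)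
    (hsf : Squarefree d) [NeZero d] {B : ℕ} (hB : 1 ≤ B) :
    ∑ y : ZMod d, (∑ b ∈ range B, jac d (y + b)) ^ (2 * r) ≤
      r ^ (2 * r) * B ^ r * d +
        12 * 177147 * (d.divisors.card : ℝ) ^ 22 * B ^ (2 * r) * √d := by
  have hd : d ≠ 0 := NeZero.ne d
  set τ : ℝ := (d.divisors.card : ℝ) with hτdef
  have hτ : 1 ≤ τ := by
    rw [hτdef]
    exact_mod_cast card_pos.2 ⟨1, Nat.one_mem_divisors.2 hd⟩
  set P := Fintype.piFinset fun _ : Fin (2 * r) => range B with hP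
  simp_rw [sum_pow' (range B)]
  rw [sum_comm]
  have hpt : ∀ b ∈ P, ∑ y : ZMod d, ∏ i, jac d (y + b i) ≤
      (if ∀ j, ¬ Odd #{i | b i = b j} then (d : ℝ) else 0) +
      ∑ j, τ ^ 11 * √d * ∏ i, shiftWeight d (b i) (b j) := by
    intro b _
    have hnn : ∀ j ∈ (univ : Finset (Fin (2 * r))),
        0 ≤ τ ^ 11 * √d * ∏ i, shiftWeight d (b i) (b j) := by
      intro j _
      have : 0 ≤ ∏ i, shiftWeight d (b i) (b j) :=
        prod_nonneg fun i _ => zero_le_one.trans (one_le_shiftWeight hd _ _)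
      positivity
    split_ifs with h
    · refine le_add_of_le_of_nonneg ?_ (sum_nonneg hnn)
      refine (le_abs_self _).trans ((abs_sum_le_sum_abs _ _).trans ?_)
      refine (sum_le_card_nsmul _ _ 1 fun y _ => ?_).trans (by simp [ZMod.card])
      rw [abs_prod]
      exact prod_le_one (fun _ _ => abs_nonneg _) fun _ _ => abs_jac_le_one _ _
    · push Not at h
      obtain ⟨j, hj⟩ := h
      rw [zero_add]
      refine le_trans ?_ (single_le_sum hnn (mem_univ j))
      exact (le_abs_self _).trans (abs_complete_sum_le (by omega) b j hj d hodd hsf)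
  refine (sum_le_sum hpt).trans ?_
  rw [sum_add_distrib, sum_comm]
  refine add_le_add ?_ ?_
  · rw [← sum_filter, sum_const, nsmul_eq_mul]
    gcongr
    exact_mod_cast card_even_tuples_le hr B
  · have h1 : ∀ j ∈ (univ : Finset (Fin (2 * r))),
        ∑ b ∈ P, τ ^ 11 * √d * ∏ i, shiftWeight d (b i) (b j) ≤
          τ ^ 11 * √d * (B * (3 * B * τ) ^ (2 * r - 1)) := by
      intro j _
      rw [← mul_sum]
      have := sum_prod_shiftWeight_le hd B j
      gcongr
    refine (sum_le_sum h1).trans ?_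
    rw [sum_const, nsmul_eq_mul, card_univ, Fintype.card_fin]
    obtain ⟨k, hk⟩ : ∃ k, 2 * r - 1 = k := ⟨_, rfl⟩
    have hk' : 2 * r = k + 1 := by omega
    have hk11 : k ≤ 11 := by omega
    rw [hk, hk']
    clear_value τ
    have e1 : (3 : ℝ) ^ k ≤ 177147 :=
      (pow_le_pow_right₀ (by norm_num) hk11).trans (by norm_num)
    have e2 : τ ^ k ≤ τ ^ 11 := pow_le_pow_right₀ hτ hk11
    have e3 : ((k + 1 : ℕ) : ℝ) ≤ 12 := by exact_mod_cast (by omega : k + 1 ≤ 12)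
    calc ((k + 1 : ℕ) : ℝ) * (τ ^ 11 * √d * (B * (3 * B * τ) ^ k))
        = ((k + 1 : ℕ) : ℝ) * 3 ^ k * (τ ^ 11 * τ ^ k) * B ^ (k + 1) * √d := by ring
      _ ≤ 12 * 177147 * (τ ^ 11 * τ ^ 11) * B ^ (k + 1) * √d := by gcongr
      _ = _ := by ring

end Moments

section Divisors

lemma card_divisors_eq_two_pow {d : ℕ} (hd : Squarefree d) :
    d.divisors.card = 2 ^ d.primeFactors.card := by
  rw [Nat.card_divisors hd.ne_zero, ← prod_const]
  refine prod_congr rfl fun p hp => ?_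
  rw [Nat.factorization_eq_one_of_squarefree hd (Nat.prime_of_mem_primeFactors hp)
    (Nat.dvd_of_mem_primeFactors hp)]

/-- The divisor bound for squarefree integers. -/
lemma exists_card_divisors_le {ε : ℝ} (hε : 0 < ε) :
    ∃ K : ℝ, 1 ≤ K ∧ ∀ d : ℕ, Squarefree d → (d.divisors.card : ℝ) ≤ K * (d : ℝ) ^ ε := by
  obtain ⟨P, hP⟩ := exists_nat_gt ((2 : ℝ) ^ (1 / ε))
  refine ⟨2 ^ P, one_le_pow₀ (by norm_num), fun d hd => ?_⟩
  have h1 : ∀ p ∈ d.primeFactors, (2 : ℝ) ≤ (if p ∈ range P then 2 else 1) * (p : ℝ) ^ ε := by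
    intro p hp
    have hp1 : (1 : ℝ) ≤ p := by exact_mod_cast (Nat.prime_of_mem_primeFactors hp).one_lt.le
    split_ifs with h
    · have := Real.one_le_rpow hp1 hε.le
      linarith
    · rw [one_mul]
      rw [mem_range, not_lt] at h
      have h' : (2 : ℝ) ^ (1 / ε) ≤ p := hP.le.trans (by exact_mod_cast h)
      calc (2 : ℝ) = ((2 : ℝ) ^ (1 / ε)) ^ ε := by
            rw [← Real.rpow_mul (by norm_num), one_div_mul_cancel hε.ne', Real.rpow_one]
        _ ≤ _ := Real.rpow_le_rpow (by positivity) h' hε.le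
  have h2 : (d : ℝ) ^ ε = ∏ p ∈ d.primeFactors, (p : ℝ) ^ ε := by
    rw [Real.finsetProd_rpow _ _ fun p _ => Nat.cast_nonneg p]
    congr 1
    rw [← Nat.cast_prod, Nat.prod_primeFactors_of_squarefree hd]
  have h3 : ∏ p ∈ d.primeFactors, (if p ∈ range P then (2 : ℝ) else 1) ≤ 2 ^ P := by
    rw [prod_ite, prod_const_one, mul_one, prod_const]
    refine pow_le_pow_right₀ (by norm_num) ?_
    refine (card_le_card (t := range P) fun x hx => (mem_filter.1 hx).2).trans ?_
    rw [card_range]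
  calc (d.divisors.card : ℝ) = ∏ _p ∈ d.primeFactors, (2 : ℝ) := by
        rw [card_divisors_eq_two_pow hd, prod_const]; push_cast; rfl
    _ ≤ ∏ p ∈ d.primeFactors, ((if p ∈ range P then 2 else 1) * (p : ℝ) ^ ε) :=
        prod_le_prod (fun _ _ => by norm_num) h1
    _ = (∏ p ∈ d.primeFactors, (if p ∈ range P then (2 : ℝ) else 1)) * (d : ℝ) ^ ε := by
        rw [prod_mul_distrib, h2]
    _ ≤ _ := by gcongr

lemma exists_density_coprime {d : ℕ} (hd : Squarefree d) :
    ∃ ρ : ℝ, 1 / (d.divisors.card : ℝ) ≤ ρ ∧ ∀ x : ℝ, 0 ≤ x →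
      |(#{a ∈ Ioc 0 ⌊x⌋₊ | d.Coprime a} : ℝ) - x * ρ| ≤ d.divisors.card := by
  induction d using induction_on_primes with
  | zero => simp at hd
  | one =>
    refine ⟨1, by simp, fun x hx => ?_⟩
    have h1 := Nat.floor_le hx
    have h2 := Nat.lt_floor_add_one x
    simp only [Nat.coprime_one_left_eq_true, filter_true, Nat.card_Ioc, Nat.sub_zero,
      Nat.divisors_one, card_singleton, Nat.cast_one]
    rw [abs_le]
    constructor <;> linarith
  | prime_mul p d hp ih =>
    have hsf : Squarefree d := hd.squarefree_of_dvd (dvd_mul_left _ _)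
    have hcop : p.Coprime d := Nat.coprime_of_squarefree_mul hd
    obtain ⟨ρ, hρ, h⟩ := ih hsf
    have hτ : ((p * d).divisors.card : ℝ) = 2 * d.divisors.card := by
      rw [hcop.card_divisors_mul, hp.divisors, card_pair hp.one_lt.ne]; push_cast; ring
    have hp2 : (2 : ℝ) ≤ p := by exact_mod_cast hp.two_le
    have hp0 : (0 : ℝ) < p := by linarith
    have hτ0 : (0 : ℝ) ≤ 1 / d.divisors.card := by
      rw [one_div, inv_nonneg]; exact Nat.cast_nonneg _
    refine ⟨ρ * (1 - 1 / p), ?_, fun x hx => ?_⟩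
    · have h1 : (1 / 2 : ℝ) ≤ 1 - 1 / p := by
        have : (1 : ℝ) / p ≤ 1 / 2 := one_div_le_one_div_of_le (by norm_num) hp2
        linarith
      rw [hτ, one_div, mul_inv, ← one_div, ← one_div, mul_comm]
      exact mul_le_mul hρ h1 (by norm_num) (hτ0.trans hρ)
    · have hcard : #{a ∈ Ioc 0 ⌊x⌋₊ | (p * d).Coprime a} + #{a ∈ Ioc 0 ⌊x / p⌋₊ | d.Coprime a} =
          #{a ∈ Ioc 0 ⌊x⌋₊ | d.Coprime a} := by
        have himg : #{a ∈ Ioc 0 ⌊x / p⌋₊ | d.Coprime a} =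
            #{a ∈ {a ∈ Ioc 0 ⌊x⌋₊ | d.Coprime a} | ¬ p.Coprime a} := by
          refine card_bij (fun a _ => p * a) ?_ ?_ ?_
          · intro a ha
            simp only [mem_filter, mem_Ioc] at ha ⊢
            obtain ⟨⟨ha0, hax⟩, hda⟩ := ha
            refine ⟨⟨⟨Nat.mul_pos hp.pos ha0, ?_⟩, Nat.Coprime.mul_right hcop.symm hda⟩, ?_⟩
            · rw [Nat.le_floor_iff (by positivity), le_div_iff₀ hp0] at hax
              rw [Nat.le_floor_iff hx]; push_cast; linarith
            · rw [hp.coprime_iff_not_dvd, not_not]; exact dvd_mul_right _ _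
          · intro a _ b _ hab
            exact Nat.eq_of_mul_eq_mul_left hp.pos hab
          · intro a ha
            simp only [mem_filter, mem_Ioc] at ha
            obtain ⟨⟨⟨ha0, hax⟩, hda⟩, hpa⟩ := ha
            rw [hp.coprime_iff_not_dvd, not_not] at hpa
            obtain ⟨b, rfl⟩ := hpa
            refine ⟨b, ?_, rfl⟩
            simp only [mem_filter, mem_Ioc]
            refine ⟨⟨Nat.pos_of_mul_pos_left ha0, ?_⟩, hda.coprime_mul_left_right⟩
            rw [Nat.le_floor_iff hx] at hax
            rw [Nat.le_floor_iff (by positivity), le_div_iff₀ hp0]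
            push_cast at hax; linarith
        rw [himg, ← card_filter_add_card_filter_not (s := {a ∈ Ioc 0 ⌊x⌋₊ | d.Coprime a})
          (fun a => p.Coprime a)]
        congr 2
        rw [filter_filter]
        refine filter_congr fun a _ => ?_
        rw [Nat.coprime_mul_iff_left, and_comm]
      have h1 := h x hx
      have h2 := h (x / p) (by positivity)
      have hcard' : (#{a ∈ Ioc 0 ⌊x⌋₊ | (p * d).Coprime a} : ℝ) +
          #{a ∈ Ioc 0 ⌊x / p⌋₊ | d.Coprime a} = #{a ∈ Ioc 0 ⌊x⌋₊ | d.Coprime a} := by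
        exact_mod_cast hcard
      have e : x * (ρ * (1 - 1 / p)) = x * ρ - x / p * ρ := by ring
      rw [hτ, e]
      rw [abs_le] at h1 h2 ⊢
      constructor <;> linarith

lemma card_coprime_Ioc_ge {d A : ℕ} (hd : Squarefree d) (hA : 4 * d.divisors.card ^ 2 ≤ A) :
    (A : ℝ) / (2 * d.divisors.card) ≤ #{a ∈ Ioc A (2 * A) | d.Coprime a} := by
  obtain ⟨ρ, hρ, h⟩ := exists_density_coprime hd
  have h1 := h A (Nat.cast_nonneg _)
  have h2 := h ((2 * A : ℕ) : ℝ) (Nat.cast_nonneg _)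
  rw [Nat.floor_natCast] at h1 h2
  have hsplit : #{a ∈ Ioc 0 A | d.Coprime a} + #{a ∈ Ioc A (2 * A) | d.Coprime a} =
      #{a ∈ Ioc 0 (2 * A) | d.Coprime a} := by
    rw [← card_union_of_disjoint, ← filter_union, Ioc_union_Ioc_eq_Ioc (by omega) (by omega)]
    exact disjoint_filter_filter (Ioc_disjoint_Ioc_of_le le_rfl)
  have hsplit' : (#{a ∈ Ioc 0 A | d.Coprime a} : ℝ) + #{a ∈ Ioc A (2 * A) | d.Coprime a} =
      #{a ∈ Ioc 0 (2 * A) | d.Coprime a} := by exact_mod_cast hsplit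
  have hτ : (1 : ℝ) ≤ d.divisors.card := by
    exact_mod_cast card_pos.2 ⟨1, Nat.one_mem_divisors.2 hd.ne_zero⟩
  have hA' : 4 * (d.divisors.card : ℝ) ^ 2 ≤ A := by exact_mod_cast hA
  generalize (d.divisors.card : ℝ) = τ at *
  have h3 : 2 * τ ≤ A / (2 * τ) := by
    rw [le_div_iff₀ (by linarith)]; nlinarith
  have h4 : (A : ℝ) / τ = 2 * (A / (2 * τ)) := by field_simp
  have h5 : (A : ℝ) / τ ≤ A * ρ := by
    rw [div_eq_mul_one_div]; gcongr
  push_cast at h2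
  rw [abs_le] at h1 h2
  linarith

end Divisors

section Collisions

lemma sum_comp_pow_twelve_le {ι Z : Type*} [Fintype Z] [DecidableEq Z] (X : Finset ι)
    (y : ι → Z) (g : Z → ℝ) (hg : ∀ z, 0 ≤ g z) :
    (∑ x ∈ X, g (y x)) ^ 12 ≤ (#X : ℝ) ^ 10 *
      (∑ x ∈ X, ∑ x' ∈ X, if y x = y x' then (1 : ℝ) else 0) * ∑ z, g z ^ 12 := by
  have hS : 0 ≤ ∑ x ∈ X, g (y x) := sum_nonneg fun x _ => hg _
  have h1 : (∑ x ∈ X, g (y x)) ^ 6 ≤ (#X : ℝ) ^ 5 * ∑ x ∈ X, g (y x) ^ 6 :=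
    pow_sum_le_card_mul_sum_pow (fun x _ => hg (y x)) 5
  have h2 : ∑ x ∈ X, g (y x) ^ 6 = ∑ z, (#{x ∈ X | y x = z} : ℝ) * g z ^ 6 := by
    rw [← sum_fiberwise X y]
    refine sum_congr rfl fun z _ => ?_
    rw [← nsmul_eq_mul, ← sum_const]
    exact sum_congr rfl fun x hx => by rw [(mem_filter.1 hx).2]
  have h3 : ∑ z, (#{x ∈ X | y x = z} : ℝ) ^ 2 =
      ∑ x ∈ X, ∑ x' ∈ X, if y x = y x' then (1 : ℝ) else 0 := by
    rw [← sum_fiberwise X y]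
    refine sum_congr rfl fun z _ => ?_
    rw [sq, ← nsmul_eq_mul, ← sum_const]
    refine sum_congr rfl fun x hx => ?_
    rw [← sum_filter, sum_const, nsmul_eq_mul, mul_one, (mem_filter.1 hx).2]
    simp_rw [eq_comm]
  have h4 := sum_mul_sq_le_sq_mul_sq univ (fun z => (#{x ∈ X | y x = z} : ℝ)) fun z => g z ^ 6
  simp only [← pow_mul] at h4
  rw [← h2, h3] at h4
  calc (∑ x ∈ X, g (y x)) ^ 12 = ((∑ x ∈ X, g (y x)) ^ 6) ^ 2 := by ring
    _ ≤ ((#X : ℝ) ^ 5 * ∑ x ∈ X, g (y x) ^ 6) ^ 2 := pow_le_pow_left₀ (pow_nonneg hS _) h1 _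
    _ = (#X : ℝ) ^ 10 * (∑ x ∈ X, g (y x) ^ 6) ^ 2 := by ring
    _ ≤ _ := by
      rw [mul_assoc]
      exact mul_le_mul_of_nonneg_left h4 (by positivity)

lemma card_solutions_le {H a a' : ℕ} (ha : 0 < a) (m : ℤ) :
    (#{i ∈ range H ×ˢ range H | (i.1 : ℤ) * a' - i.2 * a = m} : ℝ) ≤
      1 + H * Nat.gcd a a' / a := by
  set S := {i ∈ range H ×ˢ range H | (i.1 : ℤ) * a' - i.2 * a = m} with hS
  set g := Nat.gcd a a' with hg
  have hg0 : 0 < g := Nat.gcd_pos_of_pos_left _ ha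
  obtain ⟨q, hq⟩ : g ∣ a := Nat.gcd_dvd_left _ _
  have hq0 : 0 < q := Nat.pos_of_ne_zero (by rintro rfl; omega)
  have hqa : a / g = q := by rw [hq, Nat.mul_div_cancel_left _ hg0]
  have key : ∀ s ∈ S, ∀ t ∈ S, s.1 % q = t.1 % q := by
    intro s hs t ht
    have hs' := (mem_filter.1 hs).2
    have ht' := (mem_filter.1 ht).2
    have h1 : (a : ℤ) ∣ ((t.1 : ℤ) - s.1) * a' := ⟨(t.2 : ℤ) - s.2, by linear_combination ht' - hs'⟩
    have h2 : (q : ℤ) ∣ (t.1 : ℤ) - s.1 := by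
      obtain ⟨q', hq'⟩ : g ∣ a' := Nat.gcd_dvd_right _ _
      have hcop : q.Coprime q' := by
        have := Nat.coprime_div_gcd_div_gcd hg0
        rwa [← hg, hqa, hq', Nat.mul_div_cancel_left _ hg0] at this
      have h3 : (g : ℤ) * q ∣ g * (((t.1 : ℤ) - s.1) * q') := by
        rw [hq, hq'] at h1
        push_cast at h1
        convert h1 using 1; ring
      have h4 := Int.dvd_of_mul_dvd_mul_left (by exact_mod_cast hg0.ne') h3
      exact IsCoprime.dvd_of_dvd_mul_right (Nat.isCoprime_iff_coprime.2 hcop) h4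
    exact (Nat.modEq_iff_dvd.2 h2)
  have hcard : #S ≤ H / q + 1 := by
    rw [← card_range (H / q + 1)]
    refine card_le_card_of_injOn (fun s => s.1 / q) ?_ ?_
    · intro s hs
      have hs1 := (mem_product.1 (mem_filter.1 hs).1).1
      rw [mem_range] at hs1
      simp only [coe_range, Set.mem_Iio]
      exact Nat.lt_succ_of_le (Nat.div_le_div_right hs1.le)
    · intro s hs t ht hst
      have h1 : s.1 = t.1 := by
        have h2 := key s hs t ht
        have h3 : s.1 / q = t.1 / q := hst
        rw [← Nat.div_add_mod s.1 q, ← Nat.div_add_mod t.1 q, h2, h3]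
      have hs' := (mem_filter.1 hs).2
      have ht' := (mem_filter.1 ht).2
      rw [h1] at hs'
      have h4 : (s.2 : ℤ) * a = t.2 * a := by linear_combination ht' - hs'
      have h5 : s.2 = t.2 := by
        have := mul_right_cancel₀ (by exact_mod_cast ha.ne') h4
        exact_mod_cast this
      exact Prod.ext h1 h5
  have h6 : ((H / q : ℕ) : ℝ) ≤ H * g / a := by
    refine Nat.cast_div_le.trans (le_of_eq ?_)
    have : (a : ℝ) = g * q := by exact_mod_cast hq
    rw [this]
    have : (g : ℝ) ≠ 0 := by exact_mod_cast hg0.ne'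
    have : (q : ℝ) ≠ 0 := by exact_mod_cast hq0.ne'
    field_simp
  have h7 : (#S : ℝ) ≤ ((H / q + 1 : ℕ) : ℝ) := by exact_mod_cast hcard
  push_cast at h7 h6
  linarith

lemma sum_gcd_le (n : ℕ) :
    ∑ a ∈ Ioc 0 n, ∑ a' ∈ Ioc 0 n, (Nat.gcd a a' : ℝ) ≤ n ^ 2 * (1 + Real.log n) := by
  have hpt : ∀ a ∈ Ioc 0 n, ∀ a' ∈ Ioc 0 n, (Nat.gcd a a' : ℝ) ≤
      ∑ g ∈ Ioc 0 n, (g : ℝ) * ((if g ∣ a then 1 else 0) * (if g ∣ a' then 1 else 0)) := by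
    intro a ha a' _
    rw [mem_Ioc] at ha
    have hmem : Nat.gcd a a' ∈ Ioc 0 n :=
      mem_Ioc.2 ⟨Nat.gcd_pos_of_pos_left _ ha.1,
        (Nat.le_of_dvd ha.1 (Nat.gcd_dvd_left _ _)).trans ha.2⟩
    refine le_trans ?_ (single_le_sum (fun g _ => by positivity) hmem)
    rw [if_pos (Nat.gcd_dvd_left _ _), if_pos (Nat.gcd_dvd_right _ _)]
    simp
  have h1 : ∀ g ∈ Ioc 0 n, ∑ a ∈ Ioc 0 n, (if g ∣ a then (1 : ℝ) else 0) ≤ n / g := by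
    intro g _
    rw [← sum_filter, sum_const, nsmul_eq_mul, mul_one, Nat.Ioc_filter_dvd_card_eq_div]
    exact Nat.cast_div_le
  calc _ ≤ ∑ a ∈ Ioc 0 n, ∑ a' ∈ Ioc 0 n, ∑ g ∈ Ioc 0 n,
        (g : ℝ) * ((if g ∣ a then 1 else 0) * (if g ∣ a' then 1 else 0)) :=
        sum_le_sum fun a ha => sum_le_sum fun a' ha' => hpt a ha a' ha'
    _ = ∑ g ∈ Ioc 0 n, (g : ℝ) * ((∑ a ∈ Ioc 0 n, (if g ∣ a then 1 else 0)) *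
        ∑ a ∈ Ioc 0 n, (if g ∣ a then 1 else 0)) := by
        simp_rw [sum_mul_sum, mul_sum]
        rw [sum_comm]
        rw [sum_congr rfl fun y _ => sum_comm, sum_comm]
        refine sum_congr rfl fun g _ => ?_
        rw [sum_comm]
    _ ≤ ∑ g ∈ Ioc 0 n, (g : ℝ) * ((n / g) * (n / g)) := by
        refine sum_le_sum fun g hg => ?_
        have := h1 g hg
        gcongr
    _ = n ^ 2 * ∑ g ∈ Ioc 0 n, (g : ℝ)⁻¹ := by
        rw [mul_sum]
        refine sum_congr rfl fun g hg => ?_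
        have : (g : ℝ) ≠ 0 := by exact_mod_cast (mem_Ioc.1 hg).1.ne'
        field_simp
    _ ≤ _ := by
        have := harmonic_le_one_add_log n
        rw [harmonic_eq_sum_Icc] at this
        push_cast at this
        gcongr
        exact this

lemma sum_collisions_le {d A H : ℕ} (hd : 4 * A * H ≤ d) (hA : 0 < A) (N : ZMod d)
    (𝒜 : Finset ℕ) (h𝒜 : ∀ a ∈ 𝒜, A < a ∧ a ≤ 2 * A ∧ d.Coprime a) :
    ∑ x ∈ 𝒜 ×ˢ range H, ∑ x' ∈ 𝒜 ×ˢ range H,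
      (if (N + x.2) * (x.1 : ZMod d)⁻¹ = (N + x'.2) * (x'.1 : ZMod d)⁻¹ then (1 : ℝ) else 0) ≤
      (#𝒜 : ℝ) ^ 2 + 4 * H * A * (1 + Real.log (2 * A)) := by
  have h1 : ∀ a ∈ 𝒜, ∀ a' ∈ 𝒜, ∑ i ∈ range H, ∑ i' ∈ range H,
      (if (N + i) * (a : ZMod d)⁻¹ = (N + i') * (a' : ZMod d)⁻¹ then (1 : ℝ) else 0) ≤
      1 + H / A * Nat.gcd a a' := by
    intro a ha a' ha'
    obtain ⟨ha1, ha2, hac⟩ := h𝒜 a ha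
    obtain ⟨ha1', ha2', hac'⟩ := h𝒜 a' ha'
    have hA0 : (0 : ℝ) < A := by exact_mod_cast hA
    have haA : (A : ℝ) ≤ a := by exact_mod_cast ha1.le
    rw [← sum_product', ← sum_filter, sum_const, nsmul_eq_mul, mul_one]
    set S := {i ∈ range H ×ˢ range H |
      (N + i.1) * (a : ZMod d)⁻¹ = (N + i.2) * (a' : ZMod d)⁻¹} with hS
    have hle : ∀ m : ℤ, (1 : ℝ) + H * Nat.gcd a a' / a ≤ 1 + H / A * Nat.gcd a a' := by
      intro _
      rw [div_mul_eq_mul_div]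
      gcongr
    rcases S.eq_empty_or_nonempty with hemp | ⟨s, hs⟩
    · rw [hemp]; simp only [card_empty, Nat.cast_zero]; positivity
    · refine le_trans ?_ ((card_solutions_le (H := H) (a' := a') (by omega : 0 < a)
        ((s.1 : ℤ) * a' - s.2 * a)).trans (hle 0))
      rw [Nat.cast_le]
      refine card_le_card fun t ht => ?_
      rw [mem_filter] at ht ⊢
      refine ⟨ht.1, ?_⟩
      have hcong : ∀ t ∈ S, (t.1 : ZMod d) * a' - t.2 * a = N * a - N * a' := by
        intro t ht
        have e := (mem_filter.1 ht).2
        have u := ZMod.coe_mul_inv_eq_one a hac.symm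
        have u' := ZMod.coe_mul_inv_eq_one a' hac'.symm
        linear_combination (a : ZMod d) * a' * e - (N + t.1) * a' * u + (N + t.2) * a * u'
      have hc : (((t.1 : ℤ) * a' - t.2 * a : ℤ) : ZMod d) = (((s.1 : ℤ) * a' - s.2 * a : ℤ)) := by
        push_cast
        rw [hcong t (mem_filter.2 ht), hcong s hs]
      rw [ZMod.intCast_eq_intCast_iff_dvd_sub] at hc
      have hb : ∀ t ∈ S, |(t.1 : ℤ) * a' - t.2 * a| < 2 * A * H := by
        intro t ht
        have ht' := mem_product.1 (mem_filter.1 ht).1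
        rw [mem_range, mem_range] at ht'
        have b1 : (t.1 : ℤ) * a' < 2 * A * H := by
          have : t.1 * a' < 2 * A * H := by
            calc t.1 * a' < H * a' := Nat.mul_lt_mul_of_pos_right ht'.1 (by omega)
              _ ≤ H * (2 * A) := Nat.mul_le_mul_left _ ha2'
              _ = _ := by ring
          exact_mod_cast this
        have b2 : (t.2 : ℤ) * a < 2 * A * H := by
          have : t.2 * a < 2 * A * H := by
            calc t.2 * a < H * a := Nat.mul_lt_mul_of_pos_right ht'.2 (by omega)
              _ ≤ H * (2 * A) := Nat.mul_le_mul_left _ ha2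
              _ = _ := by ring
          exact_mod_cast this
        have b3 : (0 : ℤ) ≤ (t.1 : ℤ) * a' := by positivity
        have b4 : (0 : ℤ) ≤ (t.2 : ℤ) * a := by positivity
        rw [abs_lt]; constructor <;> linarith
      have h0 := Int.eq_zero_of_abs_lt_dvd hc (by
        have e1 := hb t (mem_filter.2 ht)
        have e2 := hb s hs
        have e3 : (4 * A * H : ℤ) ≤ d := by exact_mod_cast hd
        rw [abs_lt] at e1 e2 ⊢
        constructor <;> linarith)
      linarith
  calc _ = ∑ a ∈ 𝒜, ∑ a' ∈ 𝒜, ∑ i ∈ range H, ∑ i' ∈ range H,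
      (if (N + i) * (a : ZMod d)⁻¹ = (N + i') * (a' : ZMod d)⁻¹ then (1 : ℝ) else 0) := by
        rw [sum_product]
        refine sum_congr rfl fun a _ => ?_
        simp_rw [sum_product]
        rw [sum_comm]
    _ ≤ ∑ a ∈ 𝒜, ∑ a' ∈ 𝒜, (1 + H / A * (Nat.gcd a a' : ℝ)) :=
        sum_le_sum fun a ha => sum_le_sum fun a' ha' => h1 a ha a' ha'
    _ = (#𝒜 : ℝ) ^ 2 + H / A * ∑ a ∈ 𝒜, ∑ a' ∈ 𝒜, (Nat.gcd a a' : ℝ) := by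
        simp_rw [sum_add_distrib, ← mul_sum, sum_const, nsmul_eq_mul, mul_one]
        ring
    _ ≤ (#𝒜 : ℝ) ^ 2 + H / A * ((2 * A : ℕ) ^ 2 * (1 + Real.log (2 * A : ℕ))) := by
        have hsub : 𝒜 ⊆ Ioc 0 (2 * A) := fun a ha => by
          obtain ⟨ha1, ha2, -⟩ := h𝒜 a ha
          exact mem_Ioc.2 ⟨by omega, ha2⟩
        refine add_le_add le_rfl (mul_le_mul_of_nonneg_left ?_ (by positivity))
        refine le_trans ?_ (sum_gcd_le (2 * A))
        refine (sum_le_sum_of_subset_of_nonneg hsub fun a _ _ => by positivity).trans ?_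
        exact sum_le_sum fun a _ =>
          sum_le_sum_of_subset_of_nonneg hsub fun a' _ _ => by positivity
    _ = _ := by
        have hA0 : (A : ℝ) ≠ 0 := by exact_mod_cast hA.ne'
        push_cast
        field_simp
        ring

end Collisions

section Averaging

/-- The short character sum `∑_{i < H} (N + i | d)`. -/
noncomputable def charSum (d : ℕ) (N : ZMod d) (H : ℕ) : ℝ := ∑ i ∈ range H, jac d (N + i)

lemma abs_charSum_le (d : ℕ) (N : ZMod d) (H : ℕ) : |charSum d N H| ≤ H := by
  refine (abs_sum_le_sum_abs _ _).trans ?_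
  refine (sum_le_card_nsmul _ _ 1 fun _ _ => abs_jac_le_one _ _).trans ?_
  simp

lemma charSum_add (d : ℕ) (N : ZMod d) (m n : ℕ) :
    charSum d N (m + n) = charSum d N m + charSum d (N + m) n := by
  rw [charSum, charSum, charSum, sum_range_add]
  congr 1
  refine sum_congr rfl fun i _ => ?_
  push_cast
  rw [add_assoc]

lemma charSum_shift (d : ℕ) (N : ZMod d) (H k : ℕ) :
    charSum d N H = charSum d (N + k) H + charSum d N k - charSum d (N + H) k := by
  have h1 := charSum_add d N H k
  have h2 := charSum_add d N k H
  rw [add_comm k H] at h2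
  linarith

lemma charSum_average {d : ℕ} [NeZero d] {a : ℕ} (hda : d.Coprime a) {B H : ℕ} {E : ℝ}
    (hE : ∀ (N : ZMod d) (k : ℕ), k ≤ a * B → |charSum d N k| ≤ E) (N : ZMod d) :
    B * (|charSum d N H| - 2 * E) ≤
      ∑ i ∈ range H, |∑ b ∈ range B, jac d ((N + i) * (a : ZMod d)⁻¹ + b)| := by
  have h1 : ∀ b ∈ range B, |charSum d N H - charSum d (N + (a * b : ℕ)) H| ≤ 2 * E := by
    intro b hb
    have hk : a * b ≤ a * B := Nat.mul_le_mul_left _ (mem_range.1 hb).le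
    have e := charSum_shift d N H (a * b)
    have e1 := hE N _ hk
    have e2 := hE (N + H) _ hk
    rw [abs_le] at e1 e2 ⊢
    constructor <;> linarith
  have h2 : ∑ b ∈ range B, charSum d (N + (a * b : ℕ)) H =
      ∑ i ∈ range H, jac d a * ∑ b ∈ range B, jac d ((N + i) * (a : ZMod d)⁻¹ + b) := by
    simp_rw [charSum, mul_sum, ← jac_mul]
    rw [sum_comm]
    refine sum_congr rfl fun i _ => sum_congr rfl fun b _ => ?_
    congr 1
    have u := ZMod.coe_mul_inv_eq_one a hda.symm
    push_cast
    linear_combination (-(N + i)) * u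
  have h3 : |∑ b ∈ range B, charSum d (N + (a * b : ℕ)) H| ≤
      ∑ i ∈ range H, |∑ b ∈ range B, jac d ((N + i) * (a : ZMod d)⁻¹ + b)| := by
    rw [h2]
    refine (abs_sum_le_sum_abs _ _).trans (sum_le_sum fun i _ => ?_)
    rw [abs_mul]
    exact mul_le_of_le_one_left (abs_nonneg _) (abs_jac_le_one _ _)
  have h4 : |∑ b ∈ range B, (charSum d N H - charSum d (N + (a * b : ℕ)) H)| ≤ B * (2 * E) := by
    refine (abs_sum_le_sum_abs _ _).trans ((sum_le_card_nsmul _ _ _ h1).trans ?_)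
    rw [card_range, nsmul_eq_mul]
  rw [sum_sub_distrib, sum_const, card_range, nsmul_eq_mul] at h4
  have h5 : (B : ℝ) * |charSum d N H| = |B * charSum d N H| := by
    rw [abs_mul, Nat.abs_cast]
  have h6 := abs_sub_abs_le_abs_sub (B * charSum d N H)
    (∑ b ∈ range B, charSum d (N + (a * b : ℕ)) H)
  rw [mul_sub, h5]
  linarith

lemma burgess_step {d : ℕ} [NeZero d] (hodd : Odd d) (hsf : Squarefree d) {A B H : ℕ}
    (hB : 1 ≤ B) (hAd : 4 * A * H ≤ d) (hA : 4 * d.divisors.card ^ 2 ≤ A) {E : ℝ}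
    (hE : ∀ (N : ZMod d) (k : ℕ), k ≤ 2 * A * B → |charSum d N k| ≤ E) (N : ZMod d)
    (hT : 2 * E ≤ |charSum d N H|) :
    (|charSum d N H| - 2 * E) ^ 12 * A ^ 2 ≤ 4 * (d.divisors.card : ℝ) ^ 2 * H ^ 10 *
      (A ^ 2 + 4 * H * A * (1 + Real.log (2 * A))) *
      (2176782336 * (d / B ^ 6) + 12 * 177147 * (d.divisors.card : ℝ) ^ 22 * √d) := by
  have hd0 : d ≠ 0 := NeZero.ne d
  have hτN : 1 ≤ d.divisors.card := card_pos.2 ⟨1, Nat.one_mem_divisors.2 hd0⟩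
  have hτ : (1 : ℝ) ≤ d.divisors.card := by exact_mod_cast hτN
  have hA0 : 0 < A := by nlinarith
  have hA1 : (1 : ℝ) ≤ A := by exact_mod_cast hA0
  have hB1 : (1 : ℝ) ≤ B := by exact_mod_cast hB
  set 𝒜 := {a ∈ Ioc A (2 * A) | d.Coprime a} with h𝒜
  have hmem : ∀ a ∈ 𝒜, A < a ∧ a ≤ 2 * A ∧ d.Coprime a := by
    intro a ha
    rw [h𝒜, mem_filter, mem_Ioc] at ha
    exact ⟨ha.1.1, ha.1.2, ha.2⟩
  set n : ℝ := (#𝒜 : ℝ) with hn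
  have hnge : (A : ℝ) / (2 * d.divisors.card) ≤ n := card_coprime_Ioc_ge hsf hA
  have hnle : n ≤ A := by
    rw [hn, Nat.cast_le]
    refine (card_filter_le _ _).trans ?_
    rw [Nat.card_Ioc]; omega
  have hmom := moment_bound (r := 6) (by norm_num) le_rfl hodd hsf hB
  have hcol := sum_collisions_le hAd hA0 N 𝒜 hmem
  have hpow := sum_comp_pow_twelve_le (𝒜 ×ˢ range H)
    (fun x => (N + x.2) * (x.1 : ZMod d)⁻¹)
    (fun y => |∑ b ∈ range B, jac d (y + b)|) fun _ => abs_nonneg _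
  have heven : ∀ y : ZMod d, |∑ b ∈ range B, jac d (y + b)| ^ 12 =
      (∑ b ∈ range B, jac d (y + b)) ^ (2 * 6) := fun y => Even.pow_abs (by decide) _
  simp_rw [heven] at hpow
  have hmain : n * (B * (|charSum d N H| - 2 * E)) ≤
      ∑ x ∈ 𝒜 ×ˢ range H, |∑ b ∈ range B, jac d ((N + x.2) * (x.1 : ZMod d)⁻¹ + b)| := by
    rw [sum_product, hn, ← nsmul_eq_mul]
    refine card_nsmul_le_sum _ _ _ fun a ha => ?_
    obtain ⟨-, ha2, hac⟩ := hmem a ha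
    exact charSum_average hac (fun N k hk => hE N k (hk.trans (Nat.mul_le_mul_right _ ha2))) N
  rw [card_product, card_range] at hpow
  push_cast at hpow hmom
  rw [← hn] at hpow hcol
  have hlog : 0 ≤ Real.log (2 * A) := Real.log_nonneg (by linarith)
  have hnpos : 0 < n := lt_of_lt_of_le (by positivity) hnge
  have hcol0 := sum_nonneg fun x (_ : x ∈ 𝒜 ×ˢ range H) =>
    sum_nonneg fun x' (_ : x' ∈ 𝒜 ×ˢ range H) =>
      (show (0 : ℝ) ≤ if (N + x.2) * (x.1 : ZMod d)⁻¹ = (N + x'.2) * (x'.1 : ZMod d)⁻¹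
        then (1 : ℝ) else 0 by split_ifs <;> norm_num)
  generalize ∑ x ∈ 𝒜 ×ˢ range H, ∑ x' ∈ 𝒜 ×ˢ range H,
      (if (N + x.2) * (x.1 : ZMod d)⁻¹ = (N + x'.2) * (x'.1 : ZMod d)⁻¹ then (1 : ℝ) else 0)
      = col at *
  generalize ∑ x ∈ 𝒜 ×ˢ range H, |∑ b ∈ range B, jac d ((N + x.2) * (x.1 : ZMod d)⁻¹ + b)|
      = S at *
  have hmom0 : 0 ≤ ∑ y : ZMod d, (∑ b ∈ range B, jac d (y + b)) ^ (2 * 6) :=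
    sum_nonneg fun y _ => Even.pow_nonneg (by decide) _
  generalize ∑ y : ZMod d, (∑ b ∈ range B, jac d (y + b)) ^ (2 * 6) = mom at *
  clear_value n 𝒜
  generalize (d.divisors.card : ℝ) = τ at *
  have hD : 0 ≤ |charSum d N H| - 2 * E := by linarith
  generalize |charSum d N H| - 2 * E = D at *
  set R : ℝ := 2176782336 * (d / B ^ 6) + 12 * 177147 * τ ^ 22 * √d with hR
  have hR0 : 0 ≤ R := by positivity
  have hmomR : mom ≤ B ^ 12 * R := by
    refine hmom.trans (le_of_eq ?_)
    rw [hR]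
    field_simp
    ring
  set L : ℝ := A ^ 2 + 4 * H * A * (1 + Real.log (2 * A)) with hL
  have hL0 : 0 ≤ L := by positivity
  have hcolL : col ≤ L := by
    refine hcol.trans ?_
    rw [hL]
    gcongr
  have h1 : (n * (B * D)) ^ 12 ≤ (n * H) ^ 10 * L * (B ^ 12 * R) := by
    refine (pow_le_pow_left₀ (by positivity) hmain 12).trans (hpow.trans ?_)
    gcongr
  have h2 : n ^ 2 * D ^ 12 ≤ H ^ 10 * L * R := by
    have hpos : 0 < n ^ 10 * (B : ℝ) ^ 12 := by positivity
    refine le_of_mul_le_mul_left ?_ hpos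
    calc _ = (n * (B * D)) ^ 12 := by ring
      _ ≤ _ := h1
      _ = _ := by ring
  have h3 : (A : ℝ) ≤ 2 * τ * n := by
    rw [div_le_iff₀ (by positivity)] at hnge
    linarith
  calc D ^ 12 * A ^ 2 ≤ D ^ 12 * (2 * τ * n) ^ 2 := by gcongr
    _ = 4 * τ ^ 2 * (n ^ 2 * D ^ 12) := by ring
    _ ≤ 4 * τ ^ 2 * (H ^ 10 * L * R) := by gcongr
    _ = _ := by ring

end Averaging

section Burgess

lemma burgess_numeric {D A B H τ l ℓ s : ℝ} (hA : 0 < A) (hs : 0 < s)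
    (hτ : 1 ≤ τ) (hAH : A ≤ H) (hl : 1 + l ≤ ℓ) (hℓ : 1 ≤ ℓ) (hsB : s ≤ B)
    (hB : B ≤ 2 * s) (hH : H ≤ 32 * B * A)
    (h : D ^ 12 * A ^ 2 ≤ 4 * τ ^ 2 * H ^ 10 * (A ^ 2 + 4 * H * A * (1 + l)) *
      (2176782336 * (s ^ 12 / B ^ 6) + 12 * 177147 * τ ^ 22 * s ^ 6)) :
    D ^ 12 ≤ 1280 * (2176782336 + 12 * 177147) * τ ^ 24 * ℓ * H ^ 10 * s ^ 7 := by
  have hB0 : 0 < B := hs.trans_le hsB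
  have hH0 : 0 < H := hA.trans_le hAH
  have h1 : s ^ 12 / B ^ 6 ≤ s ^ 6 := by
    rw [div_le_iff₀ (by positivity)]
    calc s ^ 12 = s ^ 6 * s ^ 6 := by ring
      _ ≤ s ^ 6 * B ^ 6 := by gcongr
  have h2 : 2176782336 * (s ^ 12 / B ^ 6) + 12 * 177147 * τ ^ 22 * s ^ 6 ≤
      (2176782336 + 12 * 177147) * τ ^ 22 * s ^ 6 := by
    have h3 : 1 ≤ τ ^ 22 := one_le_pow₀ hτ
    have h4 : s ^ 6 ≤ τ ^ 22 * s ^ 6 := le_mul_of_one_le_left (by positivity) h3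
    linarith
  have h5 : A ^ 2 + 4 * H * A * (1 + l) ≤ 5 * H * A * ℓ := by
    have h6 : A ^ 2 ≤ H * A * ℓ := by
      calc A ^ 2 = A * A * 1 := by ring
        _ ≤ H * A * ℓ := by gcongr
    have h7 : 4 * H * A * (1 + l) ≤ 4 * H * A * ℓ := by gcongr
    linarith
  have h8 : H ≤ 64 * s * A := by nlinarith
  refine le_of_mul_le_mul_right ?_ (by positivity : 0 < A ^ 2)
  calc D ^ 12 * A ^ 2 ≤ _ := h
    _ ≤ 4 * τ ^ 2 * H ^ 10 * (5 * H * A * ℓ) *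
        ((2176782336 + 12 * 177147) * τ ^ 22 * s ^ 6) := by gcongr
    _ = 20 * (2176782336 + 12 * 177147) * τ ^ 24 * ℓ * H ^ 10 * A * s ^ 6 * H := by ring
    _ ≤ 20 * (2176782336 + 12 * 177147) * τ ^ 24 * ℓ * H ^ 10 * A * s ^ 6 * (64 * s * A) := by
        gcongr
    _ = _ := by ring

set_option maxHeartbeats 800000 in
/-- Burgess's bound for short sums of Jacobi symbols. -/
theorem burgess {ε : ℝ} (hε : 0 < ε) :
    ∃ K : ℝ, 1 ≤ K ∧ ∀ d : ℕ, Odd d → Squarefree d → ∀ H : ℕ, H ^ 2 ≤ d → ∀ N : ZMod d,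
      |charSum d N H| ≤ K * ((H : ℝ) ^ (5 / 6 : ℝ) * (d : ℝ) ^ (7 / 144 + ε)) := by
  obtain ⟨K₁, hK₁, hτ₁⟩ := exists_card_divisors_le (by positivity : 0 < ε / 4)
  obtain ⟨K₂, hK₂, hτ₂⟩ := exists_card_divisors_le (by norm_num : (0 : ℝ) < 1 / 24)
  set c : ℝ := 1280 * (2176782336 + 12 * 177147) * K₁ ^ 24 * (1 + 1 / (6 * ε)) with hc
  have hc1 : 1 ≤ c := by
    have e1 : 1 ≤ K₁ ^ 24 := one_le_pow₀ hK₁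
    have e2 : 0 < 1 / (6 * ε) := by positivity
    rw [hc]
    nlinarith
  set D₀ : ℝ := (160 * K₂ ^ 2) ^ 8 with hD₀
  have hD₀1 : 0 ≤ D₀ := by positivity
  refine ⟨2 * c + D₀, by linarith, fun d hodd hsf H => ?_⟩
  have hd0 : d ≠ 0 := hsf.ne_zero
  have : NeZero d := ⟨hd0⟩
  have hd1 : (1 : ℝ) ≤ d := by exact_mod_cast Nat.one_le_iff_ne_zero.2 hd0
  have hd0' : (0 : ℝ) < d := by linarith
  induction H using Nat.strong_induction_on with
  | _ H ih =>
  intro hHd N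
  set Q : ℝ := (H : ℝ) ^ (5 / 6 : ℝ) * (d : ℝ) ^ (7 / 144 + ε) with hQ
  have hQ0 : 0 ≤ Q := by positivity
  have htriv := abs_charSum_le d N H
  rcases Nat.eq_zero_or_pos H with rfl | hH0
  · simpa [charSum] using mul_nonneg (by linarith : 0 ≤ 2 * c + D₀) hQ0
  have hH1 : (1 : ℝ) ≤ H := by exact_mod_cast hH0
  have hH0' : (0 : ℝ) < H := by linarith
  have hQ1 : 1 ≤ Q := by
    rw [hQ]
    exact one_le_mul_of_one_le_of_one_le (Real.one_le_rpow hH1 (by norm_num))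
      (Real.one_le_rpow hd1 (by positivity))
  have hHd' : H ≤ d := (Nat.le_self_pow two_ne_zero H).trans hHd
  by_cases hdD : (d : ℝ) < D₀
  · have : (H : ℝ) ≤ d := by exact_mod_cast hHd'
    nlinarith
  rw [not_lt] at hdD
  by_cases hHsmall : (H : ℝ) ≤ (d : ℝ) ^ (7 / 24 : ℝ)
  · have h1 : (H : ℝ) ≤ Q := by
      calc (H : ℝ) = (H : ℝ) ^ (5 / 6 : ℝ) * (H : ℝ) ^ (1 / 6 : ℝ) := by
            rw [← Real.rpow_add hH0']; norm_num
        _ ≤ (H : ℝ) ^ (5 / 6 : ℝ) * ((d : ℝ) ^ (7 / 24 : ℝ)) ^ (1 / 6 : ℝ) := by gcongr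
        _ = (H : ℝ) ^ (5 / 6 : ℝ) * (d : ℝ) ^ (7 / 144 : ℝ) := by
            rw [← Real.rpow_mul hd0'.le]; norm_num
        _ ≤ Q := by
            rw [hQ]
            gcongr
            linarith
    nlinarith
  rw [not_le] at hHsmall
  set s : ℝ := (d : ℝ) ^ (1 / 12 : ℝ) with hs
  have hs0 : 0 < s := by positivity
  have hs1 : 1 ≤ s := Real.one_le_rpow hd1 (by norm_num)
  set B := ⌈s⌉₊ with hBdef
  have hsB : s ≤ B := Nat.le_ceil s
  have hB2 : (B : ℝ) ≤ 2 * s := by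
    have := Nat.ceil_lt_add_one hs0.le
    linarith
  have hB1 : 1 ≤ B := Nat.one_le_iff_ne_zero.2 (by
    intro h; rw [h] at hsB; simp at hsB; linarith)
  have hB0 : (0 : ℝ) < B := by linarith
  set A := H / (16 * B) with hAdef
  have hABH : A * (16 * B) ≤ H := Nat.div_mul_le_self _ _
  have hτge : (1 : ℝ) ≤ d.divisors.card := by
    exact_mod_cast card_pos.2 ⟨1, Nat.one_mem_divisors.2 hd0⟩
  have hbig : 5 * (d.divisors.card : ℝ) ^ 2 ≤ H / (16 * B) := by
    rw [le_div_iff₀ (by positivity)]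
    have e1 : 160 * K₂ ^ 2 ≤ (d : ℝ) ^ (1 / 8 : ℝ) := by
      calc 160 * K₂ ^ 2 = D₀ ^ (1 / 8 : ℝ) := by
            rw [hD₀, ← Real.rpow_natCast (160 * K₂ ^ 2), ← Real.rpow_mul (by positivity)]; norm_num
        _ ≤ _ := by gcongr
    have e2 : (d.divisors.card : ℝ) ^ 2 ≤ K₂ ^ 2 * (d : ℝ) ^ (1 / 12 : ℝ) := by
      calc (d.divisors.card : ℝ) ^ 2 ≤ (K₂ * (d : ℝ) ^ (1 / 24 : ℝ)) ^ 2 :=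
            pow_le_pow_left₀ (by linarith) (hτ₂ d hsf) 2
        _ = K₂ ^ 2 * (d : ℝ) ^ (1 / 12 : ℝ) := by
            rw [mul_pow, ← Real.rpow_natCast _ 2, ← Real.rpow_natCast _ 2,
              ← Real.rpow_mul hd0'.le]
            norm_num
    calc 5 * (d.divisors.card : ℝ) ^ 2 * (16 * B) ≤ 5 * (K₂ ^ 2 * s) * (16 * (2 * s)) := by
          gcongr
      _ = 160 * K₂ ^ 2 * (s * s) := by ring
      _ ≤ (d : ℝ) ^ (1 / 8 : ℝ) * (s * s) := by gcongr
      _ = (d : ℝ) ^ (7 / 24 : ℝ) := by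
          rw [hs, ← Real.rpow_add hd0', ← Real.rpow_add hd0']; norm_num
      _ ≤ H := hHsmall.le
  have hAfloor : (H : ℝ) / (16 * B) < A + 1 := by
    rw [div_lt_iff₀ (by positivity)]
    have := Nat.lt_div_mul_add (a := H) (b := 16 * B) (by omega)
    have e : (H : ℝ) < (H / (16 * B) * (16 * B) + 16 * B : ℕ) := by exact_mod_cast this
    push_cast [← hAdef] at e
    linarith
  have hA4 : 4 * (d.divisors.card : ℝ) ^ 2 ≤ A := by nlinarith
  have hA4' : 4 * d.divisors.card ^ 2 ≤ A := by exact_mod_cast hA4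
  have hA1 : (1 : ℝ) ≤ A := by nlinarith
  have hAH : A ≤ H := Nat.div_le_self _ _
  have hH32 : (H : ℝ) ≤ 32 * B * A := by
    have : (H : ℝ) / (16 * B) ≤ 2 * A := by linarith
    rw [div_le_iff₀ (by positivity)] at this
    linarith
  have h4AH : 4 * A * H ≤ d :=
    calc 4 * A * H ≤ A * (16 * B) * H := by
          refine Nat.mul_le_mul_right _ ?_
          rw [mul_comm]
          exact Nat.mul_le_mul_left _ (by omega)
      _ ≤ H * H := Nat.mul_le_mul_right _ hABH
      _ ≤ d := by rwa [← sq]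
  set E : ℝ := (2 * c + D₀) * (((H : ℝ) / 8) ^ (5 / 6 : ℝ) * (d : ℝ) ^ (7 / 144 + ε)) with hE
  have hE4 : 2 * E ≤ (2 * c + D₀) / 2 * Q := by
    have e8 : (4 : ℝ) ≤ 8 ^ (5 / 6 : ℝ) := by
      calc (4 : ℝ) = 8 ^ (2 / 3 : ℝ) := by
            rw [show (8 : ℝ) = 2 ^ (3 : ℝ) by norm_num, ← Real.rpow_mul (by norm_num)]; norm_num
        _ ≤ _ := Real.rpow_le_rpow_of_exponent_le (by norm_num) (by norm_num)
    have e9 : ((H : ℝ) / 8) ^ (5 / 6 : ℝ) ≤ (H : ℝ) ^ (5 / 6 : ℝ) / 4 := by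
      rw [Real.div_rpow hH0'.le (by norm_num)]
      gcongr
    calc 2 * E ≤ 2 * ((2 * c + D₀) * ((H : ℝ) ^ (5 / 6 : ℝ) / 4 * (d : ℝ) ^ (7 / 144 + ε))) := by
          rw [hE]; gcongr
      _ = _ := by rw [hQ]; ring
  have hIH : ∀ (N : ZMod d) (k : ℕ), k ≤ 2 * A * B → |charSum d N k| ≤ E := by
    intro N' k hk
    have h8k : 8 * k ≤ H :=
      calc 8 * k ≤ 8 * (2 * A * B) := Nat.mul_le_mul_left _ hk
        _ = A * (16 * B) := by ring
        _ ≤ H := hABH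
    have hkH : k ≤ H := (Nat.le_mul_of_pos_left k (by norm_num)).trans h8k
    have hk8 : (k : ℝ) ≤ H / 8 := by
      have : (8 * k : ℝ) ≤ H := by exact_mod_cast h8k
      linarith
    refine (ih k (by omega) ((Nat.pow_le_pow_left hkH 2).trans hHd) N').trans ?_
    rw [hE]
    gcongr
  by_cases hT : 2 * E ≤ |charSum d N H|
  · have hstep := burgess_step hodd hsf hB1 h4AH hA4' hIH N hT
    have hs12 : s ^ 12 = d := by
      rw [hs, ← Real.rpow_natCast, ← Real.rpow_mul hd0'.le]; norm_num
    have hs6 : √(d : ℝ) = s ^ 6 := by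
      rw [hs, ← Real.rpow_natCast, ← Real.rpow_mul hd0'.le, Real.sqrt_eq_rpow]; norm_num
    rw [hs6, show (d : ℝ) / (B : ℝ) ^ 6 = s ^ 12 / (B : ℝ) ^ 6 by rw [hs12]] at hstep
    have hlogd : Real.log (2 * A) ≤ Real.log d := by
      refine Real.log_le_log (by linarith) ?_
      have : 2 * A ≤ d :=
        calc 2 * A ≤ 4 * A * 1 := by omega
          _ ≤ 4 * A * H := Nat.mul_le_mul_left _ hH0
          _ ≤ d := h4AH
      exact_mod_cast this
    have hlog0 : 0 ≤ Real.log d := Real.log_nonneg hd1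
    have hnum := burgess_numeric (ℓ := 1 + Real.log d) (by linarith) hs0 hτge
      (by exact_mod_cast hAH) (by linarith) (by linarith) hsB hB2 hH32 hstep
    have hlogle : 1 + Real.log d ≤ (1 + 1 / (6 * ε)) * (d : ℝ) ^ (6 * ε) := by
      have e1 := Real.log_le_rpow_div hd0'.le (by positivity : 0 < 6 * ε)
      have e2 := Real.one_le_rpow hd1 (by positivity : 0 ≤ 6 * ε)
      calc 1 + Real.log d ≤ (d : ℝ) ^ (6 * ε) + (d : ℝ) ^ (6 * ε) / (6 * ε) := by linarith
        _ = _ := by ring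
    have hτ24 : (d.divisors.card : ℝ) ^ 24 ≤ K₁ ^ 24 * (d : ℝ) ^ (6 * ε) := by
      calc (d.divisors.card : ℝ) ^ 24 ≤ (K₁ * (d : ℝ) ^ (ε / 4)) ^ 24 :=
            pow_le_pow_left₀ (by linarith) (hτ₁ d hsf) 24
        _ = _ := by
            rw [mul_pow, ← Real.rpow_natCast ((d : ℝ) ^ (ε / 4)), ← Real.rpow_mul hd0'.le]
            congr 2
            push_cast; ring
    have hQ12 : Q ^ 12 = H ^ 10 * ((d : ℝ) ^ (6 * ε) * (d : ℝ) ^ (6 * ε) * s ^ 7) := by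
      rw [hQ, mul_pow, ← Real.rpow_natCast ((H : ℝ) ^ (5 / 6 : ℝ)), ← Real.rpow_mul hH0'.le,
        ← Real.rpow_natCast ((d : ℝ) ^ (7 / 144 + ε)), ← Real.rpow_mul hd0'.le, hs,
        ← Real.rpow_natCast ((d : ℝ) ^ (1 / 12 : ℝ)), ← Real.rpow_mul hd0'.le,
        ← Real.rpow_add hd0', ← Real.rpow_add hd0', ← Real.rpow_natCast (H : ℝ)]
      congr 2
      · norm_num
      · push_cast; ring
    have hcQ : (|charSum d N H| - 2 * E) ^ 12 ≤ (c * Q) ^ 12 := by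
      calc _ ≤ _ := hnum
        _ ≤ 1280 * (2176782336 + 12 * 177147) * (K₁ ^ 24 * (d : ℝ) ^ (6 * ε)) *
            ((1 + 1 / (6 * ε)) * (d : ℝ) ^ (6 * ε)) * H ^ 10 * s ^ 7 := by gcongr
        _ = c * Q ^ 12 := by rw [hQ12, hc]; ring
        _ ≤ c ^ 12 * Q ^ 12 := by
            gcongr
            exact le_self_pow₀ hc1 (by norm_num)
        _ = _ := by ring
    have hfin := le_of_pow_le_pow_left₀ (by norm_num) (by positivity) hcQ
    have : 0 ≤ D₀ * Q := by positivity
    linarith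
  · rw [not_le] at hT
    have : 0 ≤ (2 * c + D₀) * Q := by positivity
    linarith

end Burgess

section Residues

lemma isSquare_intCast_of_prime_dvd {m : ℕ} (hm : Squarefree m) {n : ℤ}
    (h : ∀ p : ℕ, p.Prime → p ∣ m → IsSquare (n : ZMod p)) : IsSquare (n : ZMod m) := by
  induction m using induction_on_primes with
  | zero => exact absurd rfl hm.ne_zero
  | one => exact ⟨0, Subsingleton.elim _ _⟩
  | prime_mul p a hp ih =>
    have hpa : p.Coprime a := Nat.coprime_of_squarefree_mul hm
    obtain ⟨b, hb⟩ := h p hp (dvd_mul_right p a)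
    obtain ⟨c, hc⟩ := ih (hm.of_mul_right) fun q hq hqa => h q hq (dvd_mul_of_dvd_right hqa p)
    have e := ZMod.chineseRemainder hpa
    have h1 : IsSquare (e n) := by
      rw [map_intCast]
      exact ⟨(b, c), Prod.ext (by simpa using hb) (by simpa using hc)⟩
    simpa using h1.map e.symm

/-- The Jacobi symbols `(n | d)`, extended by zero to even `d`, as an arithmetic function. -/
def oddJacobi (n : ℤ) : ArithmeticFunction ℤ where
  toFun d := if Odd d then jacobiSym n d else 0
  map_zero' := by simp

lemma oddJacobi_apply (n : ℤ) (d : ℕ) : oddJacobi n d = if Odd d then jacobiSym n d else 0 := rfl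

lemma isMultiplicative_oddJacobi (n : ℤ) : (oddJacobi n).IsMultiplicative := by
  rw [ArithmeticFunction.IsMultiplicative.iff_ne_zero]
  refine ⟨by simp [oddJacobi_apply], fun {a b} ha hb _ => ?_⟩
  have : NeZero a := ⟨ha⟩
  have : NeZero b := ⟨hb⟩
  rw [oddJacobi_apply, oddJacobi_apply, oddJacobi_apply, jacobiSym.mul_right]
  by_cases h1 : Odd a <;> by_cases h2 : Odd b <;> simp [Nat.odd_mul, h1, h2]

lemma sum_jacobiSym_eq_zero {M : ℕ} (hM : Squarefree M) {n : ℤ} (hn : ¬ IsSquare (n : ZMod M)) :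
    ∑ d ∈ M.divisors with Odd d, jacobiSym n d = 0 := by
  obtain ⟨p, hp, hpM, hnp⟩ : ∃ p : ℕ, p.Prime ∧ p ∣ M ∧ ¬ IsSquare (n : ZMod p) := by
    by_contra! h
    exact hn (isSquare_intCast_of_prime_dvd hM h)
  have : Fact p.Prime := ⟨hp⟩
  have hp2 : p ≠ 2 := by
    rintro rfl
    exact hnp (by generalize (n : ZMod 2) = z; revert z; decide)
  rw [sum_filter]
  change ∑ d ∈ M.divisors, oddJacobi n d = 0
  rw [← (isMultiplicative_oddJacobi n).prodPrimeFactors_one_add_of_squarefree hM]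
  refine prod_eq_zero (Nat.mem_primeFactors.2 ⟨hp, hpM, hM.ne_zero⟩) ?_
  rw [oddJacobi_apply, if_pos (hp.odd_of_ne_two hp2), ← jacobiSym.legendreSym.to_jacobiSym,
    (legendreSym.eq_neg_one_iff p).2 hnp]
  norm_num

lemma mem_QR_of_isSquare {M : ℕ} [NeZero M] {z : ZMod M} (hz : IsSquare z) : z ∈ QR M := by
  obtain ⟨a, rfl⟩ := hz
  exact mem_image.2 ⟨a.val, mem_range.2 a.val_lt, by rw [ZMod.natCast_zmod_val, sq]⟩

lemma sum_charSum_eq_zero {M : ℕ} [NeZero M] (hM : Squarefree M) {h : ℕ} {x : ZMod M}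
    (hx : x ∈ Nset M (range h)) :
    ∑ d ∈ M.divisors with Odd d, charSum d (x.val : ZMod d) h = 0 := by
  simp_rw [charSum]
  rw [sum_comm]
  refine sum_eq_zero fun i hi => ?_
  have h1 : ¬ IsSquare (((x.val + i : ℕ) : ℤ) : ZMod M) := by
    intro hsq
    refine (mem_filter.1 hx).2 i hi (mem_QR_of_isSquare ?_)
    simpa using hsq
  have h2 : ∑ d ∈ M.divisors with Odd d, (jacobiSym (x.val + i : ℕ) d : ℝ) = 0 := by
    exact_mod_cast sum_jacobiSym_eq_zero hM h1
  rw [← h2]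
  refine sum_congr rfl fun d hd => ?_
  have : NeZero d := ⟨(Nat.pos_of_mem_divisors (mem_filter.1 hd).1).ne'⟩
  rw [← jac_intCast]
  push_cast
  rfl

end Residues

section Period

lemma sum_jac_eq_zero {d : ℕ} [NeZero d] (hodd : Odd d) (hsf : Squarefree d) (hd : 1 < d) :
    ∑ z : ZMod d, jac d z = 0 := by
  obtain ⟨p, hp, a, rfl⟩ := Nat.exists_prime_and_dvd hd.ne'
  have : Fact p.Prime := ⟨hp⟩
  have ha : NeZero a := ⟨right_ne_zero_of_mul hsf.ne_zero⟩
  have hp2 : p ≠ 2 := by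
    rintro rfl
    exact (Nat.not_odd_iff_even.2 (even_two_mul a)) hodd
  simp_rw [jac_mul_right]
  rw [sum_mul_castHom (Nat.coprime_of_squarefree_mul hsf)]
  simp_rw [jac_prime]
  rw [← Int.cast_sum, quadraticChar_sum_zero (by rwa [ZMod.ringChar_zmod_n])]
  simp

lemma charSum_period {d : ℕ} [NeZero d] (hodd : Odd d) (hsf : Squarefree d) (hd : 1 < d)
    (N : ZMod d) : charSum d N d = 0 := by
  rw [charSum, ← sum_jac_eq_zero hodd hsf hd, ← Equiv.sum_comp (Equiv.addLeft N)]
  refine sum_bij' (fun i _ => (i : ZMod d)) (fun z _ => z.val) (fun _ _ => mem_univ _)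
    (fun z _ => mem_range.2 z.val_lt) (fun i hi => ZMod.val_natCast_of_lt (mem_range.1 hi))
    (fun z _ => ZMod.natCast_zmod_val z) fun i _ => rfl

lemma charSum_mul_period {d : ℕ} [NeZero d] (hodd : Odd d) (hsf : Squarefree d) (hd : 1 < d)
    (N : ZMod d) (k : ℕ) : charSum d N (k * d) = 0 := by
  induction k with
  | zero => simp [charSum]
  | succ k ih => rw [Nat.succ_mul, charSum_add, ih, charSum_period hodd hsf hd, add_zero]

lemma abs_charSum_le_modulus {d : ℕ} [NeZero d] (hodd : Odd d) (hsf : Squarefree d) (hd : 1 < d)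
    (N : ZMod d) (H : ℕ) : |charSum d N H| ≤ d := by
  rw [← Nat.div_add_mod' H d, charSum_add, charSum_mul_period hodd hsf hd, zero_add]
  refine (abs_charSum_le _ _ _).trans ?_
  exact_mod_cast (Nat.mod_lt _ (by omega)).le

lemma abs_charSum_le_blocks {d L : ℕ} {E : ℝ}
    (hE : ∀ (N : ZMod d) (k : ℕ), k ≤ L → |charSum d N k| ≤ E) (k : ℕ) {r : ℕ} (hr : r ≤ L)
    (N : ZMod d) : |charSum d N (k * L + r)| ≤ (k + 1) * E := by
  induction k generalizing N with
  | zero => simpa using hE N r hr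
  | succ k ih =>
    rw [show (k + 1) * L + r = L + (k * L + r) by ring, charSum_add]
    have h1 := hE N L le_rfl
    have h2 := ih (N + L)
    refine (abs_add_le _ _).trans ?_
    push_cast
    linarith

/-- Short character sums of length `h` to moduli up to `h ^ 2.95` save a power of `h`. -/
theorem exists_abs_charSum_le :
    ∃ C : ℝ, 1 ≤ C ∧ ∀ d : ℕ, Odd d → Squarefree d → 1 < d → ∀ h : ℕ, 1 ≤ h →
      (d : ℝ) ≤ (h : ℝ) ^ (2.95 : ℝ) → ∀ N : ZMod d, |charSum d N h| ≤ C * (h : ℝ) ^ (0.98 : ℝ) := by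
  obtain ⟨K, hK, hB⟩ := burgess (by norm_num : (0 : ℝ) < 1 / 1000)
  refine ⟨4 * K, by linarith, fun d hodd hsf hd h hh hdh N => ?_⟩
  have : NeZero d := ⟨by omega⟩
  have hh1 : (1 : ℝ) ≤ h := by exact_mod_cast hh
  have hh0 : (0 : ℝ) < h := by linarith
  have hd1 : (1 : ℝ) ≤ d := by exact_mod_cast hd.le
  have hd0 : (0 : ℝ) < d := by linarith
  have hp0 : 0 ≤ (h : ℝ) ^ (0.98 : ℝ) := by positivity
  by_cases h1 : (d : ℝ) ≤ (h : ℝ) ^ (0.98 : ℝ)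
  · calc _ ≤ (d : ℝ) := abs_charSum_le_modulus hodd hsf hd N h
      _ ≤ 1 * (h : ℝ) ^ (0.98 : ℝ) := by linarith
      _ ≤ _ := by gcongr; linarith
  rw [not_le] at h1
  by_cases h2 : h ^ 2 ≤ d
  · calc _ ≤ K * ((h : ℝ) ^ (5 / 6 : ℝ) * (d : ℝ) ^ (7 / 144 + 1 / 1000 : ℝ)) :=
          hB d hodd hsf h h2 N
      _ ≤ K * ((h : ℝ) ^ (5 / 6 : ℝ) * ((h : ℝ) ^ (2.95 : ℝ)) ^ (7 / 144 + 1 / 1000 : ℝ)) := by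
          gcongr
      _ = K * (h : ℝ) ^ (5 / 6 + 2.95 * (7 / 144 + 1 / 1000) : ℝ) := by
          rw [← Real.rpow_mul hh0.le, ← Real.rpow_add hh0]
      _ ≤ (4 * K) * (h : ℝ) ^ (0.98 : ℝ) := by
          gcongr
          · linarith
          · norm_num
  rw [not_le] at h2
  set L := Nat.sqrt d with hL
  have hL1 : 1 ≤ L := Nat.sqrt_pos.2 (by omega)
  have hLd : L ^ 2 ≤ d := Nat.sqrt_le' d
  have hLh : L ≤ h := (Nat.pow_lt_pow_iff_left two_ne_zero).1 (hLd.trans_lt h2) |>.le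
  have hdL : d ≤ 4 * L ^ 2 :=
    calc d ≤ (L + 1) ^ 2 := (Nat.lt_succ_sqrt' d).le
      _ ≤ (2 * L) ^ 2 := Nat.pow_le_pow_left (by omega) 2
      _ = 4 * L ^ 2 := by ring
  have hL1' : (1 : ℝ) ≤ L := by exact_mod_cast hL1
  have hL0 : (0 : ℝ) < L := by linarith
  have hdL' : (d : ℝ) ≤ 4 * (L : ℝ) ^ 2 := by exact_mod_cast hdL
  have hE : ∀ (N : ZMod d) (k : ℕ), k ≤ L → |charSum d N k| ≤
      K * ((L : ℝ) ^ (5 / 6 : ℝ) * (d : ℝ) ^ (7 / 144 + 1 / 1000 : ℝ)) := by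
    intro N k hk
    refine (hB d hodd hsf k ((Nat.pow_le_pow_left hk 2).trans hLd) N).trans ?_
    gcongr
  have hblock := abs_charSum_le_blocks hE (h / L) (Nat.mod_lt h (by omega)).le N
  rw [Nat.div_add_mod'] at hblock
  have hk : ((h / L : ℕ) + 1 : ℝ) ≤ 2 * h * (L : ℝ) ^ (-1 : ℝ) := by
    have e1 : (((h / L : ℕ) : ℝ)) ≤ h / L := Nat.cast_div_le
    have e2 : (1 : ℝ) ≤ h / L := by
      rw [le_div_iff₀ hL0, one_mul]
      exact_mod_cast hLh
    rw [Real.rpow_neg_one]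
    calc _ ≤ (h : ℝ) / L + h / L := add_le_add e1 e2
      _ = _ := by ring
  have hLpow : (L : ℝ) ^ (-1 / 6 : ℝ) ≤ 2 * (d : ℝ) ^ (-1 / 12 : ℝ) := by
    calc (L : ℝ) ^ (-1 / 6 : ℝ) = ((L : ℝ) ^ 2) ^ (-1 / 12 : ℝ) := by
          rw [← Real.rpow_natCast, ← Real.rpow_mul hL0.le]; norm_num
      _ ≤ ((d : ℝ) / 4) ^ (-1 / 12 : ℝ) :=
          Real.rpow_le_rpow_of_nonpos (by positivity) (by linarith) (by norm_num)
      _ = (4 : ℝ) ^ (1 / 12 : ℝ) * (d : ℝ) ^ (-1 / 12 : ℝ) := by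
          rw [Real.div_rpow hd0.le (by norm_num), div_eq_mul_inv,
            ← Real.rpow_neg (by norm_num), mul_comm]
          norm_num
      _ ≤ (4 : ℝ) ^ (1 / 2 : ℝ) * (d : ℝ) ^ (-1 / 12 : ℝ) := by
          gcongr <;> norm_num
      _ = _ := by
          rw [← Real.sqrt_eq_rpow, show (4 : ℝ) = 2 ^ 2 by norm_num, Real.sqrt_sq (by norm_num)]
  calc _ ≤ _ := hblock
    _ ≤ (2 * h * (L : ℝ) ^ (-1 : ℝ)) *
        (K * ((L : ℝ) ^ (5 / 6 : ℝ) * (d : ℝ) ^ (7 / 144 + 1 / 1000 : ℝ))) := by gcongr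
    _ = 2 * K * h * ((L : ℝ) ^ (-1 / 6 : ℝ) * (d : ℝ) ^ (7 / 144 + 1 / 1000 : ℝ)) := by
        rw [show (-1 / 6 : ℝ) = -1 + 5 / 6 by norm_num, Real.rpow_add hL0]; ring
    _ ≤ 2 * K * h * (2 * (d : ℝ) ^ (-1 / 12 : ℝ) * (d : ℝ) ^ (7 / 144 + 1 / 1000 : ℝ)) := by
        gcongr
    _ = 4 * K * h * (d : ℝ) ^ (-1 / 12 + (7 / 144 + 1 / 1000) : ℝ) := by
        rw [Real.rpow_add hd0 (-1 / 12)]; ring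
    _ ≤ 4 * K * h * ((h : ℝ) ^ (0.98 : ℝ)) ^ (-1 / 12 + (7 / 144 + 1 / 1000) : ℝ) := by
        gcongr 4 * K * h * ?_
        exact Real.rpow_le_rpow_of_nonpos (by positivity) h1.le (by norm_num)
    _ = 4 * K * (h : ℝ) ^ (1 + 0.98 * (-1 / 12 + (7 / 144 + 1 / 1000)) : ℝ) := by
        rw [← Real.rpow_mul hh0.le, Real.rpow_add hh0, Real.rpow_one]; ring
    _ ≤ 4 * K * (h : ℝ) ^ (0.98 : ℝ) := by
        gcongr
        · norm_num

end Period

section LongRuns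

lemma sum_comp_val {M d : ℕ} [NeZero M] [NeZero d] (hM : Squarefree M) (hd : d ∣ M)
    (G : ZMod d → ℝ) : ∑ x : ZMod M, G (x.val : ZMod d) = (M / d : ℝ) * ∑ y, G y := by
  obtain ⟨e, rfl⟩ := hd
  have : NeZero e := ⟨right_ne_zero_of_mul hM.ne_zero⟩
  have h := sum_mul_castHom (Nat.coprime_of_squarefree_mul hM) G fun _ => 1
  simp only [mul_one, ZMod.castHom_apply, ← ZMod.natCast_val] at h
  rw [h]
  have hd0 : (d : ℝ) ≠ 0 := Nat.cast_ne_zero.2 (NeZero.ne d)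
  simp [hd0, mul_comm]

lemma exists_fourth_moment_le :
    ∃ K : ℝ, 0 < K ∧ ∀ M : ℕ, Squarefree M → ∀ d ∈ M.divisors, Odd d → ∀ h : ℕ, 1 ≤ h →
      (h : ℝ) ^ (2.95 : ℝ) < d →
      ∑ x ∈ univM M, charSum d (x.val : ZMod d) h ^ 4 ≤
        K * M * ((h : ℝ) ^ 4 * (h : ℝ) ^ (-(1.47 : ℝ))) := by
  obtain ⟨K, hK, hτ⟩ := exists_card_divisors_le (by norm_num : (0 : ℝ) < 1 / 22000)
  refine ⟨16 + 12 * 177147 * K ^ 22, by positivity, fun M hM d hdM hodd h hh hhd => ?_⟩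
  have : NeZero M := ⟨hM.ne_zero⟩
  have hdvd : d ∣ M := Nat.dvd_of_mem_divisors hdM
  have hd0 : d ≠ 0 := (Nat.pos_of_mem_divisors hdM).ne'
  have : NeZero d := ⟨hd0⟩
  have hsf : Squarefree d := hM.squarefree_of_dvd hdvd
  have hh1 : (1 : ℝ) ≤ h := by exact_mod_cast hh
  have hh0 : (0 : ℝ) < h := by linarith
  have hd0' : (0 : ℝ) < d := by exact_mod_cast Nat.pos_of_ne_zero hd0
  have hmom := moment_bound (by norm_num : 1 ≤ 2) (by norm_num) hodd hsf hh
  have h22 : (d.divisors.card : ℝ) ^ 22 ≤ K ^ 22 * (d : ℝ) ^ (1 / 1000 : ℝ) := by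
    calc (d.divisors.card : ℝ) ^ 22 ≤ (K * (d : ℝ) ^ (1 / 22000 : ℝ)) ^ 22 :=
          pow_le_pow_left₀ (Nat.cast_nonneg _) (hτ d hsf) 22
      _ = _ := by
          rw [mul_pow, ← Real.rpow_natCast ((d : ℝ) ^ (1 / 22000 : ℝ)), ← Real.rpow_mul hd0'.le]
          norm_num
  have hsqrt : (d : ℝ) ^ (1 / 1000 : ℝ) * √d ≤ d * (h : ℝ) ^ (-(1.47 : ℝ)) := by
    calc (d : ℝ) ^ (1 / 1000 : ℝ) * √d = d * (d : ℝ) ^ (1 / 1000 - 1 / 2 : ℝ) := by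
          rw [Real.sqrt_eq_rpow, ← Real.rpow_add hd0']
          nth_rw 2 [← Real.rpow_one (d : ℝ)]
          rw [← Real.rpow_add hd0']
          norm_num
      _ ≤ d * ((h : ℝ) ^ (2.95 : ℝ)) ^ (1 / 1000 - 1 / 2 : ℝ) := by
          gcongr d * ?_
          exact Real.rpow_le_rpow_of_nonpos (by positivity) hhd.le (by norm_num)
      _ = d * (h : ℝ) ^ (2.95 * (1 / 1000 - 1 / 2) : ℝ) := by rw [← Real.rpow_mul hh0.le]
      _ ≤ _ := by
          gcongr d * ?_
          exact Real.rpow_le_rpow_of_exponent_le hh1 (by norm_num)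
  have hsq : (h : ℝ) ^ 2 ≤ (h : ℝ) ^ 4 * (h : ℝ) ^ (-(1.47 : ℝ)) := by
    calc (h : ℝ) ^ 2 = (h : ℝ) ^ 4 * (h : ℝ) ^ (-2 : ℝ) := by
          rw [← Real.rpow_natCast, ← Real.rpow_natCast, ← Real.rpow_add hh0]
          norm_num
      _ ≤ _ := by
          gcongr (h : ℝ) ^ 4 * ?_
          exact Real.rpow_le_rpow_of_exponent_le hh1 (by norm_num)
  calc ∑ x ∈ univM M, charSum d (x.val : ZMod d) h ^ 4
      ≤ ∑ x : ZMod M, charSum d (x.val : ZMod d) h ^ 4 :=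
        sum_le_sum_of_subset_of_nonneg (subset_univ _) fun _ _ _ => by positivity
    _ = (M / d : ℝ) * ∑ y : ZMod d, charSum d y h ^ 4 :=
        sum_comp_val hM hdvd fun y => charSum d y h ^ 4
    _ ≤ (M / d : ℝ) * (2 ^ 4 * h ^ 2 * d +
        12 * 177147 * (d.divisors.card : ℝ) ^ 22 * h ^ 4 * √d) := by
        gcongr
        simpa [charSum] using hmom
    _ ≤ (M / d : ℝ) * (2 ^ 4 * ((h : ℝ) ^ 4 * (h : ℝ) ^ (-(1.47 : ℝ))) * d +
        12 * 177147 * (K ^ 22 * (d : ℝ) ^ (1 / 1000 : ℝ)) * h ^ 4 * √d) := by gcongr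
    _ = (M / d : ℝ) * (2 ^ 4 * ((h : ℝ) ^ 4 * (h : ℝ) ^ (-(1.47 : ℝ))) * d +
        12 * 177147 * K ^ 22 * h ^ 4 * ((d : ℝ) ^ (1 / 1000 : ℝ) * √d)) := by ring
    _ ≤ (M / d : ℝ) * (2 ^ 4 * ((h : ℝ) ^ 4 * (h : ℝ) ^ (-(1.47 : ℝ))) * d +
        12 * 177147 * K ^ 22 * h ^ 4 * (d * (h : ℝ) ^ (-(1.47 : ℝ)))) := by gcongr
    _ = _ := by field_simp; norm_num

/-- The odd divisors of `M` larger than `T`. -/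
noncomputable def largeOddDivisors (M : ℕ) (T : ℝ) : Finset ℕ :=
  M.divisors.filter fun d : ℕ => Odd d ∧ T < (d : ℝ)

lemma half_pow_four_le {M : ℕ} [NeZero M] (hM : Squarefree M) {h : ℕ} {T : ℝ} (hT : 1 ≤ T)
    (hC : ∀ d ∈ M.divisors, Odd d → 1 < d → (d : ℝ) ≤ T →
      ∀ N : ZMod d, |charSum d N h| ≤ h / (2 * M.divisors.card))
    {x : ZMod M} (hx : x ∈ Nset M (range h)) :
    ((h : ℝ) / 2) ^ 4 ≤ (M.divisors.card : ℝ) ^ 3 *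
      ∑ d ∈ largeOddDivisors M T, charSum d (x.val : ZMod d) h ^ 4 := by
  have hτ : (0 : ℝ) < M.divisors.card := by
    exact_mod_cast card_pos.2 ⟨1, Nat.one_mem_divisors.2 hM.ne_zero⟩
  set F : ℕ → ℝ := fun d => charSum d (x.val : ZMod d) h with hF
  have hsum : ∑ d ∈ M.divisors with Odd d, F d = 0 := sum_charSum_eq_zero hM hx
  rw [← sum_filter_add_sum_filter_not _ fun d : ℕ => T < (d : ℝ), filter_filter,
    filter_filter, ← largeOddDivisors] at hsum
  have h1mem : 1 ∈ M.divisors.filter fun d : ℕ => Odd d ∧ ¬ T < (d : ℝ) :=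
    mem_filter.2 ⟨Nat.one_mem_divisors.2 hM.ne_zero, odd_one, by simpa using hT⟩
  rw [← add_sum_erase _ _ h1mem] at hsum
  have hF1 : F 1 = h := by simp [hF, charSum, jac]
  have hsmall : |∑ d ∈ (M.divisors.filter fun d : ℕ => Odd d ∧ ¬ T < (d : ℝ)).erase 1, F d| ≤
      h / 2 := by
    refine (abs_sum_le_sum_abs _ _).trans ?_
    refine (sum_le_card_nsmul _ _ ((h : ℝ) / (2 * M.divisors.card)) fun d hd => ?_).trans ?_
    · obtain ⟨hd1, hd2⟩ := mem_erase.1 hd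
      obtain ⟨hd3, hd4, hd5⟩ := mem_filter.1 hd2
      have := Nat.pos_of_mem_divisors hd3
      exact hC d hd3 hd4 (by omega) (not_lt.1 hd5) _
    · rw [nsmul_eq_mul]
      calc _ ≤ (M.divisors.card : ℝ) * (h / (2 * M.divisors.card)) := by
            gcongr
            exact (erase_subset _ _).trans (filter_subset _ _)
        _ = h / 2 := by field_simp
  have hlarge : (h : ℝ) / 2 ≤ ∑ d ∈ largeOddDivisors M T, |F d| := by
    refine le_trans ?_ (abs_sum_le_sum_abs _ _)
    rw [hF1] at hsum
    rw [abs_le] at hsmall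
    refine le_trans ?_ (neg_le_abs _)
    linarith
  calc ((h : ℝ) / 2) ^ 4 ≤ (∑ d ∈ largeOddDivisors M T, |F d|) ^ (3 + 1) :=
        pow_le_pow_left₀ (by positivity) hlarge 4
    _ ≤ ((largeOddDivisors M T).card : ℝ) ^ 3 *
        ∑ d ∈ largeOddDivisors M T, |F d| ^ (3 + 1) :=
        pow_sum_le_card_mul_sum_pow (fun _ _ => abs_nonneg _) 3
    _ = ((largeOddDivisors M T).card : ℝ) ^ 3 *
        ∑ d ∈ largeOddDivisors M T, F d ^ 4 := by
        simp_rw [show 3 + 1 = 4 from rfl, Even.pow_abs (by decide : Even 4)]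
    _ ≤ _ := by
        have hcard : ((largeOddDivisors M T).card : ℝ) ≤ M.divisors.card := by
          exact_mod_cast card_le_card (filter_subset _ _)
        exact mul_le_mul_of_nonneg_right (pow_le_pow_left₀ (Nat.cast_nonneg _) hcard 3)
          (sum_nonneg fun _ _ => Even.pow_nonneg (by decide) _)

end LongRuns

/-- Lemma 4.3: there are absolute constants `C, K > 0` such that for every square-free `M`
and every `h ≥ (2C·τ(M))^50`, the number of `x ∈ Z_M` such that `x, x+1, ..., x+h-1` are all
quadratic non-residues mod `M` is at most `K·M·τ(M)⁴·h^(-1.47)`. -/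
theorem stmt_12 :
    ∃ C K : ℝ, 0 < C ∧ 0 < K ∧
      ∀ M : ℕ, 0 < M → Squarefree M →
        ∀ h : ℕ, (2 * C * (M.divisors.card : ℝ)) ^ (50 : ℕ) ≤ (h : ℝ) →
          ((Nset M (Finset.range h)).card : ℝ) ≤
            K * M * ((M.divisors.card : ℝ)) ^ 4 * (h : ℝ) ^ (-(1.47 : ℝ)) := by
  obtain ⟨C, hC, hshort⟩ := exists_abs_charSum_le
  obtain ⟨K, hK, hmom⟩ := exists_fourth_moment_le
  refine ⟨C, 16 * K, by linarith, by linarith, fun M hM0 hM h hh => ?_⟩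
  have : NeZero M := ⟨hM.ne_zero⟩
  have hτ : (1 : ℝ) ≤ M.divisors.card := by
    exact_mod_cast card_pos.2 ⟨1, Nat.one_mem_divisors.2 hM.ne_zero⟩
  have hCτ : 1 ≤ 2 * C * (M.divisors.card : ℝ) := by nlinarith
  have hh1 : (1 : ℝ) ≤ h := (one_le_pow₀ hCτ).trans hh
  have hh0 : (0 : ℝ) < h := by linarith
  have hh1' : 1 ≤ h := by exact_mod_cast hh1
  have hroot : 2 * C * (M.divisors.card : ℝ) ≤ (h : ℝ) ^ (0.02 : ℝ) := by
    calc 2 * C * (M.divisors.card : ℝ)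
        = ((2 * C * (M.divisors.card : ℝ)) ^ 50) ^ (0.02 : ℝ) := by
          rw [← Real.rpow_natCast, ← Real.rpow_mul (by linarith)]
          norm_num
      _ ≤ _ := by gcongr
  set T : ℝ := (h : ℝ) ^ (2.95 : ℝ) with hT
  have hpoint : ∀ x ∈ Nset M (range h), ((h : ℝ) / 2) ^ 4 ≤ (M.divisors.card : ℝ) ^ 3 *
      ∑ d ∈ largeOddDivisors M T, charSum d (x.val : ZMod d) h ^ 4 := by
    refine fun x hx => half_pow_four_le hM (Real.one_le_rpow hh1 (by norm_num)) ?_ hx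
    intro d hd hodd hd1 hdT N
    refine (hshort d hodd (hM.squarefree_of_dvd (Nat.dvd_of_mem_divisors hd)) hd1 h hh1' hdT
      N).trans ?_
    rw [le_div_iff₀ (by positivity)]
    calc C * (h : ℝ) ^ (0.98 : ℝ) * (2 * M.divisors.card)
        = (h : ℝ) ^ (0.98 : ℝ) * (2 * C * M.divisors.card) := by ring
      _ ≤ (h : ℝ) ^ (0.98 : ℝ) * (h : ℝ) ^ (0.02 : ℝ) := by gcongr
      _ = h := by rw [← Real.rpow_add hh0]; norm_num
  have htotal : ((Nset M (range h)).card : ℝ) * ((h : ℝ) / 2) ^ 4 ≤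
      (M.divisors.card : ℝ) ^ 4 * (K * M * ((h : ℝ) ^ 4 * (h : ℝ) ^ (-(1.47 : ℝ)))) := by
    calc ((Nset M (range h)).card : ℝ) * ((h : ℝ) / 2) ^ 4
        = (Nset M (range h)).card • ((h : ℝ) / 2) ^ 4 := (nsmul_eq_mul _ _).symm
      _ ≤ ∑ x ∈ Nset M (range h), (M.divisors.card : ℝ) ^ 3 *
          ∑ d ∈ largeOddDivisors M T, charSum d (x.val : ZMod d) h ^ 4 :=
          card_nsmul_le_sum _ _ _ hpoint
      _ ≤ ∑ x ∈ univM M, (M.divisors.card : ℝ) ^ 3 *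
          ∑ d ∈ largeOddDivisors M T, charSum d (x.val : ZMod d) h ^ 4 :=
          sum_le_sum_of_subset_of_nonneg (filter_subset _ _) fun _ _ _ =>
            mul_nonneg (by positivity) (sum_nonneg fun _ _ => by positivity)
      _ = (M.divisors.card : ℝ) ^ 3 * ∑ d ∈ largeOddDivisors M T,
          ∑ x ∈ univM M, charSum d (x.val : ZMod d) h ^ 4 := by rw [← mul_sum, sum_comm]
      _ ≤ (M.divisors.card : ℝ) ^ 3 * ∑ d ∈ largeOddDivisors M T,
          K * M * ((h : ℝ) ^ 4 * (h : ℝ) ^ (-(1.47 : ℝ))) := by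
          gcongr with d hd
          obtain ⟨hd1, hd2, hd3⟩ := mem_filter.1 hd
          exact hmom M hM d hd1 hd2 h hh1' hd3
      _ ≤ (M.divisors.card : ℝ) ^ 3 * (M.divisors.card *
          (K * M * ((h : ℝ) ^ 4 * (h : ℝ) ^ (-(1.47 : ℝ))))) := by
          rw [sum_const, nsmul_eq_mul]
          gcongr
          exact filter_subset _ _
      _ = _ := by ring
  refine le_of_mul_le_mul_right ?_ (by positivity : 0 < ((h : ℝ) / 2) ^ 4)
  calc _ ≤ _ := htotal
    _ = _ := by ring
end

section
/- Let M be a positive integer, let R_M = {0 = r_1 < r_2 < ... < r_{|R_M|}} be the quadratic residues modulo M listed in increasing order, and let ν ≥ 0 be an integer. Then Σ (r_i − r_{i−1})², summed over those indices 2 ≤ i ≤ |R_M| with 2^{ν+1} ≤ r_i − r_{i−1} < 2^{ν+2}, is at most |N_M(2^ν)|·2^{ν+4}. -/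
open Finset

/-- The increasing list `0 = r_1 < r_2 < ... < r_(|R_M|)` of quadratic residues mod `M`
(with representatives in `{0, ..., M-1}`). -/
def resList (M : ℕ) : List ℕ := ((QR M).image ZMod.val).sort (· ≤ ·)

theorem mem_resList {M : ℕ} (hM : 0 < M) {y : ℕ} :
    y ∈ resList M ↔ y < M ∧ (y : ZMod M) ∈ QR M := by
  have : NeZero M := ⟨hM.ne'⟩
  simp only [resList, Finset.mem_sort, Finset.mem_image]
  constructor
  · rintro ⟨a, ha, rfl⟩
    exact ⟨ZMod.val_lt a, by simpa using ha⟩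
  · rintro ⟨hy, hq⟩
    exact ⟨_, hq, ZMod.val_cast_of_lt hy⟩

theorem mem_univM {M : ℕ} (hM : 0 < M) (x : ZMod M) : x ∈ univM M := by
  have : NeZero M := ⟨hM.ne'⟩
  exact Finset.mem_image.2 ⟨x.val, Finset.mem_range.2 (ZMod.val_lt x), by simp⟩

theorem resList_getD_mem {M j : ℕ} (hj : j < (resList M).length) :
    (resList M).getD j 0 ∈ resList M := by
  rw [List.getD_eq_getElem _ _ hj]
  exact List.getElem_mem hj

theorem resList_getD_lt {M i j : ℕ} (hij : i < j) (hj : j < (resList M).length) :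
    (resList M).getD i 0 < (resList M).getD j 0 := by
  rw [List.getD_eq_getElem _ _ hj, List.getD_eq_getElem _ _ (hij.trans hj)]
  have h : (resList M).SortedLT := Finset.sortedLT_sort _
  exact h.strictMono_get (a := ⟨i, hij.trans hj⟩) (b := ⟨j, hj⟩) hij

theorem resList_getD_le {M i j : ℕ} (hij : i ≤ j) (hj : j < (resList M).length) :
    (resList M).getD i 0 ≤ (resList M).getD j 0 := by
  rcases hij.eq_or_lt with rfl | h
  · exact le_rfl
  · exact (resList_getD_lt h hj).le

/-- No quadratic residue lies strictly between two consecutive entries of `resList M`. -/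
theorem notMem_QR_of_between {M j y : ℕ} (hM : 0 < M) (hj : j + 1 < (resList M).length)
    (h₁ : (resList M).getD j 0 < y) (h₂ : y < (resList M).getD (j + 1) 0) :
    (y : ZMod M) ∉ QR M := by
  intro hq
  have hlt := ((mem_resList hM).1 (resList_getD_mem hj)).1
  obtain ⟨k, hk, rfl⟩ := List.getElem_of_mem ((mem_resList hM).2 ⟨h₂.trans hlt, hq⟩)
  rw [← List.getD_eq_getElem _ 0 hk] at h₁ h₂
  rcases Nat.lt_or_ge j k with h | h
  · exact absurd (resList_getD_le h hk) (not_le.2 h₂)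
  · exact absurd (resList_getD_le h (by omega)) (not_le.2 h₁)

/-- Each gap of length at least `2 * H` contributes `H` elements to `N_M(H)`, and different gaps
contribute different elements. -/
theorem card_gaps_mul_le {M : ℕ} (hM : 0 < M) (H : ℕ) (S : Finset ℕ)
    (hS : ∀ j ∈ S, j + 1 < (resList M).length ∧
      (resList M).getD j 0 + 2 * H ≤ (resList M).getD (j + 1) 0) :
    S.card * H ≤ (Nset M (Finset.range H)).card := by
  have hcard : (S ×ˢ Finset.range H).card = S.card * H := by simp
  rw [← hcard]
  apply Finset.card_le_card_of_injOn
    (fun p => (((resList M).getD p.1 0 + 1 + p.2 : ℕ) : ZMod M))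
  · rintro ⟨j, t⟩ hp
    simp only [Finset.coe_product, Set.mem_prod, Finset.mem_coe, Finset.mem_range] at hp
    obtain ⟨hj, hg⟩ := hS j hp.1
    refine Finset.mem_coe.2 (Finset.mem_filter.2 ⟨mem_univM hM _, fun c hc => ?_⟩)
    rw [Finset.mem_range] at hc
    dsimp only
    rw [← Nat.cast_add]
    exact notMem_QR_of_between hM hj (by omega) (by omega)
  · rintro ⟨j, t⟩ hp ⟨k, u⟩ hq h
    simp only [Finset.coe_product, Set.mem_prod, Finset.mem_coe, Finset.mem_range] at hp hq
    obtain ⟨hj, hgj⟩ := hS j hp.1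
    obtain ⟨hk, hgk⟩ := hS k hq.1
    have hjM := ((mem_resList hM).1 (resList_getD_mem hj)).1
    have hkM := ((mem_resList hM).1 (resList_getD_mem hk)).1
    dsimp only at h
    have h' := (ZMod.natCast_eq_natCast_iff' _ _ _).1 h
    rw [Nat.mod_eq_of_lt (by omega), Nat.mod_eq_of_lt (by omega)] at h'
    rcases lt_trichotomy j k with hjk | rfl | hjk
    · have := resList_getD_le (M := M) (Nat.succ_le_of_lt hjk) (by omega)
      simp only [Nat.succ_eq_add_one] at this
      omega
    · simp only [Prod.mk.injEq, true_and]
      omega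
    · have := resList_getD_le (M := M) (Nat.succ_le_of_lt hjk) (by omega)
      simp only [Nat.succ_eq_add_one] at this
      omega

/-- Lemma 4.5: `Σ (r_i - r_(i-1))²`, summed over the consecutive gaps of `R_M` lying in
`[2^(ν+1), 2^(ν+2))`, is at most `|N_M(2^ν)|·2^(ν+4)`. -/
theorem stmt_13 (M : ℕ) (hM : 0 < M) (ν : ℕ) :
    ∑ j ∈ (Finset.range ((resList M).length - 1)).filter
        (fun j => 2 ^ (ν + 1) ≤ (resList M).getD (j + 1) 0 - (resList M).getD j 0 ∧
          (resList M).getD (j + 1) 0 - (resList M).getD j 0 < 2 ^ (ν + 2)),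
      ((resList M).getD (j + 1) 0 - (resList M).getD j 0) ^ 2 ≤
      (Nset M (Finset.range (2 ^ ν))).card * 2 ^ (ν + 4) := by
  refine (Finset.sum_le_card_nsmul _ _ (2 ^ ν * 2 ^ (ν + 4)) fun j hj => ?_).trans ?_
  · have h := (Finset.mem_filter.1 hj).2.2.le
    calc _ ≤ (2 ^ (ν + 2)) ^ 2 := Nat.pow_le_pow_left h 2
      _ = 2 ^ ν * 2 ^ (ν + 4) := by ring
  · rw [smul_eq_mul, ← mul_assoc]
    refine Nat.mul_le_mul_right _ (card_gaps_mul_le hM _ _ fun j hj => ?_)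
    simp only [Finset.mem_filter, Finset.mem_range] at hj
    obtain ⟨hj, hg, -⟩ := hj
    have hpos : 0 < 2 ^ ν := by positivity
    rw [pow_succ] at hg
    omega
end
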